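/- arXiv:0812.4963 — 3 statements merged into one kernel-verified Lean document; each statement's English description precedes it below -/
import Mathlib

section
/- With notation as in the context: (a) the ideals y^n·(𝒜A) and g·K^{(n)} of A are equal; (b) the elements y^n and g of S do not lie in H; (c) the bi-graded A-modules 𝒜A and K^{(n)}(0,−1) are isomorphic (where the shift is with respect to the bi-grading with deg x = deg y = (1,0) and deg T_i = (0,1)). -/
set_option maxHeartbeats 1000000
set_option synthInstance.maxHeartbeats 400000

open MvPolynomial

/-!
Common setup: `R = k[x,y]` (with `x = X 0`, `y = X 1`),
`S = R[T₁,…,T_m] = k[x,y,T₀,…,T_{m-1}]` (`m = m2 + 2`, variables `Fin 2 ⊕ Fin m`,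
`x = X (inl 0)`, `y = X (inl 1)`, `Tᵢ = X (inr i)`, 0-indexed).
`S` is bi-graded with `deg x = deg y = (1,0)`, `deg Tᵢ = (0,1)`.
The ideal `I` is generated by the signed maximal minors of the `m × (m−1)`
Hilbert–Burch matrix `φ = [φ' φ'']` whose linear part `φ'` is the block matrix with
diagonal blocks `D_{σ₁}` (and `D_{σ₂}`, the splitting being encoded by `σ₁` alone),
where `D_a` has `x` on the main diagonal and `−y` on the subdiagonal, and whose last
column `φ''` has entries of degree `n`.
-/

/-- The variable `Tᵢ` of `S` (0-indexed); junk value `0` if `i` is out of range. -/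
noncomputable def Tvar (k : Type*) [Field k] (m : ℕ) (i : ℕ) :
    MvPolynomial (Fin 2 ⊕ Fin m) k :=
  if h : i < m then X (Sum.inr ⟨i, h⟩) else 0

/-- The Hilbert–Burch matrix `φ = [φ' φ'']`: the linear part `φ'` is the block
diagonal matrix with blocks `D_{σ₁}` and `D_{m2-σ₁}` (a single block `D_{m2}` with a
zero row when `σ₁ = m2`, i.e. `ρ = 1`), and the last column is `col = φ''`. -/
noncomputable def hbMatrix (k : Type*) [Field k] (m2 σ₁ : ℕ)
    (col : Fin (m2 + 2) → MvPolynomial (Fin 2) k) :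
    Matrix (Fin (m2 + 2)) (Fin (m2 + 1)) (MvPolynomial (Fin 2) k) :=
  Matrix.of fun i j =>
    if (j : ℕ) = m2 then col i
    else if (j : ℕ) < σ₁ then
      (if (i : ℕ) = (j : ℕ) then X 0 else if (i : ℕ) = (j : ℕ) + 1 then -(X 1) else 0)
    else
      (if (i : ℕ) = (j : ℕ) + 1 then X 0 else if (i : ℕ) = (j : ℕ) + 2 then -(X 1) else 0)

/-- The signed maximal minors `δᵢ` of the Hilbert–Burch matrix: the generators of `I`. -/
noncomputable def hbDelta (k : Type*) [Field k] (m2 σ₁ : ℕ)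
    (col : Fin (m2 + 2) → MvPolynomial (Fin 2) k) (i : Fin (m2 + 2)) :
    MvPolynomial (Fin 2) k :=
  (-1) ^ (i : ℕ) * ((hbMatrix k m2 σ₁ col).submatrix i.succAbove id).det

/-- The ideal `I ⊆ R` generated by the maximal minors of the Hilbert-Burch matrix. -/
noncomputable def hbIdeal (k : Type*) [Field k] (m2 σ₁ : ℕ)
    (col : Fin (m2 + 2) → MvPolynomial (Fin 2) k) : Ideal (MvPolynomial (Fin 2) k) :=
  Ideal.span (Set.range (hbDelta k m2 σ₁ col))

/-- The map `Π : S → R[t] = R[It]`, `x,y ↦ x,y`, `Tᵢ ↦ δᵢ t`. -/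
noncomputable def PiRees (k : Type*) [Field k] (m2 σ₁ : ℕ)
    (col : Fin (m2 + 2) → MvPolynomial (Fin 2) k) :
    MvPolynomial (Fin 2 ⊕ Fin (m2 + 2)) k →ₐ[k] Polynomial (MvPolynomial (Fin 2) k) :=
  aeval (Sum.elim (fun i => Polynomial.C (X i))
    (fun i => Polynomial.C (hbDelta k m2 σ₁ col i) * Polynomial.X))

/-- The defining ideal `𝒜 = ker Π` of the Rees algebra `𝓡(I) = R[It]`. -/
noncomputable def reesDefIdeal (k : Type*) [Field k] (m2 σ₁ : ℕ)
    (col : Fin (m2 + 2) → MvPolynomial (Fin 2) k) :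
    Ideal (MvPolynomial (Fin 2 ⊕ Fin (m2 + 2)) k) :=
  RingHom.ker (PiRees k m2 σ₁ col).toRingHom

/-- Top row of the scroll matrix `ψ = [ψ₁ ⋯ ψ_ρ ψ_{ρ+1}]`, where `ψᵢ` (`i ≤ ρ`) is the
generic scroll block on the variables `T_{i,1},…,T_{i,σᵢ+1}` and `ψ_{ρ+1} = (y,x)ᵀ`.
(The relabelling `T_{1,j} = T_j`, `T_{2,j} = T_{σ₁+1+j}` is built in; only `σ₁` and
`m2 = σ₁ + ⋯ + σ_ρ` are needed to describe `ψ`.) -/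
noncomputable def psiTop (k : Type*) [Field k] (m2 σ₁ : ℕ) (j : Fin (m2 + 1)) :
    MvPolynomial (Fin 2 ⊕ Fin (m2 + 2)) k :=
  if (j : ℕ) = m2 then X (Sum.inl 1)
  else if (j : ℕ) < σ₁ then Tvar k (m2 + 2) (j : ℕ) else Tvar k (m2 + 2) ((j : ℕ) + 1)

/-- Bottom row of the scroll matrix `ψ`. -/
noncomputable def psiBot (k : Type*) [Field k] (m2 σ₁ : ℕ) (j : Fin (m2 + 1)) :
    MvPolynomial (Fin 2 ⊕ Fin (m2 + 2)) k :=
  if (j : ℕ) = m2 then X (Sum.inl 0)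
  else if (j : ℕ) < σ₁ then Tvar k (m2 + 2) ((j : ℕ) + 1) else Tvar k (m2 + 2) ((j : ℕ) + 2)

/-- `H = I₂(ψ) ⊆ S`. -/
noncomputable def scrollH (k : Type*) [Field k] (m2 σ₁ : ℕ) :
    Ideal (MvPolynomial (Fin 2 ⊕ Fin (m2 + 2)) k) :=
  Ideal.span {p | ∃ j j' : Fin (m2 + 1),
    p = psiTop k m2 σ₁ j * psiBot k m2 σ₁ j' - psiTop k m2 σ₁ j' * psiBot k m2 σ₁ j}

/-- The height one prime ideal `K ⊆ A = S/H` generated by the entries of the top row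
of `ψ`. -/
noncomputable def scrollK (k : Type*) [Field k] (m2 σ₁ : ℕ) :
    Ideal (MvPolynomial (Fin 2 ⊕ Fin (m2 + 2)) k ⧸ scrollH k m2 σ₁) :=
  Ideal.span (Set.range fun j : Fin (m2 + 1) =>
    Ideal.Quotient.mk (scrollH k m2 σ₁) (psiTop k m2 σ₁ j))

/-- The `n`-th symbolic power of an ideal `K` of `A` (for `K` prime this is
`K^{(n)} = ⋃_{s ∉ K} (Kⁿ :_A s)`, the `K`-primary component of `Kⁿ`). -/
noncomputable def symbolicPower {A : Type*} [CommRing A] (K : Ideal A) (n : ℕ) :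
    Ideal A :=
  sSup {J : Ideal A | ∃ s : A, s ∉ K ∧ J = Submodule.colon (K ^ n) (Ideal.span {s})}

/-- `g = T·φ'' = Σᵢ Tᵢ·φ''ᵢ ∈ S`. -/
noncomputable def scrollg (k : Type*) [Field k] (m2 : ℕ)
    (col : Fin (m2 + 2) → MvPolynomial (Fin 2) k) :
    MvPolynomial (Fin 2 ⊕ Fin (m2 + 2)) k :=
  ∑ i : Fin (m2 + 2), X (Sum.inr i) * rename Sum.inl (col i)

/-- Bi-homogeneity in `S`, with `deg x = deg y = (1,0)` and `deg Tᵢ = (0,1)`. -/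
def IsBiHomogeneous {k : Type*} [Field k] {m : ℕ}
    (p : MvPolynomial (Fin 2 ⊕ Fin m) k) (u s : ℕ) : Prop :=
  IsWeightedHomogeneous (Sum.elim (fun _ : Fin 2 => 1) (fun _ : Fin m => 0)) p u ∧
  IsWeightedHomogeneous (Sum.elim (fun _ : Fin 2 => 0) (fun _ : Fin m => 1)) p s

/-- An element of `A = S/H` is bi-homogeneous of bidegree `(u,s)` if it is the image of
a bi-homogeneous element of `S` of bidegree `(u,s)`. -/
def IsBiHomogeneousQuot {k : Type*} [Field k] {m2 σ₁ : ℕ}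
    (a : MvPolynomial (Fin 2 ⊕ Fin (m2 + 2)) k ⧸ scrollH k m2 σ₁) (u s : ℕ) : Prop :=
  ∃ p : MvPolynomial (Fin 2 ⊕ Fin (m2 + 2)) k,
    IsBiHomogeneous p u s ∧ Ideal.Quotient.mk (scrollH k m2 σ₁) p = a

/-- The height of an ideal: the infimum of the heights of the primes containing it. -/
noncomputable def idealHeight {R : Type*} [CommRing R] (I : Ideal R) : ℕ∞ :=
  ⨅ (p : PrimeSpectrum R) (_ : I ≤ p.asIdeal), Order.height p

/-- The hypotheses on the numerical data: `σ₁ ≥ 1`, `n ≥ 2`, and either `ρ = 1` (a single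
block `D_{σ₁}`, `σ₁ = m−2`; by convention `σ₂ = 1` in this case) or `ρ = 2`
(two blocks, `σ₁ ≥ σ₂ ≥ 1`, `σ₁ + σ₂ = m−2`). -/
def ScrollData (m2 σ₁ σ₂ ρ n : ℕ) : Prop :=
  1 ≤ σ₁ ∧ 2 ≤ n ∧
    ((ρ = 1 ∧ σ₁ = m2 ∧ σ₂ = 1) ∨ (ρ = 2 ∧ 1 ≤ σ₂ ∧ σ₂ ≤ σ₁ ∧ σ₁ + σ₂ = m2))

/-- The context hypotheses on the ideal `I`: the entries of `φ''` are forms of degree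
`n`, `I` has height two and is minimally generated by the `m` maximal minors `δᵢ`. -/
def ScrollIdealData (k : Type*) [Field k] (m2 σ₁ n : ℕ)
    (col : Fin (m2 + 2) → MvPolynomial (Fin 2) k) : Prop :=
  (∀ i, (col i).IsHomogeneous n) ∧
  idealHeight (hbIdeal k m2 σ₁ col) = 2 ∧
  (∀ i, hbDelta k m2 σ₁ col i ∉
    Ideal.span (hbDelta k m2 σ₁ col '' {i' | i' ≠ i}))

namespace ScrollExchange

variable {A κ : Type*} [CommRing A] {size : κ → ℕ} {V : κ → ℕ → A}

theorem exchange_pair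
    (hV : ∀ c d i j, i < size c → j < size d → V c (i + 1) * V d j = V c i * V d (j + 1))
    {c d : κ} {i j : ℕ} (r : ℕ) (hc : i + r ≤ size c) (hd : j + r ≤ size d) :
    V c (i + r) * V d j = V c i * V d (j + r) := by
  induction r generalizing i with
  | zero => rfl
  | succ r ih =>
    have h := ih (i := i + 1) (by omega) (by omega)
    rw [show i + (r + 1) = i + 1 + r by omega, h, hV c d i (j + r) (by omega) (by omega)]
    rfl

/-- Index can be transferred from a product of letters to a given letter. -/
theorem exchange_prod
    (hV : ∀ c d i j, i < size c → j < size d → V c (i + 1) * V d j = V c i * V d (j + 1))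
    (s : Multiset (κ × ℕ)) (hs : ∀ p ∈ s, p.2 ≤ size p.1) (c : κ) (j r : ℕ)
    (hr : r ≤ (s.map Prod.snd).sum) (hc : j + r ≤ size c) :
    ∃ s' : Multiset (κ × ℕ), (∀ p ∈ s', p.2 ≤ size p.1) ∧ s'.map Prod.fst = s.map Prod.fst ∧
      (s'.map Prod.snd).sum + r = (s.map Prod.snd).sum ∧
      V c j * (s.map fun p => V p.1 p.2).prod = V c (j + r) * (s'.map fun p => V p.1 p.2).prod := by
  induction s using Multiset.induction_on generalizing j r with
  | empty => exact ⟨0, by simp_all⟩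
  | cons a s ih =>
    obtain ⟨d, i⟩ := a
    have hdi : i ≤ size d := hs (d, i) (Multiset.mem_cons_self _ _)
    have hs' : ∀ p ∈ s, p.2 ≤ size p.1 := fun p hp => hs p (Multiset.mem_cons_of_mem hp)
    simp only [Multiset.map_cons, Multiset.sum_cons] at hr
    obtain ⟨a, b, ha, hb, rfl⟩ : ∃ a b, a ≤ i ∧ b ≤ (s.map Prod.snd).sum ∧ r = a + b :=
      ⟨min i r, r - min i r, by omega, by omega, by omega⟩
    obtain ⟨s', h1, h2, h3, h4⟩ := ih hs' (j + a) b hb (by omega)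
    refine ⟨(d, i - a) ::ₘ s', ?_, ?_, ?_, ?_⟩
    · intro p hp
      rcases Multiset.mem_cons.1 hp with rfl | hp
      · simp only; omega
      · exact h1 p hp
    · simp [h2]
    · simp only [Multiset.map_cons, Multiset.sum_cons]; omega
    · have h5 := exchange_pair hV (c := c) (d := d) (i := j) (j := i - a) a (by omega) (by omega)
      rw [Nat.sub_add_cancel ha] at h5
      simp only [Multiset.map_cons, Multiset.prod_cons]
      rw [← mul_assoc, ← h5, ← add_assoc]
      linear_combination V d (i - a) * h4

/-- In a ring where the exchange relations hold, a product of letters depends only on the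
classes of the letters and on the sum of their indices. -/
theorem prod_eq_prod
    (hV : ∀ c d i j, i < size c → j < size d → V c (i + 1) * V d j = V c i * V d (j + 1))
    (s s' : Multiset (κ × ℕ)) (hs : ∀ p ∈ s, p.2 ≤ size p.1) (hs' : ∀ p ∈ s', p.2 ≤ size p.1)
    (hfst : s.map Prod.fst = s'.map Prod.fst)
    (hsnd : (s.map Prod.snd).sum = (s'.map Prod.snd).sum) :
    (s.map fun p => V p.1 p.2).prod = (s'.map fun p => V p.1 p.2).prod := by
  induction hn : s.card generalizing s s' with
  | zero =>
    obtain rfl := Multiset.card_eq_zero.1 hn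
    have : s' = 0 := by simpa using hfst.symm
    rw [this]
  | succ N ih =>
    obtain ⟨⟨c, i⟩, s, rfl⟩ : ∃ a t, s = a ::ₘ t := by
      obtain ⟨a, ha⟩ := Multiset.card_pos_iff_exists_mem.1 (by omega : 0 < s.card)
      exact ⟨a, Multiset.exists_cons_of_mem ha⟩
    obtain ⟨⟨c', i'⟩, hmem, rfl⟩ : ∃ p ∈ s', p.1 = c := by
      have : c ∈ s'.map Prod.fst := by rw [← hfst]; simp
      simpa using this
    obtain ⟨s', rfl⟩ := Multiset.exists_cons_of_mem hmem
    simp only [Multiset.map_cons, Multiset.sum_cons, Multiset.prod_cons] at *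
    have hi := hs (c', i) (Multiset.mem_cons_self _ _)
    have hi' := hs' (c', i') (Multiset.mem_cons_self _ _)
    have hfst' := (Multiset.cons_inj_right _).1 hfst
    simp only at hi hi'
    rcases le_total i i' with h | h
    · obtain ⟨t, h1, h2, h3, h4⟩ := exchange_prod hV s
        (fun p hp => hs p (Multiset.mem_cons_of_mem hp)) c' i (i' - i) (by omega) (by omega)
      rw [h4, Nat.add_sub_cancel' h, ih t s' h1 (fun p hp => hs' p (Multiset.mem_cons_of_mem hp))
        (h2.trans hfst') (by omega)]
      rw [← Multiset.card_map Prod.fst, h2, Multiset.card_map]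
      simpa using hn
    · obtain ⟨t, h1, h2, h3, h4⟩ := exchange_prod hV s'
        (fun p hp => hs' p (Multiset.mem_cons_of_mem hp)) c' i' (i - i') (by omega) (by omega)
      rw [h4, Nat.add_sub_cancel' h, ih s t (fun p hp => hs p (Multiset.mem_cons_of_mem hp)) h1
        (hfst'.trans h2.symm) (by omega)]
      simpa using hn

end ScrollExchange

/-- A `k`-algebra map sending monomials to monomials has its kernel inside `I` as soon as
monomials with the same image are congruent modulo `I`. -/
theorem ker_le_of_monomial {k ι τ : Type*} [Field k] (θ : MvPolynomial ι k →ₐ[k] MvPolynomial τ k)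
    (I : Ideal (MvPolynomial ι k)) (E : (ι →₀ ℕ) → (τ →₀ ℕ))
    (hE : ∀ d, θ (monomial d 1) = monomial (E d) 1)
    (h : ∀ d d', E d = E d' →
      Ideal.Quotient.mk I (monomial d 1) = Ideal.Quotient.mk I (monomial d' 1)) :
    RingHom.ker θ ≤ I := by
  classical
  let ν : MvPolynomial τ k →ₗ[k] MvPolynomial ι k ⧸ I :=
    (basisMonomials τ k).constr k fun e =>
      if he : ∃ d, E d = e then Ideal.Quotient.mk I (monomial he.choose 1) else 0
  have hν : ν ∘ₗ θ.toLinearMap = (Ideal.Quotient.mkₐ k I).toLinearMap := by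
    refine (basisMonomials ι k).ext fun d => ?_
    have he : ∃ d', E d' = E d := ⟨d, rfl⟩
    have : ν (monomial (E d) 1) = Ideal.Quotient.mk I (monomial d 1) := by
      have := (basisMonomials τ k).constr_basis k (fun e =>
        if he : ∃ d, E d = e then Ideal.Quotient.mk I (monomial he.choose 1) else 0) (E d)
      rw [coe_basisMonomials] at this
      simp only [ν]
      rw [this, dif_pos he]
      exact h _ _ he.choose_spec
    simpa [hE] using this
  intro f hf
  have h1 := LinearMap.congr_fun hν f
  have h2 : θ f = 0 := hf
  rw [← Ideal.Quotient.eq_zero_iff_mem]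
  simpa [h2] using h1.symm

namespace Scroll

/-- The sizes of the three blocks `(y,x)`, `ψ₁`, `ψ₂` of the scroll. -/
def size (m2 σ₁ : ℕ) : Fin 3 → ℕ := ![1, σ₁, m2 - σ₁]

/-- The block of a variable of `S` and its position in that block. -/
def letter (m2 σ₁ : ℕ) : Fin 2 ⊕ Fin (m2 + 2) → Fin 3 × ℕ
  | Sum.inl i => (0, if i = 0 then 1 else 0)
  | Sum.inr i => if (i : ℕ) ≤ σ₁ then (1, i) else (2, i - (σ₁ + 1))

/-- The variable of `S` in a given block at a given position. -/
noncomputable def letterVar (k : Type*) [Field k] (m2 σ₁ : ℕ) (c : Fin 3) (i : ℕ) :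
    MvPolynomial (Fin 2 ⊕ Fin (m2 + 2)) k :=
  ![if i = 0 then X (Sum.inl 1) else X (Sum.inl 0), Tvar k (m2 + 2) i,
    Tvar k (m2 + 2) (σ₁ + 1 + i)] c

/-- The exponent of the monomial parametrizing a variable of `S`. -/
noncomputable def letterExp (m2 σ₁ : ℕ) (p : Fin 3 × ℕ) : Fin 2 ⊕ Fin 2 →₀ ℕ :=
  Finsupp.single (Sum.inl 0) p.2 + Finsupp.single (Sum.inl 1) (size m2 σ₁ p.1 - p.2) +
    (![0, Finsupp.single (Sum.inr 0) 1, Finsupp.single (Sum.inr 1) 1] : Fin 3 → _) p.1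

/-- The monomial parametrization of the rational normal scroll. -/
noncomputable def theta (k : Type*) [Field k] (m2 σ₁ : ℕ) :
    MvPolynomial (Fin 2 ⊕ Fin (m2 + 2)) k →ₐ[k] MvPolynomial (Fin 2 ⊕ Fin 2) k :=
  aeval fun v => monomial (letterExp m2 σ₁ (letter m2 σ₁ v)) 1

/-- The action of `theta` on exponents. -/
noncomputable def thetaExp (m2 σ₁ : ℕ) (d : Fin 2 ⊕ Fin (m2 + 2) →₀ ℕ) : Fin 2 ⊕ Fin 2 →₀ ℕ :=
  ((d.toMultiset.map (letter m2 σ₁)).map (letterExp m2 σ₁)).sum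

variable {k : Type*} [Field k] {m2 σ₁ : ℕ}

theorem letter_le (h : σ₁ ≤ m2) (v : Fin 2 ⊕ Fin (m2 + 2)) :
    (letter m2 σ₁ v).2 ≤ size m2 σ₁ (letter m2 σ₁ v).1 := by
  rcases v with i | i
  · simp only [letter, size]; split_ifs <;> simp
  · have := i.2
    simp only [letter, size]; split_ifs <;> simp <;> omega

theorem letterVar_letter (v : Fin 2 ⊕ Fin (m2 + 2)) :
    letterVar k m2 σ₁ (letter m2 σ₁ v).1 (letter m2 σ₁ v).2 = X v := by
  rcases v with i | i
  · fin_cases i <;> simp [letter, letterVar]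
  · by_cases h : (i : ℕ) ≤ σ₁
    · simp [letter, letterVar, Tvar, h]
    · have : σ₁ + 1 + ((i : ℕ) - (σ₁ + 1)) = i := by omega
      simp [letter, letterVar, Tvar, h, this]

theorem exists_psi_eq (h : σ₁ ≤ m2) (c : Fin 3) (i : ℕ) (hi : i < size m2 σ₁ c) :
    ∃ j, psiTop k m2 σ₁ j = letterVar k m2 σ₁ c i ∧
      psiBot k m2 σ₁ j = letterVar k m2 σ₁ c (i + 1) := by
  fin_cases c
  · obtain rfl : i = 0 := by simpa [size] using hi
    exact ⟨⟨m2, by omega⟩, by simp [psiTop, letterVar], by simp [psiBot, letterVar]⟩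
  · have hi : i < σ₁ := by simpa [size] using hi
    have : i ≠ m2 := by omega
    exact ⟨⟨i, by omega⟩, by simp [psiTop, letterVar, hi, this],
      by simp [psiBot, letterVar, hi, this]⟩
  · have hi : i < m2 - σ₁ := by simpa [size] using hi
    have : σ₁ + i ≠ m2 := by omega
    refine ⟨⟨σ₁ + i, by omega⟩, ?_, ?_⟩
    · simp only [psiTop, letterVar]
      rw [if_neg this, if_neg (by simp)]
      simp only [Fin.reduceFinMk, Matrix.cons_val]; congr 1; omega
    · simp only [psiBot, letterVar]
      rw [if_neg this, if_neg (by simp)]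
      simp only [Fin.reduceFinMk, Matrix.cons_val]; congr 1; omega

theorem exists_letterVar_eq (h : σ₁ ≤ m2) (j : Fin (m2 + 1)) :
    ∃ c i, i < size m2 σ₁ c ∧ psiTop k m2 σ₁ j = letterVar k m2 σ₁ c i ∧
      psiBot k m2 σ₁ j = letterVar k m2 σ₁ c (i + 1) := by
  have hj := j.2
  by_cases h1 : (j : ℕ) = m2
  · exact ⟨0, 0, by simp [size], by simp [psiTop, letterVar, h1], by simp [psiBot, letterVar, h1]⟩
  · by_cases h2 : (j : ℕ) < σ₁
    · exact ⟨1, j, by simpa [size], by simp [psiTop, letterVar, h1, h2],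
        by simp [psiBot, letterVar, h1, h2]⟩
    · refine ⟨2, j - σ₁, by simp [size]; omega, ?_, ?_⟩
      · simp only [psiTop, letterVar]
        rw [if_neg h1, if_neg h2]
        simp only [Matrix.cons_val]; congr 1; omega
      · simp only [psiBot, letterVar]
        rw [if_neg h1, if_neg h2]
        simp only [Matrix.cons_val]; congr 1; omega

theorem mk_exchange (h : σ₁ ≤ m2) (c d : Fin 3) (i j : ℕ) (hi : i < size m2 σ₁ c)
    (hj : j < size m2 σ₁ d) :
    Ideal.Quotient.mk (scrollH k m2 σ₁) (letterVar k m2 σ₁ c (i + 1)) *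
        Ideal.Quotient.mk (scrollH k m2 σ₁) (letterVar k m2 σ₁ d j) =
      Ideal.Quotient.mk (scrollH k m2 σ₁) (letterVar k m2 σ₁ c i) *
        Ideal.Quotient.mk (scrollH k m2 σ₁) (letterVar k m2 σ₁ d (j + 1)) := by
  obtain ⟨a, ha, ha'⟩ := exists_psi_eq (k := k) h c i hi
  obtain ⟨b, hb, hb'⟩ := exists_psi_eq (k := k) h d j hj
  rw [← map_mul, ← map_mul, Ideal.Quotient.eq, ← ha, ← ha', ← hb, ← hb']
  exact Ideal.subset_span ⟨b, a, by ring⟩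

theorem theta_monomial (d : Fin 2 ⊕ Fin (m2 + 2) →₀ ℕ) :
    theta k m2 σ₁ (monomial d 1) = monomial (thetaExp m2 σ₁ d) 1 := by
  induction d using Finsupp.induction_linear with
  | zero => simp [thetaExp]
  | add f g hf hg =>
    rw [← one_mul (1 : k), ← monomial_mul, map_mul, hf, hg, monomial_mul]
    simp [thetaExp]
  | single v n =>
    rw [← X_pow_eq_monomial, map_pow, theta, aeval_X, monomial_pow]
    simp [thetaExp, Multiset.map_nsmul, Multiset.sum_nsmul]

theorem mk_monomial (d : Fin 2 ⊕ Fin (m2 + 2) →₀ ℕ) :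
    Ideal.Quotient.mk (scrollH k m2 σ₁) (monomial d 1) =
      ((d.toMultiset.map (letter m2 σ₁)).map fun p =>
        Ideal.Quotient.mk (scrollH k m2 σ₁) (letterVar k m2 σ₁ p.1 p.2)).prod := by
  induction d using Finsupp.induction_linear with
  | zero => simp
  | add f g hf hg =>
    rw [← one_mul (1 : k), ← monomial_mul, map_mul, hf, hg]
    simp
  | single v n =>
    rw [← X_pow_eq_monomial, map_pow]
    simp [Multiset.map_nsmul, Multiset.prod_nsmul, letterVar_letter]

theorem sum_letterExp (s : Multiset (Fin 3 × ℕ)) (hs : ∀ p ∈ s, p.2 ≤ size m2 σ₁ p.1) :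
    (s.map (letterExp m2 σ₁)).sum (Sum.inl 0) = (s.map Prod.snd).sum ∧
    (s.map (letterExp m2 σ₁)).sum (Sum.inr 0) = (s.map Prod.fst).count 1 ∧
    (s.map (letterExp m2 σ₁)).sum (Sum.inr 1) = (s.map Prod.fst).count 2 ∧
    (s.map (letterExp m2 σ₁)).sum (Sum.inl 0) + (s.map (letterExp m2 σ₁)).sum (Sum.inl 1) =
      (s.map Prod.fst).count 0 + σ₁ * (s.map Prod.fst).count 1 +
        (m2 - σ₁) * (s.map Prod.fst).count 2 := by
  induction s using Multiset.induction_on with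
  | empty => simp
  | cons a s ih =>
    obtain ⟨h1, h2, h3, h4⟩ := ih fun p hp => hs p (Multiset.mem_cons_of_mem hp)
    have ha := hs a (Multiset.mem_cons_self _ _)
    obtain ⟨c, i⟩ := a
    simp only [Multiset.map_cons, Multiset.sum_cons, Multiset.count_cons, Finsupp.add_apply,
      h1, h2, h3] at h4 ⊢
    fin_cases c
    · simp [letterExp, size] at ha ⊢; omega
    · simp [letterExp, size, mul_add] at ha ⊢; omega
    · simp [letterExp, size, mul_add] at ha ⊢; omega

theorem ker_theta_le (h : σ₁ ≤ m2) : RingHom.ker (theta k m2 σ₁) ≤ scrollH k m2 σ₁ := by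
  refine ker_le_of_monomial _ _ (thetaExp m2 σ₁) theta_monomial fun d d' hd => ?_
  rw [mk_monomial, mk_monomial]
  have hl : ∀ d : Fin 2 ⊕ Fin (m2 + 2) →₀ ℕ, ∀ p ∈ d.toMultiset.map (letter m2 σ₁),
      p.2 ≤ size m2 σ₁ p.1 := by
    intro d p hp
    obtain ⟨v, -, rfl⟩ := Multiset.mem_map.1 hp
    exact letter_le h v
  obtain ⟨h1, h2, h3, h4⟩ := sum_letterExp _ (hl d)
  obtain ⟨h1', h2', h3', h4'⟩ := sum_letterExp _ (hl d')
  have e : ∀ v, _ = _ := DFunLike.congr_fun hd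
  simp only [thetaExp] at e
  rw [← e] at h1' h2' h3' h4'
  rw [← e, h4, ← h2', h2, ← h3', h3] at h4'
  refine ScrollExchange.prod_eq_prod (size := size m2 σ₁) (V := fun c i =>
    Ideal.Quotient.mk (scrollH k m2 σ₁) (letterVar k m2 σ₁ c i)) (mk_exchange h) _ _ (hl d) (hl d')
    (Multiset.ext.2 fun c => ?_) (h1.symm.trans h1')
  fin_cases c
  · simpa using h4'
  · exact h2.symm.trans h2'
  · exact h3.symm.trans h3'

theorem theta_letterVar (h : σ₁ ≤ m2) (c : Fin 3) (i : ℕ) (hi : i ≤ size m2 σ₁ c) :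
    theta k m2 σ₁ (letterVar k m2 σ₁ c i) = monomial (letterExp m2 σ₁ (c, i)) 1 := by
  obtain ⟨v, hv⟩ : ∃ v, letter m2 σ₁ v = (c, i) := by
    fin_cases c
    · have hi : i ≤ 1 := by simpa [size] using hi
      interval_cases i
      · exact ⟨Sum.inl 1, by simp [letter]⟩
      · exact ⟨Sum.inl 0, by simp [letter]⟩
    · have hi : i ≤ σ₁ := by simpa [size] using hi
      exact ⟨Sum.inr ⟨i, by omega⟩, by simp [letter, hi]⟩
    · have hi : i ≤ m2 - σ₁ := by simpa [size] using hi
      exact ⟨Sum.inr ⟨σ₁ + 1 + i, by omega⟩, by simp [letter]; omega⟩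
  have := letterVar_letter (k := k) (σ₁ := σ₁) v
  rw [hv] at this
  simp only at this
  rw [this, theta, aeval_X, hv]

/-- The common factor of the images of the entries of a column of `ψ`. -/
noncomputable def colExp (m2 σ₁ : ℕ) (p : Fin 3 × ℕ) : Fin 2 ⊕ Fin 2 →₀ ℕ :=
  Finsupp.single (Sum.inl 0) p.2 + Finsupp.single (Sum.inl 1) (size m2 σ₁ p.1 - 1 - p.2) +
    (![0, Finsupp.single (Sum.inr 0) 1, Finsupp.single (Sum.inr 1) 1] : Fin 3 → _) p.1

theorem theta_top (h : σ₁ ≤ m2) (c : Fin 3) (i : ℕ) (hi : i < size m2 σ₁ c) :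
    theta k m2 σ₁ (letterVar k m2 σ₁ c i) =
      X (Sum.inl 1) * monomial (colExp m2 σ₁ (c, i)) 1 := by
  rw [theta_letterVar h c i hi.le, X, monomial_mul, one_mul, letterExp, colExp,
    show size m2 σ₁ c - i = 1 + (size m2 σ₁ c - 1 - i) by omega, Finsupp.single_add]
  refine congrArg (fun e => monomial e (1 : k)) ?_
  abel

theorem theta_bot (h : σ₁ ≤ m2) (c : Fin 3) (i : ℕ) (hi : i < size m2 σ₁ c) :
    theta k m2 σ₁ (letterVar k m2 σ₁ c (i + 1)) =
      X (Sum.inl 0) * monomial (colExp m2 σ₁ (c, i)) 1 := by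
  rw [theta_letterVar h c (i + 1) hi, X, monomial_mul, one_mul, letterExp, colExp,
    show size m2 σ₁ c - (i + 1) = (size m2 σ₁ c - 1 - i) by omega, Finsupp.single_add]
  refine congrArg (fun e => monomial e (1 : k)) ?_
  abel

theorem ker_theta (h : σ₁ ≤ m2) : RingHom.ker (theta k m2 σ₁) = scrollH k m2 σ₁ := by
  refine le_antisymm (ker_theta_le h) (Ideal.span_le.2 ?_)
  rintro _ ⟨j, j', rfl⟩
  obtain ⟨c, i, hi, h1, h2⟩ := exists_letterVar_eq (k := k) h j
  obtain ⟨c', i', hi', h1', h2'⟩ := exists_letterVar_eq (k := k) h j'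
  rw [SetLike.mem_coe, RingHom.mem_ker, h1, h2, h1', h2', map_sub, map_mul, map_mul,
    theta_top h _ _ hi, theta_top h _ _ hi', theta_bot h _ _ hi, theta_bot h _ _ hi']
  ring

end Scroll

theorem weightedHomogeneousComponent_mul_of_left {R σ M : Type*} [CommRing R] [AddCommGroup M]
    (w : σ → M) {G h : MvPolynomial σ R} {i : M} (hG : IsWeightedHomogeneous w G i) (j : M) :
    weightedHomogeneousComponent w (i + j) (G * h) =
      G * weightedHomogeneousComponent w j h := by
  classical
  let _ := weightedGradedAlgebra R w
  have := DirectSum.coe_decompose_mul_add_of_left_mem (𝒜 := weightedHomogeneousSubmodule R w)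
    (b := h) (j := j) (show G ∈ weightedHomogeneousSubmodule R w i from hG)
  rw [← MvPolynomial.decompose'_apply, ← MvPolynomial.decompose'_apply]
  exact this

/-- A homomorphism sending variables to homogeneous elements of the same weight commutes with
taking homogeneous components. -/
theorem weightedHomogeneousComponent_aeval {R σ τ M : Type*} [CommRing R] [AddCommMonoid M]
    (w : σ → M) (w' : τ → M) (F : MvPolynomial σ R →ₐ[R] MvPolynomial τ R)
    (hF : ∀ i, IsWeightedHomogeneous w' (F (X i)) (w i)) (p : MvPolynomial σ R) (j : M) :
    weightedHomogeneousComponent w' j (F p) = F (weightedHomogeneousComponent w j p) := by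
  classical
  have hm : ∀ d, IsWeightedHomogeneous w' (F (monomial d 1)) (Finsupp.weight w d) := by
    intro d
    induction d using Finsupp.induction_linear with
    | zero => simpa using isWeightedHomogeneous_one R w'
    | add f g hf hg =>
      rw [← one_mul (1 : R), ← monomial_mul, map_mul, map_add]
      exact hf.mul hg
    | single v n =>
      rw [← X_pow_eq_monomial, map_pow, Finsupp.weight_single]
      exact (hF v).pow n
  have : (weightedHomogeneousComponent w' j) ∘ₗ F.toLinearMap =
      F.toLinearMap ∘ₗ (weightedHomogeneousComponent w j) := by
    refine (basisMonomials σ R).ext fun d => ?_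
    have h1 := weightedHomogeneousComponent_of_mem (m := j)
      (show F (monomial d 1) ∈ weightedHomogeneousSubmodule R w' _ from hm d)
    have h2 := weightedHomogeneousComponent_of_mem (m := j)
      (show monomial d (1 : R) ∈ weightedHomogeneousSubmodule R w _ from
        isWeightedHomogeneous_monomial w d (1 : R) rfl)
    simp only [coe_basisMonomials, LinearMap.comp_apply, AlgHom.toLinearMap_apply]
    rw [h1, h2]
    split_ifs <;> simp
  exact LinearMap.congr_fun this p

namespace Scroll

/-- The weights on the parametrizing ring for which the scroll is the part of weight `≥ 0`. -/
def wt (m2 σ₁ : ℕ) : Fin 2 ⊕ Fin 2 → ℤ :=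
  Sum.elim (fun _ => 1) ![-(σ₁ : ℤ), -((m2 - σ₁ : ℕ) : ℤ)]

/-- All monomials occurring in `f` have weight at least `c`. -/
def WtGE {k : Type*} [Field k] (m2 σ₁ : ℕ) (c : ℤ) (f : MvPolynomial (Fin 2 ⊕ Fin 2) k) : Prop :=
  ∀ e, coeff e f ≠ 0 → c ≤ Finsupp.weight (wt m2 σ₁) e

variable {k : Type*} [Field k] {m2 σ₁ : ℕ}

theorem weight_eq (e : Fin 2 ⊕ Fin 2 →₀ ℕ) :
    Finsupp.weight (wt m2 σ₁) e = e (Sum.inl 0) + e (Sum.inl 1) - σ₁ * e (Sum.inr 0)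
      - (m2 - σ₁ : ℕ) * e (Sum.inr 1) := by
  rw [Finsupp.weight_apply, Finsupp.sum_fintype _ _ (by simp)]
  simp [wt]
  ring

theorem WtGE.mul {c d : ℤ} {f g : MvPolynomial (Fin 2 ⊕ Fin 2) k} (hf : WtGE m2 σ₁ c f)
    (hg : WtGE m2 σ₁ d g) : WtGE m2 σ₁ (c + d) (f * g) := by
  classical
  intro e he
  rw [coeff_mul] at he
  obtain ⟨⟨a, b⟩, hab, h⟩ := Finset.exists_ne_zero_of_sum_ne_zero he
  rw [Finset.HasAntidiagonal.mem_antidiagonal] at hab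
  rw [← hab, map_add]
  exact add_le_add (hf a (left_ne_zero_of_mul h)) (hg b (right_ne_zero_of_mul h))

theorem WtGE.add {c : ℤ} {f g : MvPolynomial (Fin 2 ⊕ Fin 2) k} (hf : WtGE m2 σ₁ c f)
    (hg : WtGE m2 σ₁ c g) : WtGE m2 σ₁ c (f + g) := by
  intro e he
  by_cases h : coeff e f = 0
  · exact hg e (by simpa [h] using he)
  · exact hf e h

theorem WtGE.mono {c d : ℤ} {f : MvPolynomial (Fin 2 ⊕ Fin 2) k} (hf : WtGE m2 σ₁ c f)
    (h : d ≤ c) : WtGE m2 σ₁ d f := fun e he => h.trans (hf e he)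

theorem WtGE.of_isWeightedHomogeneous {c : ℤ} {f : MvPolynomial (Fin 2 ⊕ Fin 2) k}
    (hf : IsWeightedHomogeneous (wt m2 σ₁) f c) : WtGE m2 σ₁ c f := fun _ he => (hf he).ge

theorem WtGE.of_mul {c d : ℤ} {G h : MvPolynomial (Fin 2 ⊕ Fin 2) k} (hG0 : G ≠ 0)
    (hG : IsWeightedHomogeneous (wt m2 σ₁) G d) (hf : WtGE m2 σ₁ c (G * h)) :
    WtGE m2 σ₁ (c - d) h := by
  classical
  intro e he
  by_contra! hlt
  have h1 := weightedHomogeneousComponent_mul_of_left (wt m2 σ₁) hG (h := h)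
    (Finsupp.weight (wt m2 σ₁) e)
  have h2 : weightedHomogeneousComponent (wt m2 σ₁) (Finsupp.weight (wt m2 σ₁) e) h ≠ 0 := by
    intro h0
    have := congrArg (coeff e) h0
    rw [coeff_weightedHomogeneousComponent, if_pos rfl] at this
    exact he this
  have h3 := mul_ne_zero hG0 h2
  rw [← h1] at h3
  obtain ⟨a, ha⟩ := ne_zero_iff.1 h3
  rw [coeff_weightedHomogeneousComponent] at ha
  split_ifs at ha with hw
  · have := hf a ha
    omega
  · exact ha rfl

theorem exists_theta_eq_monomial (h : σ₁ ≤ m2) (e : Fin 2 ⊕ Fin 2 →₀ ℕ)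
    (he : 0 ≤ Finsupp.weight (wt m2 σ₁) e) : ∃ a, theta k m2 σ₁ a = monomial e 1 := by
  induction hN : e (Sum.inr 0) + e (Sum.inr 1) generalizing e with
  | zero =>
    refine ⟨X (Sum.inl 0) ^ e (Sum.inl 0) * X (Sum.inl 1) ^ e (Sum.inl 1), ?_⟩
    rw [map_mul, map_pow, map_pow, theta, aeval_X, aeval_X, monomial_pow, monomial_pow,
      monomial_mul]
    have h0 : e (Sum.inr 0) = 0 := by omega
    have h1 : e (Sum.inr 1) = 0 := by omega
    simp only [one_pow, one_mul]
    refine congrArg (fun e => monomial e (1 : k)) (Finsupp.ext fun v => ?_)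
    rcases v with v | v <;> fin_cases v <;> simp [letter, letterExp, size, h0, h1]
  | succ N ih =>
    rw [weight_eq] at he
    obtain ⟨c, i, hi, hle, hlt, hw⟩ : ∃ c i, i ≤ size m2 σ₁ c ∧ letterExp m2 σ₁ (c, i) ≤ e ∧
        (e - letterExp m2 σ₁ (c, i)) (Sum.inr 0) + (e - letterExp m2 σ₁ (c, i)) (Sum.inr 1) = N ∧
        0 ≤ Finsupp.weight (wt m2 σ₁) (e - letterExp m2 σ₁ (c, i)) := by
      rcases Nat.eq_zero_or_pos (e (Sum.inr 0)) with h0 | h0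
      · obtain ⟨s, hs⟩ : ∃ s, e (Sum.inr 1) = s + 1 := ⟨e (Sum.inr 1) - 1, by omega⟩
        rw [h0, hs] at he
        push_cast at he
        have hp : (0 : ℤ) ≤ (m2 - σ₁ : ℕ) * s := by positivity
        have hq : m2 - σ₁ ≤ e (Sum.inl 0) + e (Sum.inl 1) := by zify; linarith
        refine ⟨2, min (e (Sum.inl 0)) (m2 - σ₁), by simp [size], ?_, ?_, ?_⟩
        · intro v
          rcases v with v | v <;> fin_cases v <;> simp [letterExp, size] <;> omega
        · simp [letterExp, size]; omega
        · rw [weight_eq]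
          simp only [letterExp, size, Finsupp.tsub_apply, Finsupp.add_apply]
          simp [h0, hs]
          have : ((e (Sum.inl 0) : ℤ) - min (e (Sum.inl 0) : ℤ) ((m2 - σ₁ : ℕ) : ℤ)) +
            ((e (Sum.inl 1) - (m2 - σ₁ - min (e (Sum.inl 0)) (m2 - σ₁)) : ℕ) : ℤ) =
            e (Sum.inl 0) + e (Sum.inl 1) - (m2 - σ₁ : ℕ) := by omega
          linarith
      · obtain ⟨s, hs⟩ : ∃ s, e (Sum.inr 0) = s + 1 := ⟨e (Sum.inr 0) - 1, by omega⟩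
        rw [hs] at he
        push_cast at he
        have hp : (0 : ℤ) ≤ (m2 - σ₁ : ℕ) * e (Sum.inr 1) := by positivity
        have hp' : (0 : ℤ) ≤ σ₁ * s := by positivity
        have hq : σ₁ ≤ e (Sum.inl 0) + e (Sum.inl 1) := by zify; linarith
        refine ⟨1, min (e (Sum.inl 0)) σ₁, by simp [size], ?_, ?_, ?_⟩
        · intro v
          rcases v with v | v <;> fin_cases v <;> simp [letterExp, size] <;> omega
        · simp [letterExp, size]; omega
        · rw [weight_eq]
          simp only [letterExp, size, Finsupp.tsub_apply, Finsupp.add_apply]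
          simp [hs]
          have : ((e (Sum.inl 0) : ℤ) - min (e (Sum.inl 0) : ℤ) (σ₁ : ℤ)) +
            ((e (Sum.inl 1) - (σ₁ - min (e (Sum.inl 0)) σ₁) : ℕ) : ℤ) =
            e (Sum.inl 0) + e (Sum.inl 1) - σ₁ := by omega
          linarith
    obtain ⟨a, ha⟩ := ih _ hw hlt
    refine ⟨letterVar k m2 σ₁ c i * a, ?_⟩
    rw [map_mul, ha, theta_letterVar h c i hi, monomial_mul, one_mul, add_tsub_cancel_of_le hle]

theorem wtGE_theta (h : σ₁ ≤ m2) (a : MvPolynomial (Fin 2 ⊕ Fin (m2 + 2)) k) :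
    WtGE m2 σ₁ 0 (theta k m2 σ₁ a) := by
  classical
  induction a using MvPolynomial.induction_on with
  | C r =>
    rw [algHom_C]
    exact WtGE.of_isWeightedHomogeneous (isWeightedHomogeneous_C _ r)
  | add p q hp hq => rw [map_add]; exact hp.add hq
  | mul_X p v hp =>
    rw [map_mul]
    refine (hp.mul (d := 0) ?_).mono (by simp)
    rw [theta, aeval_X]
    refine (WtGE.of_isWeightedHomogeneous (isWeightedHomogeneous_monomial _ _ _ rfl)).mono ?_
    have hl := letter_le h v
    rw [weight_eq]
    generalize letter m2 σ₁ v = p at hl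
    obtain ⟨c, i⟩ := p
    fin_cases c <;> simp [letterExp, size] at hl ⊢ <;> omega

theorem exists_theta_eq (h : σ₁ ≤ m2) (f : MvPolynomial (Fin 2 ⊕ Fin 2) k)
    (hf : WtGE m2 σ₁ 0 f) : ∃ a, theta k m2 σ₁ a = f := by
  suffices f ∈ (theta k m2 σ₁).range from this
  rw [f.as_sum]
  refine sum_mem fun e he => ?_
  obtain ⟨a, ha⟩ := exists_theta_eq_monomial (k := k) h e (hf e (mem_support_iff.1 he))
  exact ⟨C (coeff e f) * a, by
    rw [AlgHom.toRingHom_eq_coe, RingHom.coe_coe, map_mul, ha, algHom_C, algebraMap_eq,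
      C_mul_monomial, mul_one]⟩

/-- The embedding of the coordinate ring of the scroll induced by the parametrization. -/
noncomputable def thetaBar (k : Type*) [Field k] {m2 σ₁ : ℕ} (h : σ₁ ≤ m2) :
    MvPolynomial (Fin 2 ⊕ Fin (m2 + 2)) k ⧸ scrollH k m2 σ₁ →+*
      MvPolynomial (Fin 2 ⊕ Fin 2) k :=
  Ideal.Quotient.lift (scrollH k m2 σ₁) (theta k m2 σ₁ : _ →+* _) fun a ha => by
    rw [← ker_theta h] at ha
    exact ha

theorem thetaBar_mk (h : σ₁ ≤ m2) (a : MvPolynomial (Fin 2 ⊕ Fin (m2 + 2)) k) :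
    thetaBar k h (Ideal.Quotient.mk (scrollH k m2 σ₁) a) = theta k m2 σ₁ a := rfl

theorem thetaBar_injective (h : σ₁ ≤ m2) : Function.Injective (thetaBar k h) := by
  refine (injective_iff_map_eq_zero _).2 fun a ha => ?_
  obtain ⟨a, rfl⟩ := Ideal.Quotient.mk_surjective a
  rw [Ideal.Quotient.eq_zero_iff_mem, ← ker_theta h]
  exact ha

theorem wtGE_thetaBar (h : σ₁ ≤ m2) (a) : WtGE m2 σ₁ 0 (thetaBar k h a) := by
  obtain ⟨a, rfl⟩ := Ideal.Quotient.mk_surjective a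
  exact wtGE_theta h a

theorem exists_thetaBar_eq (h : σ₁ ≤ m2) (f : MvPolynomial (Fin 2 ⊕ Fin 2) k)
    (hf : WtGE m2 σ₁ 0 f) : ∃ a, thetaBar k h a = f := by
  obtain ⟨a, ha⟩ := exists_theta_eq h f hf
  exact ⟨Ideal.Quotient.mk _ a, ha⟩

theorem isWeightedHomogeneous_X_inl_pow (i : Fin 2) (n : ℕ) :
    IsWeightedHomogeneous (wt m2 σ₁) (X (Sum.inl i) ^ n : MvPolynomial (Fin 2 ⊕ Fin 2) k) n := by
  have := (isWeightedHomogeneous_X k (wt m2 σ₁) (Sum.inl i)).pow n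
  simpa [wt] using this

theorem exists_mem_scrollK_monomial (h : σ₁ ≤ m2) (e : Fin 2 ⊕ Fin 2 →₀ ℕ)
    (he : -1 ≤ Finsupp.weight (wt m2 σ₁) e) :
    ∃ a ∈ scrollK k m2 σ₁, thetaBar k h a = X (Sum.inl 1) * monomial e 1 := by
  obtain ⟨c, i, hi, hle, hw⟩ : ∃ c i, i < size m2 σ₁ c ∧ colExp m2 σ₁ (c, i) ≤ e ∧
      0 ≤ Finsupp.weight (wt m2 σ₁) (e - colExp m2 σ₁ (c, i)) := by
    by_cases hw : 0 ≤ Finsupp.weight (wt m2 σ₁) e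
    · have : colExp m2 σ₁ (0, 0) = 0 := by simp [colExp, size]
      exact ⟨0, 0, by simp [size], by simp [this], by rwa [this, tsub_zero]⟩
    rw [weight_eq] at he hw
    by_cases h0 : σ₁ * e (Sum.inr 0) = 0
    · have hpos : 0 < m2 - σ₁ ∧ 0 < e (Sum.inr 1) := by
        have h0' : (σ₁ : ℤ) * e (Sum.inr 0) = 0 := by exact_mod_cast h0
        constructor <;> by_contra! hc <;> rw [Nat.le_zero] at hc <;> simp [h0', hc] at hw <;> omega
      obtain ⟨s, hs⟩ : ∃ s, e (Sum.inr 1) = s + 1 := ⟨e (Sum.inr 1) - 1, by omega⟩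
      have h0' : (σ₁ : ℤ) * e (Sum.inr 0) = 0 := by exact_mod_cast h0
      rw [h0', hs] at he
      push_cast at he
      have hp : (0 : ℤ) ≤ (m2 - σ₁ : ℕ) * s := by positivity
      have hq : m2 - σ₁ ≤ e (Sum.inl 0) + e (Sum.inl 1) + 1 := by zify; linarith
      refine ⟨2, min (e (Sum.inl 0)) (m2 - σ₁ - 1), by simp [size]; omega, ?_, ?_⟩
      · intro v
        rcases v with v | v <;> fin_cases v <;> simp [colExp, size] <;> omega
      · rw [weight_eq]
        simp only [colExp, size, Finsupp.tsub_apply, Finsupp.add_apply]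
        simp [h0', hs]
        have : ((e (Sum.inl 0) : ℤ) - min (e (Sum.inl 0) : ℤ) ((m2 - σ₁ - 1 : ℕ) : ℤ)) +
          ((e (Sum.inl 1) - (m2 - σ₁ - 1 - min (e (Sum.inl 0)) (m2 - σ₁ - 1)) : ℕ) : ℤ) =
          e (Sum.inl 0) + e (Sum.inl 1) + 1 - (m2 - σ₁ : ℕ) := by omega
        linarith
    · have hpos : 0 < σ₁ ∧ 0 < e (Sum.inr 0) := by
        constructor <;> by_contra! hc <;> rw [Nat.le_zero] at hc <;> simp [hc] at h0
      obtain ⟨s, hs⟩ : ∃ s, e (Sum.inr 0) = s + 1 := ⟨e (Sum.inr 0) - 1, by omega⟩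
      rw [hs] at he
      push_cast at he
      have hp : (0 : ℤ) ≤ (m2 - σ₁ : ℕ) * e (Sum.inr 1) := by positivity
      have hp' : (0 : ℤ) ≤ σ₁ * s := by positivity
      have hq : σ₁ ≤ e (Sum.inl 0) + e (Sum.inl 1) + 1 := by zify; linarith
      refine ⟨1, min (e (Sum.inl 0)) (σ₁ - 1), by simp [size]; omega, ?_, ?_⟩
      · intro v
        rcases v with v | v <;> fin_cases v <;> simp [colExp, size] <;> omega
      · rw [weight_eq]
        simp only [colExp, size, Finsupp.tsub_apply, Finsupp.add_apply]
        simp [hs]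
        have : ((e (Sum.inl 0) : ℤ) - min (e (Sum.inl 0) : ℤ) ((σ₁ - 1 : ℕ) : ℤ)) +
          ((e (Sum.inl 1) - (σ₁ - 1 - min (e (Sum.inl 0)) (σ₁ - 1)) : ℕ) : ℤ) =
          e (Sum.inl 0) + e (Sum.inl 1) + 1 - σ₁ := by omega
        linarith
  obtain ⟨a, ha⟩ := exists_theta_eq_monomial (k := k) h _ hw
  obtain ⟨j, hj, -⟩ := exists_psi_eq (k := k) h c i hi
  refine ⟨Ideal.Quotient.mk _ (psiTop k m2 σ₁ j) * Ideal.Quotient.mk _ a,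
    Ideal.mul_mem_right _ _ (Ideal.subset_span ⟨j, rfl⟩), ?_⟩
  rw [map_mul, thetaBar_mk, thetaBar_mk, ha, hj, theta_top h c i hi, mul_assoc, monomial_mul,
    one_mul, add_tsub_cancel_of_le hle]

theorem mem_scrollK_iff (h : σ₁ ≤ m2) (a) :
    a ∈ scrollK k m2 σ₁ ↔ X (Sum.inl 1) ∣ thetaBar k h a := by
  constructor
  · intro ha
    have : scrollK k m2 σ₁ ≤ (Ideal.span {X (Sum.inl 1)}).comap (thetaBar k h) := by
      refine Ideal.span_le.2 ?_
      rintro _ ⟨j, rfl⟩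
      obtain ⟨c, i, hi, h1, -⟩ := exists_letterVar_eq (k := k) h j
      simp only [SetLike.mem_coe, Ideal.mem_comap, Ideal.mem_span_singleton]
      rw [thetaBar_mk, h1, theta_top h c i hi]
      exact dvd_mul_right _ _
    exact Ideal.mem_span_singleton.1 (this ha)
  · rintro ⟨f, hf⟩
    have hw : WtGE m2 σ₁ (-1) f := by
      have := wtGE_thetaBar h a
      rw [hf, ← pow_one (X (Sum.inl 1))] at this
      simpa using this.of_mul (by simp) (isWeightedHomogeneous_X_inl_pow 1 1)
    suffices X (Sum.inl 1) * f ∈ (scrollK k m2 σ₁).toAddSubmonoid.map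
        (thetaBar k h : _ →+* _).toAddMonoidHom by
      obtain ⟨b, hb, hbf⟩ := this
      have : thetaBar k h b = thetaBar k h a := by rw [hf]; exact hbf
      rwa [← thetaBar_injective h this]
    conv in f => rw [f.as_sum]
    rw [Finset.mul_sum]
    refine sum_mem fun e he => ?_
    obtain ⟨b, hb, hbe⟩ := exists_mem_scrollK_monomial (k := k) h e (hw e (mem_support_iff.1 he))
    refine ⟨Ideal.Quotient.mk _ (C (coeff e f)) * b, Ideal.mul_mem_left _ _ hb, ?_⟩
    change thetaBar k h _ = _
    rw [map_mul, hbe, thetaBar_mk, algHom_C, algebraMap_eq, mul_left_comm, C_mul_monomial, mul_one]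

theorem X_inl_one_not_dvd (n : ℕ) :
    ¬ (X (Sum.inl 1) : MvPolynomial (Fin 2 ⊕ Fin 2) k) ∣ X (Sum.inl 0) ^ n := by
  intro hd
  have := (X_prime (R := k) (i := (Sum.inl 1 : Fin 2 ⊕ Fin 2))).dvd_of_dvd_pow hd
  simp [X_dvd_X] at this

theorem mem_symbolicPower_iff (h : σ₁ ≤ m2) (n : ℕ) (a) :
    a ∈ symbolicPower (scrollK k m2 σ₁) n ↔ X (Sum.inl 1) ^ n ∣ thetaBar k h a := by
  have hK : scrollK k m2 σ₁ ^ n ≤ (Ideal.span {X (Sum.inl 1) ^ n}).comap (thetaBar k h) := by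
    have : scrollK k m2 σ₁ ≤ (Ideal.span {X (Sum.inl 1)}).comap (thetaBar k h) := fun a ha =>
      Ideal.mem_span_singleton.2 ((mem_scrollK_iff h a).1 ha)
    refine (Ideal.pow_right_mono this n).trans ((Ideal.le_comap_pow _ n).trans ?_)
    rw [Ideal.span_singleton_pow]
  constructor
  · have : symbolicPower (scrollK k m2 σ₁) n ≤
        (Ideal.span {X (Sum.inl 1) ^ n}).comap (thetaBar k h) := by
      refine sSup_le ?_
      rintro _ ⟨s, hs, rfl⟩ b hb
      have hb := hK (Ideal.mem_colon_span_singleton.1 hb)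
      rw [Ideal.mem_comap, Ideal.mem_span_singleton] at hb ⊢
      rw [mem_scrollK_iff h] at hs
      rw [map_mul] at hb
      exact X_prime.pow_dvd_of_dvd_mul_right n hs hb
    exact fun ha => Ideal.mem_span_singleton.1 (this ha)
  · rintro ⟨f, hf⟩
    have hw : WtGE m2 σ₁ 0 (X (Sum.inl 0) ^ n * f) := by
      have := wtGE_thetaBar h a
      rw [hf] at this
      have := this.of_mul (by simp) (isWeightedHomogeneous_X_inl_pow 1 n)
      exact ((WtGE.of_isWeightedHomogeneous (isWeightedHomogeneous_X_inl_pow 0 n)).mul this).mono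
        (by simp)
    obtain ⟨b, hb⟩ := exists_thetaBar_eq h _ hw
    have hx : theta k m2 σ₁ (X (Sum.inl 0)) = X (Sum.inl 0) := by
      rw [theta, aeval_X]; simp [letter, letterExp, size, X]
    have hy : theta k m2 σ₁ (X (Sum.inl 1)) = X (Sum.inl 1) := by
      rw [theta, aeval_X]; simp [letter, letterExp, size, X]
    have hmem : Submodule.colon (scrollK k m2 σ₁ ^ n)
          (Ideal.span {Ideal.Quotient.mk (scrollH k m2 σ₁) (X (Sum.inl 0)) ^ n}) ∈
        {J | ∃ s, s ∉ scrollK k m2 σ₁ ∧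
          J = Submodule.colon (scrollK k m2 σ₁ ^ n) (Ideal.span {s})} := by
      refine ⟨_, ?_, rfl⟩
      rw [mem_scrollK_iff h, map_pow, thetaBar_mk, hx]
      exact X_inl_one_not_dvd n
    refine le_sSup hmem (Ideal.mem_colon_span_singleton.2 ?_)
    · have : a * Ideal.Quotient.mk _ (X (Sum.inl 0)) ^ n =
          Ideal.Quotient.mk _ (X (Sum.inl 1)) ^ n * b := by
        apply thetaBar_injective h
        simp only [map_mul, map_pow, thetaBar_mk, hx, hy, hb, hf]
        ring
      rw [this]
      refine Ideal.mul_mem_right _ _ (Ideal.pow_mem_pow ((mem_scrollK_iff h _).2 ?_) n)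
      rw [thetaBar_mk, hy]

end Scroll

/-- The alternating maximal minors of an `(N + 1) × N` matrix are a syzygy of its rows. -/
theorem sum_mul_alternating_minor {R : Type*} [CommRing R] {N : ℕ}
    (M : Matrix (Fin (N + 1)) (Fin N) R) (j : Fin N) :
    ∑ i, M i j * ((-1) ^ (i : ℕ) * (M.submatrix i.succAbove id).det) = 0 := by
  let B : Matrix (Fin (N + 1)) (Fin (N + 1)) R := Matrix.of fun i => Fin.cons (M i j) (M i)
  have h0 : B.det = 0 := Matrix.det_zero_of_column_eq (Fin.succ_ne_zero j).symm fun _ => rfl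
  rw [Matrix.det_succ_column_zero] at h0
  rw [← h0]
  refine Finset.sum_congr rfl fun i _ => ?_
  rw [mul_left_comm, mul_assoc]
  rfl

theorem exists_eq_pow_mul_pow_mul {R : Type*} [CommRing R] [IsDomain R] {x y : R} (hy : Prime y)
    (hxy : ¬ y ∣ x) (f : ℕ → R) (a : ℕ) (hf : ∀ j < a, x * f j = y * f (j + 1)) :
    ∃ A, ∀ j ≤ a, f j = y ^ (a - j) * x ^ j * A := by
  induction a with
  | zero => exact ⟨f 0, fun j hj => by simp [Nat.le_zero.1 hj]⟩
  | succ a ih =>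
    obtain ⟨A, hA⟩ := ih fun j hj => hf j (by omega)
    have h1 := hf a (by omega)
    rw [hA a le_rfl, Nat.sub_self, pow_zero, one_mul, ← mul_assoc, ← pow_succ'] at h1
    obtain ⟨A', rfl⟩ : y ∣ A :=
      (hy.dvd_or_dvd ⟨_, h1⟩).resolve_left fun h => hxy (hy.dvd_of_dvd_pow h)
    refine ⟨A', fun j hj => ?_⟩
    rcases hj.lt_or_eq with hj | rfl
    · rw [hA j (by omega), show a + 1 - j = a - j + 1 by omega]; ring
    · apply mul_left_cancel₀ hy.ne_zero
      rw [← h1, Nat.sub_self]; ring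

namespace Scroll

variable {k : Type*} [Field k] {m2 σ₁ n : ℕ} {col : Fin (m2 + 2) → MvPolynomial (Fin 2) k}

theorem hbDelta_isHomogeneous (hc : ∀ i, (col i).IsHomogeneous n) (i : Fin (m2 + 2)) :
    (hbDelta k m2 σ₁ col i).IsHomogeneous (n + m2) := by
  have hent : ∀ i (j : Fin (m2 + 1)), (hbMatrix k m2 σ₁ col i j).IsHomogeneous
      (if (j : ℕ) = m2 then n else 1) := by
    intro i j
    simp only [hbMatrix, Matrix.of_apply]
    split_ifs
    · exact hc i
    · exact isHomogeneous_X _ _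
    · exact (isHomogeneous_X _ _).neg
    · exact isHomogeneous_zero _ _ _
    · exact isHomogeneous_X _ _
    · exact (isHomogeneous_X _ _).neg
    · exact isHomogeneous_zero _ _ _
  have hsum : ∑ j : Fin (m2 + 1), (if (j : ℕ) = m2 then n else 1) = n + m2 := by
    rw [Fin.sum_univ_castSucc]
    have : ∀ j : Fin m2, (if ((Fin.castSucc j : Fin (m2 + 1)) : ℕ) = m2 then n else 1) = 1 :=
      fun j => if_neg (by have := j.2; simp; omega)
    rw [Finset.sum_congr rfl fun j _ => this j]
    simp [add_comm]
  have hsign : ∀ e : ℕ, ((-1 : MvPolynomial (Fin 2) k) ^ e).IsHomogeneous 0 := fun e => by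
    simpa using ((isHomogeneous_one (Fin 2) k).neg).pow e
  rw [hbDelta, ← zero_add (n + m2)]
  refine (hsign _).mul ?_
  rw [Matrix.det_apply, ← hsum]
  refine IsHomogeneous.sum _ _ _ fun p _ => ?_
  have : (∏ j, (hbMatrix k m2 σ₁ col).submatrix i.succAbove id (p j) j).IsHomogeneous
      (∑ j : Fin (m2 + 1), (if (j : ℕ) = m2 then n else 1)) :=
    IsHomogeneous.prod _ _ _ fun j _ => hent _ _
  rcases Int.units_eq_one_or (Equiv.Perm.sign p) with hp | hp <;> rw [hp]
  · simpa using this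
  · simpa using this.neg

theorem exists_not_dvd_hbDelta (hI : idealHeight (hbIdeal k m2 σ₁ col) = 2)
    {d : MvPolynomial (Fin 2) k} (hd : Prime d) : ∃ i, ¬ d ∣ hbDelta k m2 σ₁ col i := by
  by_contra! hall
  have hle : hbIdeal k m2 σ₁ col ≤ Ideal.span {d} := by
    refine Ideal.span_le.2 ?_
    rintro _ ⟨i, rfl⟩
    exact Ideal.mem_span_singleton.2 (hall i)
  let p : PrimeSpectrum (MvPolynomial (Fin 2) k) :=
    ⟨Ideal.span {d}, (Ideal.span_singleton_prime hd.ne_zero).2 hd⟩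
  have h1 : idealHeight (hbIdeal k m2 σ₁ col) ≤ Order.height p := iInf₂_le p hle
  have h2 : Order.height p ≤ 1 := by
    rw [← PrimeSpectrum.height_eq_orderHeight]
    exact Ideal.height_span_singleton_le_one hd.not_isUnit
  rw [hI] at h1
  exact absurd (h1.trans h2) (by norm_num)

/-- The form `∑ y^{σ₁-j} x^j φ''_j`, summed over the first block. -/
noncomputable def blockP (σ₁ : ℕ) (col : Fin (m2 + 2) → MvPolynomial (Fin 2) k) :
    MvPolynomial (Fin 2) k :=
  ∑ i : Fin (m2 + 2), (if (i : ℕ) ≤ σ₁ then X 1 ^ (σ₁ - i) * X 0 ^ (i : ℕ) else 0) * col i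

/-- The form `∑ y^{σ₂-j} x^j φ''_{σ₁+1+j}`, summed over the second block. -/
noncomputable def blockQ (σ₁ : ℕ) (col : Fin (m2 + 2) → MvPolynomial (Fin 2) k) :
    MvPolynomial (Fin 2) k :=
  ∑ i : Fin (m2 + 2),
    (if (i : ℕ) ≤ σ₁ then 0 else X 1 ^ (m2 + 1 - i) * X 0 ^ (i - (σ₁ + 1) : ℕ)) * col i

theorem blockQ_isHomogeneous (h : σ₁ ≤ m2) (hc : ∀ i, (col i).IsHomogeneous n) :
    (blockQ σ₁ col).IsHomogeneous (m2 - σ₁ + n) := by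
  refine IsHomogeneous.sum _ _ _ fun i _ => IsHomogeneous.mul ?_ (hc i)
  split_ifs
  · exact isHomogeneous_zero _ _ _
  · have := ((isHomogeneous_X k (1 : Fin 2)).pow (m2 + 1 - i)).mul
      ((isHomogeneous_X k (0 : Fin 2)).pow (i - (σ₁ + 1)))
    have hi := i.2
    convert this using 1
    omega

theorem sum_hbMatrix_mul (f : ℕ → MvPolynomial (Fin 2) k) (j : ℕ) (hj : j < m2) :
    ∑ i : Fin (m2 + 2), hbMatrix k m2 σ₁ col i ⟨j, by omega⟩ * f i =
      if j < σ₁ then X 0 * f j - X 1 * f (j + 1) else X 0 * f (j + 1) - X 1 * f (j + 2) := by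
  have key : ∀ l, (hl : l + 1 < m2 + 2) → ∑ i : Fin (m2 + 2),
      (if (i : ℕ) = l then X 0 else if (i : ℕ) = l + 1 then -(X 1) else 0) * f i =
        X 0 * f l - X 1 * f (l + 1) := by
    intro l hl
    rw [Finset.sum_eq_add (⟨l, by omega⟩ : Fin (m2 + 2)) ⟨l + 1, hl⟩]
    · simp [sub_eq_add_neg]
    · simp
    · rintro ⟨i, hi⟩ - ⟨h1, h2⟩
      simp only [ne_eq, Fin.mk.injEq] at h1 h2
      simp [h1, h2]
    · simp
    · simp
  have hj' : j ≠ m2 := hj.ne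
  split_ifs with h
  · rw [← key j (by omega)]
    simp [hbMatrix, hj', h]
  · rw [← key (j + 1) (by omega)]
    simp [hbMatrix, hj', h]

theorem blockQ_eq_zero_imp (h : σ₁ ≤ m2) (hQ : blockQ σ₁ col = 0) :
    hbDelta k m2 σ₁ col ⟨σ₁, by omega⟩ = 0 := by
  let q : ℕ → MvPolynomial (Fin 2) k := fun i =>
    if i ≤ σ₁ then 0 else X 1 ^ (m2 + 1 - i) * X 0 ^ (i - (σ₁ + 1))
  have hsum : ∀ j : Fin (m2 + 1), ∑ i : Fin (m2 + 2), q i * hbMatrix k m2 σ₁ col i j = 0 := by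
    intro j
    rcases (Nat.lt_succ_iff.1 j.2).lt_or_eq with hj | hj
    · simp_rw [mul_comm (q _)]
      refine (sum_hbMatrix_mul q j hj).trans ?_
      split_ifs with h1
      · simp [q, h1.le, Nat.succ_le_of_lt h1]
      · simp only [q]
        rw [if_neg (by omega), if_neg (by omega), sub_eq_zero,
          show m2 + 1 - (j + 1 : ℕ) = m2 + 1 - (j + 2 : ℕ) + 1 by omega,
          show (j + 2 - (σ₁ + 1) : ℕ) = j + 1 - (σ₁ + 1) + 1 by omega]
        ring
    · rw [← hQ]
      simp [hbMatrix, hj, blockQ, q]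
  have : ((hbMatrix k m2 σ₁ col).submatrix (Fin.succAbove ⟨σ₁, by omega⟩) id).det = 0 := by
    refine Matrix.exists_vecMul_eq_zero_iff.1
      ⟨fun i => q (Fin.succAbove (⟨σ₁, by omega⟩ : Fin (m2 + 2)) i), ?_, ?_⟩
    · intro h0
      have := congrFun h0 (Fin.last m2)
      rw [Fin.succAbove_ne_last_last (by rw [ne_eq, Fin.ext_iff, Fin.val_last]; simp; omega)] at this
      have h1 : ¬ m2 + 1 ≤ σ₁ := by omega
      simp [q, h1] at this
    · funext j
      have := hsum j
      rw [Fin.sum_univ_succAbove _ ⟨σ₁, by omega⟩] at this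
      simpa [q, Matrix.vecMul, dotProduct] using this
  rw [hbDelta, this, mul_zero]

theorem exists_hbDelta_eq (h : σ₁ ≤ m2) (hn : 2 ≤ n) (hc : ∀ i, (col i).IsHomogeneous n)
    (hI : idealHeight (hbIdeal k m2 σ₁ col) = 2) :
    ∃ A B : MvPolynomial (Fin 2) k,
      (∀ i : Fin (m2 + 2), hbDelta k m2 σ₁ col i = if (i : ℕ) ≤ σ₁ then
        X 1 ^ (σ₁ - i) * X 0 ^ (i : ℕ) * A else
        X 1 ^ (m2 + 1 - i) * X 0 ^ (i - (σ₁ + 1) : ℕ) * B) ∧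
      B ≠ 0 ∧ A * blockP σ₁ col + B * blockQ σ₁ col = 0 ∧
      blockP σ₁ col ≠ 0 ∧ IsRelPrime (blockP σ₁ col) (blockQ σ₁ col) := by
  have hy : Prime (X 1 : MvPolynomial (Fin 2) k) := X_prime
  have hxy : ¬ (X 1 : MvPolynomial (Fin 2) k) ∣ X 0 := by simp [X_dvd_X]
  let f : ℕ → MvPolynomial (Fin 2) k := fun i =>
    if hi : i < m2 + 2 then hbDelta k m2 σ₁ col ⟨i, hi⟩ else 0
  have hf : ∀ i : Fin (m2 + 2), f i = hbDelta k m2 σ₁ col i := fun i => by simp [f]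
  have hrel : ∀ j < m2, (if j < σ₁ then X 0 * f j - X 1 * f (j + 1)
      else X 0 * f (j + 1) - X 1 * f (j + 2)) = 0 := by
    intro j hj
    rw [← sum_hbMatrix_mul (col := col) f j hj,
      ← sum_mul_alternating_minor (hbMatrix k m2 σ₁ col) ⟨j, by omega⟩]
    refine Finset.sum_congr rfl fun i _ => ?_
    rw [hf]
    simp only [hbMatrix, hbDelta, Matrix.of_apply, hj.ne, if_false]
  obtain ⟨A, hA⟩ := exists_eq_pow_mul_pow_mul hy hxy f σ₁ fun j hj => by
    have := hrel j (by omega)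
    rwa [if_pos hj, sub_eq_zero] at this
  obtain ⟨B, hB⟩ := exists_eq_pow_mul_pow_mul hy hxy (fun j => f (σ₁ + 1 + j)) (m2 - σ₁)
    fun j hj => by
      have := hrel (σ₁ + j) (by omega)
      rw [if_neg (by omega), sub_eq_zero] at this
      convert this using 3 <;> ring
  have hδ : ∀ i : Fin (m2 + 2), hbDelta k m2 σ₁ col i = if (i : ℕ) ≤ σ₁ then
        X 1 ^ (σ₁ - i) * X 0 ^ (i : ℕ) * A else
        X 1 ^ (m2 + 1 - i) * X 0 ^ (i - (σ₁ + 1) : ℕ) * B := by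
    intro i
    have := i.2
    rw [← hf]
    split_ifs with hi
    · exact hA i hi
    · have := hB (i - (σ₁ + 1)) (by omega)
      rw [show σ₁ + 1 + ((i : ℕ) - (σ₁ + 1)) = i by omega] at this
      rw [this]
      congr 3
      omega
  have hPQ : A * blockP σ₁ col + B * blockQ σ₁ col = 0 := by
    rw [← sum_mul_alternating_minor (hbMatrix k m2 σ₁ col) (Fin.last m2), blockP, blockQ,
      Finset.mul_sum, Finset.mul_sum, ← Finset.sum_add_distrib]
    refine Finset.sum_congr rfl fun i _ => ?_
    change _ = _ * hbDelta k m2 σ₁ col i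
    rw [hδ]
    simp only [hbMatrix, Matrix.of_apply, Fin.val_last, if_true]
    split_ifs <;> ring
  have hAB : IsRelPrime A B := by
    intro d hdA hdB
    by_contra hd
    obtain ⟨p, hp, hpd⟩ : ∃ p, Prime p ∧ p ∣ d := by
      rcases eq_or_ne d 0 with rfl | h0
      · exact ⟨_, hy, dvd_zero _⟩
      · obtain ⟨p, hp, hpd⟩ := WfDvdMonoid.exists_irreducible_factor hd h0
        exact ⟨p, hp.prime, hpd⟩
    obtain ⟨i, hi⟩ := exists_not_dvd_hbDelta hI hp
    apply hi
    rw [hδ]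
    split_ifs
    · exact (hpd.trans hdA).mul_left _
    · exact (hpd.trans hdB).mul_left _
  have hdeg : ∀ {a b : ℕ} {D : MvPolynomial (Fin 2) k} (i : Fin (m2 + 2)),
      hbDelta k m2 σ₁ col i = X 1 ^ a * X 0 ^ b * D → D ≠ 0 → D.totalDegree + a + b = n + m2 := by
    intro a b D i hi hD
    have hne : (X 1 ^ a * X 0 ^ b : MvPolynomial (Fin 2) k) ≠ 0 := by simp
    have hab := (((isHomogeneous_X k (1 : Fin 2)).pow a).mul
      ((isHomogeneous_X k (0 : Fin 2)).pow b)).totalDegree hne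
    have := (hbDelta_isHomogeneous (σ₁ := σ₁) hc i).totalDegree
      (by rw [hi]; exact mul_ne_zero hne hD)
    rw [hi, totalDegree_mul_of_isDomain hne hD, hab] at this
    omega
  have hδ0 := hδ ⟨0, by omega⟩
  have hδ1 := hδ ⟨m2 + 1, by omega⟩
  rw [if_pos (Nat.zero_le _)] at hδ0
  rw [if_neg (by simp; omega)] at hδ1
  simp only at hδ0 hδ1
  have hA0 : A ≠ 0 := by
    rintro rfl
    have hu : IsUnit B := isRelPrime_zero_left.1 hAB
    have := hdeg _ hδ1 hu.ne_zero
    rw [(isUnit_iff_totalDegree_of_isReduced.1 hu).2] at this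
    omega
  have hB0 : B ≠ 0 := by
    rintro rfl
    have hu : IsUnit A := isRelPrime_zero_right.1 hAB
    have := hdeg _ hδ0 hu.ne_zero
    rw [(isUnit_iff_totalDegree_of_isReduced.1 hu).2] at this
    omega
  have hQ0 : blockQ σ₁ col ≠ 0 := by
    intro hQ
    have := blockQ_eq_zero_imp h hQ
    rw [hδ, if_pos le_rfl] at this
    simp [hA0] at this
  obtain ⟨e, he⟩ : A ∣ blockQ σ₁ col :=
    hAB.dvd_of_dvd_mul_left ⟨-blockP σ₁ col, by linear_combination hPQ⟩
  have hP : blockP σ₁ col = -(B * e) := by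
    apply mul_left_cancel₀ hA0
    rw [he] at hPQ
    linear_combination hPQ
  have he0 : e ≠ 0 := by rintro rfl; simp [he] at hQ0
  have heu : IsUnit e := by
    have h1 := (blockQ_isHomogeneous h hc).totalDegree hQ0
    rw [he, totalDegree_mul_of_isDomain hA0 he0] at h1
    have h2 := hdeg _ hδ0 hA0
    have h3 : e.totalDegree = 0 := by omega
    refine isUnit_iff_totalDegree_of_isReduced.2 ⟨?_, h3⟩
    rw [totalDegree_eq_zero_iff_eq_C] at h3
    refine isUnit_iff_ne_zero.2 fun h0 => he0 ?_
    rw [h3, h0, C_0]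
  refine ⟨A, B, hδ, hB0, hPQ, ?_, fun d hdP hdQ => hAB ?_ ?_⟩
  · rw [hP]; simp [hB0, he0]
  · rw [he] at hdQ; exact (heu.dvd_mul_right).1 hdQ
  · rw [hP, dvd_neg] at hdP; exact (heu.dvd_mul_right).1 hdP

end Scroll

theorem exists_eq_rename_of_dvd_rename {k σ τ : Type*} [Field k] {p : MvPolynomial σ k}
    {d : MvPolynomial (σ ⊕ τ) k} (hp : p ≠ 0) (hd : d ∣ rename Sum.inl p) :
    ∃ d', d = rename Sum.inl d' ∧ d' ∣ p := by
  classical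
  obtain ⟨c, hc⟩ := hd
  have hne : rename (Sum.inl : σ → σ ⊕ τ) p ≠ 0 := by
    rwa [ne_eq, map_eq_zero_iff _ (rename_injective _ Sum.inl_injective)]
  rw [hc] at hne
  have hvars : (d.vars : Set (σ ⊕ τ)) ⊆ Set.range Sum.inl := by
    intro v hv
    rcases v with v | v
    · exact ⟨v, rfl⟩
    · have h1 := degreeOf_mul_eq (n := Sum.inr v) (left_ne_zero_of_mul hne)
        (right_ne_zero_of_mul hne)
      have h2 : degreeOf (Sum.inr v) (rename (Sum.inl : σ → σ ⊕ τ) p) = 0 := by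
        by_contra h
        have := vars_rename (Sum.inl : σ → σ ⊕ τ) p (mem_vars_iff_degreeOf_ne_zero.2 h)
        simp at this
      have h3 := mem_vars_iff_degreeOf_ne_zero.1 (Finset.mem_coe.1 hv)
      rw [← hc, h2] at h1
      omega
  obtain ⟨d', rfl⟩ := exists_rename_eq_of_vars_subset_range d Sum.inl Sum.inl_injective hvars
  refine ⟨d', rfl, ?_⟩
  have := congrArg (aeval (Sum.elim X 0 : σ ⊕ τ → MvPolynomial σ k)) hc
  rw [map_mul, aeval_rename, aeval_rename, Sum.elim_comp_inl, aeval_X_left_apply,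
    aeval_X_left_apply] at this
  exact ⟨_, this⟩

namespace Scroll

/-- The image `P u₁ + Q u₂` of `g` under the parametrization, as a function of `P` and `Q`. -/
noncomputable def biForm {k : Type*} [Field k] (P Q : MvPolynomial (Fin 2) k) :
    MvPolynomial (Fin 2 ⊕ Fin 2) k :=
  rename Sum.inl P * X (Sum.inr 0) + rename Sum.inl Q * X (Sum.inr 1)

/-- The map `k[x,y,u₁,u₂] → R[t]` with `u₁ ↦ A t`, `u₂ ↦ B t`. -/
noncomputable def betaRees {k : Type*} [Field k] (A B : MvPolynomial (Fin 2) k) :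
    MvPolynomial (Fin 2 ⊕ Fin 2) k →ₐ[k] Polynomial (MvPolynomial (Fin 2) k) :=
  aeval (Sum.elim (fun i => Polynomial.C (X i))
    ![Polynomial.C A * Polynomial.X, Polynomial.C B * Polynomial.X])

variable {k : Type*} [Field k] {m2 σ₁ n : ℕ} {col : Fin (m2 + 2) → MvPolynomial (Fin 2) k}
  {A B P Q : MvPolynomial (Fin 2) k}

theorem betaRees_rename (p : MvPolynomial (Fin 2) k) :
    betaRees A B (rename Sum.inl p) = Polynomial.C p := by
  rw [betaRees, aeval_rename, Sum.elim_comp_inl]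
  have : (aeval fun i => Polynomial.C (X i) : MvPolynomial (Fin 2) k →ₐ[k] _) =
      (Polynomial.CAlgHom :
        MvPolynomial (Fin 2) k →ₐ[MvPolynomial (Fin 2) k] _).restrictScalars k := by
    ext i; simp
  rw [this]; rfl

theorem betaRees_biForm (h : A * P + B * Q = 0) : betaRees A B (biForm P Q) = 0 := by
  rw [biForm, map_add, map_mul, map_mul, betaRees_rename, betaRees_rename, betaRees, aeval_X,
    aeval_X]
  simp only [Sum.elim_inr, Matrix.cons_val_zero, Matrix.cons_val_one]
  have := congrArg (fun p => Polynomial.C p * Polynomial.X) h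
  simp only [map_add, map_mul, map_zero] at this
  linear_combination this

theorem isRelPrime_biForm (hP : P ≠ 0) (hPQ : IsRelPrime P Q) :
    IsRelPrime (rename Sum.inl P) (biForm P Q) := by
  intro d hd hd'
  obtain ⟨d, rfl, hdP⟩ := exists_eq_rename_of_dvd_rename hP hd
  have := map_dvd (aeval (Sum.elim X ![0, 1] : Fin 2 ⊕ Fin 2 → MvPolynomial (Fin 2) k)) hd'
  rw [biForm, map_add, map_mul, map_mul, aeval_rename, aeval_rename, aeval_rename,
    Sum.elim_comp_inl] at this
  simp only [aeval_X_left_apply, aeval_X, Sum.elim_inr, Matrix.cons_val_zero,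
    Matrix.cons_val_one, mul_zero, zero_add, mul_one] at this
  exact (hPQ hdP this).map _

/-- Modulo `P u₁ + Q u₂`, every polynomial becomes free of `u₁` after multiplication by a
power of `P`. -/
theorem exists_dvd_pow_mul_sub (f : MvPolynomial (Fin 2 ⊕ Fin 2) k) :
    ∃ (N : ℕ) (r : Polynomial (MvPolynomial (Fin 2) k)), biForm P Q ∣
      rename Sum.inl P ^ N * f -
        r.eval₂ (rename Sum.inl : _ →ₐ[k] _).toRingHom (X (Sum.inr 1)) := by
  induction f using MvPolynomial.induction_on with
  | C a => exact ⟨0, Polynomial.C (C a), by simp⟩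
  | add f g hf hg =>
    obtain ⟨N, r, c, hc⟩ := hf
    obtain ⟨M, s, d, hd⟩ := hg
    refine ⟨N + M, Polynomial.C (P ^ M) * r + Polynomial.C (P ^ N) * s,
      rename Sum.inl P ^ M * c + rename Sum.inl P ^ N * d, ?_⟩
    simp only [Polynomial.eval₂_add, Polynomial.eval₂_mul, Polynomial.eval₂_C,
      Polynomial.eval₂_pow, map_pow,
      AlgHom.toRingHom_eq_coe, RingHom.coe_coe] at hc hd ⊢
    linear_combination rename Sum.inl P ^ M * hc + rename Sum.inl P ^ N * hd
  | mul_X f v hf =>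
    obtain ⟨N, r, c, hc⟩ := hf
    simp only [AlgHom.toRingHom_eq_coe] at hc ⊢
    rcases v with i | i
    · refine ⟨N, r * Polynomial.C (X i), c * X (Sum.inl i), ?_⟩
      simp only [Polynomial.eval₂_mul, Polynomial.eval₂_C, RingHom.coe_coe, rename_X]
      linear_combination X (Sum.inl i) * hc
    · fin_cases i
      · refine ⟨N + 1, -(Polynomial.C Q * Polynomial.X * r),
          rename Sum.inl P * X (Sum.inr 0) * c +
            r.eval₂ (rename Sum.inl : _ →ₐ[k] _).toRingHom (X (Sum.inr 1)), ?_⟩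
        simp only [AlgHom.toRingHom_eq_coe, Polynomial.eval₂_neg, Polynomial.eval₂_mul,
          Polynomial.eval₂_C,
          Polynomial.eval₂_X, RingHom.coe_coe, Fin.zero_eta]
        have hb : biForm P Q =
          rename Sum.inl P * X (Sum.inr 0) + rename Sum.inl Q * X (Sum.inr 1) := rfl
        linear_combination rename Sum.inl P * X (Sum.inr 0) * hc -
          r.eval₂ (RingHomClass.toRingHom (rename Sum.inl : _ →ₐ[k] MvPolynomial (Fin 2 ⊕ Fin 2) k))
            (X (Sum.inr 1)) * hb
      · refine ⟨N, r * Polynomial.X, c * X (Sum.inr 1), ?_⟩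
        simp only [Polynomial.eval₂_mul, Polynomial.eval₂_X, Fin.mk_one]
        linear_combination X (Sum.inr 1) * hc

theorem betaRees_eval₂ (r : Polynomial (MvPolynomial (Fin 2) k)) :
    betaRees A B (r.eval₂ (rename Sum.inl : _ →ₐ[k] _).toRingHom (X (Sum.inr 1))) =
      r.comp (Polynomial.C B * Polynomial.X) := by
  induction r using Polynomial.induction_on' with
  | add p q hp hq => rw [Polynomial.eval₂_add, map_add, hp, hq, Polynomial.add_comp]
  | monomial n a =>
    rw [Polynomial.eval₂_monomial, map_mul, map_pow, Polynomial.monomial_comp]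
    simp only [AlgHom.toRingHom_eq_coe, RingHom.coe_coe, betaRees_rename]
    simp [betaRees]

theorem betaRees_eq_zero_iff (hB : B ≠ 0) (h : A * P + B * Q = 0) (hP : P ≠ 0)
    (hPQ : IsRelPrime P Q) (f : MvPolynomial (Fin 2 ⊕ Fin 2) k) :
    betaRees A B f = 0 ↔ biForm P Q ∣ f := by
  constructor
  · intro hf
    obtain ⟨N, r, hr⟩ := exists_dvd_pow_mul_sub (P := P) (Q := Q) f
    have h0 : r.comp (Polynomial.C B * Polynomial.X) = 0 := by
      have := map_dvd (betaRees A B) hr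
      rwa [betaRees_biForm h, zero_dvd_iff, map_sub, map_mul, hf, mul_zero, zero_sub, neg_eq_zero,
        betaRees_eval₂] at this
    have hr0 : r = 0 := by
      ext1 i
      have := congrArg (fun q => Polynomial.coeff q i) h0
      simpa [Polynomial.comp_C_mul_X_coeff, hB] using this
    rw [hr0, Polynomial.eval₂_zero, sub_zero] at hr
    exact ((isRelPrime_biForm hP hPQ).pow_left).symm.dvd_of_dvd_mul_left hr
  · intro hd
    have := map_dvd (betaRees A B) hd
    rwa [betaRees_biForm h, zero_dvd_iff] at this

theorem theta_X_inl (i : Fin 2) : theta k m2 σ₁ (X (Sum.inl i)) = X (Sum.inl i) := by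
  rw [theta, aeval_X]
  fin_cases i <;> simp [letter, letterExp, size, X]

theorem theta_X_inr (i : Fin (m2 + 2)) : theta k m2 σ₁ (X (Sum.inr i)) =
    if (i : ℕ) ≤ σ₁ then X (Sum.inl 1) ^ (σ₁ - i) * X (Sum.inl 0) ^ (i : ℕ) * X (Sum.inr 0)
    else X (Sum.inl 1) ^ (m2 + 1 - i) * X (Sum.inl 0) ^ (i - (σ₁ + 1) : ℕ) * X (Sum.inr 1) := by
  rw [theta, aeval_X]
  split_ifs with h
  · simp [letter, letterExp, size, X, monomial_pow, monomial_mul, h, add_comm]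
  · have : m2 - σ₁ - (i - (σ₁ + 1) : ℕ) = m2 + 1 - i := by omega
    simp [letter, letterExp, size, X, monomial_pow, monomial_mul, h, add_comm, this]

theorem theta_rename (p : MvPolynomial (Fin 2) k) :
    theta k m2 σ₁ (rename Sum.inl p) = rename Sum.inl p := by
  have : (theta k m2 σ₁).comp (rename Sum.inl) = rename Sum.inl := by
    ext i : 1
    rw [AlgHom.comp_apply, rename_X, theta_X_inl, rename_X]
  exact DFunLike.congr_fun this p

theorem theta_scrollg :
    theta k m2 σ₁ (scrollg k m2 col) = biForm (blockP σ₁ col) (blockQ σ₁ col) := by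
  simp only [scrollg, biForm, blockP, blockQ, map_sum, Finset.sum_mul, ← Finset.sum_add_distrib,
    map_mul, theta_rename, theta_X_inr]
  refine Finset.sum_congr rfl fun i _ => ?_
  split_ifs <;> simp only [map_mul, map_pow, rename_X, map_zero] <;> ring

theorem betaRees_theta (hδ : ∀ i : Fin (m2 + 2), hbDelta k m2 σ₁ col i = if (i : ℕ) ≤ σ₁ then
        X 1 ^ (σ₁ - i) * X 0 ^ (i : ℕ) * A else
        X 1 ^ (m2 + 1 - i) * X 0 ^ (i - (σ₁ + 1) : ℕ) * B)
    (a : MvPolynomial (Fin 2 ⊕ Fin (m2 + 2)) k) :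
    PiRees k m2 σ₁ col a = betaRees A B (theta k m2 σ₁ a) := by
  have : PiRees k m2 σ₁ col = (betaRees A B).comp (theta k m2 σ₁) := by
    ext v : 1
    rcases v with i | i
    · simp [PiRees, theta_X_inl, betaRees]
    · rw [AlgHom.comp_apply, theta_X_inr, PiRees, aeval_X, Sum.elim_inr, hδ]
      split_ifs <;> simp [betaRees, mul_assoc]
  rw [this, AlgHom.comp_apply]

theorem mem_map_reesDefIdeal_iff (h : σ₁ ≤ m2) (hn : 2 ≤ n) (hc : ∀ i, (col i).IsHomogeneous n)
    (hI : idealHeight (hbIdeal k m2 σ₁ col) = 2) (a) :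
    a ∈ (reesDefIdeal k m2 σ₁ col).map (Ideal.Quotient.mk (scrollH k m2 σ₁)) ↔
      biForm (blockP σ₁ col) (blockQ σ₁ col) ∣ thetaBar k h a := by
  obtain ⟨A, B, hδ, hB, hPQ, hP, hrel⟩ := exists_hbDelta_eq h hn hc hI
  have key : ∀ f, f ∈ reesDefIdeal k m2 σ₁ col ↔
      biForm (blockP σ₁ col) (blockQ σ₁ col) ∣ theta k m2 σ₁ f := fun f => by
    rw [← betaRees_eq_zero_iff hB hPQ hP hrel, ← betaRees_theta hδ]
    exact RingHom.mem_ker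
  rw [Ideal.mem_map_iff_of_surjective _ Ideal.Quotient.mk_surjective]
  constructor
  · rintro ⟨f, hf, rfl⟩
    exact (key f).1 hf
  · intro ha
    obtain ⟨f, rfl⟩ := Ideal.Quotient.mk_surjective a
    exact ⟨f, (key f).2 ha, rfl⟩

theorem biForm_ne_zero (hP : P ≠ 0) : biForm P Q ≠ 0 := by
  intro h0
  have := congrArg (aeval (Sum.elim X ![1, 0] : Fin 2 ⊕ Fin 2 → MvPolynomial (Fin 2) k)) h0
  rw [biForm, map_add, map_mul, map_mul, aeval_rename, aeval_rename, Sum.elim_comp_inl] at this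
  simp [hP] at this

end Scroll

theorem span_singleton_mul_eq_of_forall {A : Type*} [CommRing A] {I J : Ideal A} {y g : A}
    (hI : ∀ a ∈ I, ∃ b ∈ J, y * a = g * b) (hJ : ∀ b ∈ J, ∃ a ∈ I, y * a = g * b) :
    Ideal.span {y} * I = Ideal.span {g} * J := by
  refine le_antisymm ?_ ?_
  · refine Ideal.span_singleton_mul_le_iff.2 fun a ha => ?_
    obtain ⟨b, hb, h⟩ := hI a ha
    exact h ▸ Ideal.mul_mem_mul (Ideal.mem_span_singleton_self g) hb
  · refine Ideal.span_singleton_mul_le_iff.2 fun b hb => ?_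
    obtain ⟨a, ha, h⟩ := hJ b hb
    exact h ▸ Ideal.mul_mem_mul (Ideal.mem_span_singleton_self y) ha

theorem exists_linearEquiv_of_forall {A : Type*} [CommRing A] [IsDomain A] {I J : Ideal A}
    {y g : A} (hy : y ≠ 0) (hg : g ≠ 0) (hI : ∀ a ∈ I, ∃ b ∈ J, y * a = g * b)
    (hJ : ∀ b ∈ J, ∃ a ∈ I, y * a = g * b) :
    ∃ e : J ≃ₗ[A] I, ∀ b : J, y * (e b : A) = g * b := by
  choose f hfI hf using hJ
  let F : J →ₗ[A] I :=
    { toFun := fun b => ⟨f b b.2, hfI b b.2⟩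
      map_add' := fun b c => Subtype.ext <| mul_left_cancel₀ hy <| by
        simp only [Submodule.coe_add, mul_add, hf]
      map_smul' := fun r b => Subtype.ext <| mul_left_cancel₀ hy <| by
        simp only [Submodule.coe_smul, smul_eq_mul, RingHom.id_apply, hf, mul_left_comm _ r] }
  have hF : ∀ b : J, y * (F b : A) = g * b := fun b => hf b b.2
  refine ⟨LinearEquiv.ofBijective F ⟨fun b c h => ?_, fun a => ?_⟩, hF⟩
  · apply Subtype.ext
    apply mul_left_cancel₀ hg
    rw [← hF, ← hF, h]
  · obtain ⟨b, hb, h⟩ := hI a a.2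
    refine ⟨⟨b, hb⟩, Subtype.ext (mul_left_cancel₀ hy ?_)⟩
    rw [hF, h]

theorem MvPolynomial.IsHomogeneous.rename_isWeightedHomogeneous {R σ τ M : Type*} [CommSemiring R]
    [AddCommMonoid M] {p : MvPolynomial σ R} {d : ℕ} (hp : p.IsHomogeneous d) (f : σ → τ)
    (w : τ → M) (c : M) (hw : ∀ i, w (f i) = c) :
    IsWeightedHomogeneous w (rename f p) (d • c) := by
  intro e he
  obtain ⟨u, rfl, hu⟩ := coeff_rename_ne_zero f p e he
  rw [← hp hu, Finsupp.weight_apply, Finsupp.weight_apply,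
    Finsupp.sum_mapDomain_index (by simp) (by simp [add_smul]), Finsupp.sum, Finsupp.sum,
    Finset.sum_smul]
  simp [hw]

namespace Scroll

variable {k : Type*} [Field k] {m2 σ₁ n : ℕ} {col : Fin (m2 + 2) → MvPolynomial (Fin 2) k}

theorem blockP_isHomogeneous (hc : ∀ i, (col i).IsHomogeneous n) :
    (blockP σ₁ col).IsHomogeneous (σ₁ + n) := by
  refine IsHomogeneous.sum _ _ _ fun i _ => IsHomogeneous.mul ?_ (hc i)
  split_ifs
  · have := ((isHomogeneous_X k (1 : Fin 2)).pow (σ₁ - i)).mul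
      ((isHomogeneous_X k (0 : Fin 2)).pow i)
    convert this using 1
    omega
  · exact isHomogeneous_zero _ _ _

theorem biForm_isWeightedHomogeneous {M : Type*} [AddCommMonoid M] {P Q : MvPolynomial (Fin 2) k}
    {a b : ℕ} (hP : P.IsHomogeneous a) (hQ : Q.IsHomogeneous b) (w : Fin 2 ⊕ Fin 2 → M) {c d : M}
    (hw : ∀ i, w (Sum.inl i) = c) (h0 : a • c + w (Sum.inr 0) = d)
    (h1 : b • c + w (Sum.inr 1) = d) : IsWeightedHomogeneous w (biForm P Q) d := by
  refine IsWeightedHomogeneous.add ?_ ?_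
  · rw [← h0]
    exact (hP.rename_isWeightedHomogeneous _ w c hw).mul (isWeightedHomogeneous_X _ _ _)
  · rw [← h1]
    exact (hQ.rename_isWeightedHomogeneous _ w c hw).mul (isWeightedHomogeneous_X _ _ _)

/-- The bidegrees of the variables of `S`. -/
def bideg (m : ℕ) : Fin 2 ⊕ Fin m → ℤ × ℤ := Sum.elim (fun _ => (1, 0)) fun _ => (0, 1)

/-- The bidegrees of `x, y, u₁, u₂` for which the parametrization is bihomogeneous. -/
def parBideg (m2 σ₁ : ℕ) (v : Fin 2 ⊕ Fin 2) : ℤ × ℤ :=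
  (wt m2 σ₁ v, Sum.elim (fun _ => 0) (fun _ => 1) v)

theorem isBiHomogeneous_iff {m : ℕ} (p : MvPolynomial (Fin 2 ⊕ Fin m) k) (u s : ℕ) :
    IsBiHomogeneous p u s ↔ IsWeightedHomogeneous (bideg m) p (u, s) := by
  have key : ∀ e : Fin 2 ⊕ Fin m →₀ ℕ, Finsupp.weight (bideg m) e =
      (((Finsupp.weight (Sum.elim (fun _ : Fin 2 => 1) (fun _ : Fin m => 0)) e : ℕ) : ℤ),
        ((Finsupp.weight (Sum.elim (fun _ : Fin 2 => 0) (fun _ : Fin m => 1)) e : ℕ) : ℤ)) := by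
    intro e
    simp only [Finsupp.weight_apply, Finsupp.sum_fintype, zero_smul, implies_true,
      Fintype.sum_sum_type, bideg, Sum.elim_inl, Sum.elim_inr]
    ext <;> simp [Prod.fst_sum, Prod.snd_sum]
  constructor
  · intro h e he
    rw [key, h.1 he, h.2 he]
  · intro h
    refine ⟨fun e he => ?_, fun e he => ?_⟩
    · have := congrArg Prod.fst (h he)
      rw [key] at this
      exact Nat.cast_injective (R := ℤ) this
    · have := congrArg Prod.snd (h he)
      rw [key] at this
      exact Nat.cast_injective (R := ℤ) this

theorem theta_X_isWeightedHomogeneous (h : σ₁ ≤ m2) (v : Fin 2 ⊕ Fin (m2 + 2)) :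
    IsWeightedHomogeneous (parBideg m2 σ₁) (theta k m2 σ₁ (X v)) (bideg _ v) := by
  rcases v with i | i
  · rw [theta_X_inl]
    convert isWeightedHomogeneous_X k (parBideg m2 σ₁) (Sum.inl i) using 1
    rfl
  · have hx := isWeightedHomogeneous_X k (parBideg m2 σ₁)
    have hi := i.2
    rw [theta_X_inr]
    split_ifs with hσ
    · convert (((hx (Sum.inl 1)).pow (σ₁ - i)).mul ((hx (Sum.inl 0)).pow i)).mul
        (hx (Sum.inr 0)) using 1
      ext <;> simp [bideg, parBideg, wt, hσ]
    · convert (((hx (Sum.inl 1)).pow (m2 + 1 - i)).mul ((hx (Sum.inl 0)).pow (i - (σ₁ + 1)))).mul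
        (hx (Sum.inr 1)) using 1
      ext
      · simp [bideg, parBideg, wt]; omega
      · simp [bideg, parBideg]

theorem isBiHomogeneousQuot_of_mul_eq (h : σ₁ ≤ m2)
    {a f : MvPolynomial (Fin 2 ⊕ Fin (m2 + 2)) k ⧸ scrollH k m2 σ₁}
    {G : MvPolynomial (Fin 2 ⊕ Fin 2) k}
    (hG : IsWeightedHomogeneous (parBideg m2 σ₁) G ((n : ℤ), 1))
    (hf : X (Sum.inl 1) ^ n * thetaBar k h f = G * thetaBar k h a) {u s : ℕ}
    (ha : IsBiHomogeneousQuot a u s) : IsBiHomogeneousQuot f u (s + 1) := by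
  obtain ⟨p, hp, rfl⟩ := ha
  obtain ⟨F, rfl⟩ := Ideal.Quotient.mk_surjective f
  rw [isBiHomogeneous_iff] at hp
  simp only [thetaBar_mk] at hf
  refine ⟨weightedHomogeneousComponent (bideg _) ((u : ℤ), ((s + 1 : ℕ) : ℤ)) F, ?_, ?_⟩
  · rw [isBiHomogeneous_iff]
    exact weightedHomogeneousComponent_isWeightedHomogeneous _ _
  · apply thetaBar_injective h
    have hy : IsWeightedHomogeneous (parBideg m2 σ₁)
        (X (Sum.inl 1) ^ n : MvPolynomial (Fin 2 ⊕ Fin 2) k) ((n : ℤ), 0) := by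
      simpa [parBideg, wt] using (isWeightedHomogeneous_X k (parBideg m2 σ₁) (Sum.inl 1)).pow n
    have hθ := weightedHomogeneousComponent_aeval (bideg _) (parBideg m2 σ₁) (theta k m2 σ₁)
      (theta_X_isWeightedHomogeneous h)
    have hp' := hp.weightedHomogeneousComponent_same
    rw [thetaBar_mk, thetaBar_mk, ← hθ]
    apply mul_left_cancel₀ (pow_ne_zero n (X_ne_zero (R := k) (Sum.inl 1 : Fin 2 ⊕ Fin 2)))
    rw [← weightedHomogeneousComponent_mul_of_left _ hy, hf,
      show (((n : ℤ), (0 : ℤ)) + ((u : ℤ), ((s + 1 : ℕ) : ℤ))) = ((n : ℤ), 1) + ((u : ℤ), (s : ℤ)) by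
        ext <;> simp [add_comm],
      weightedHomogeneousComponent_mul_of_left _ hG, hθ, hp']

end Scroll

open Scroll

/-!
STATEMENT 0 (Theorem main1).  With the notation above, writing `A = S/H`,
`𝒜A` for the image of `𝒜` in `A`, and `K^{(n)}` for the `n`-th symbolic power of `K`:
(a) `yⁿ·𝒜A = g·K^{(n)}` as ideals of `A`;
(b) `yⁿ ∉ H` and `g ∉ H`;
(c) the bi-graded `A`-modules `𝒜A` and `K^{(n)}(0,−1)` are isomorphic, i.e. there is an
`A`-module isomorphism `K^{(n)} ≅ 𝒜A` sending elements of bidegree `(u,s)` to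
elements of bidegree `(u,s+1)`.
-/

theorem rees_ideal_eq_divisor_on_scroll
    {k : Type*} [Field k] (m2 σ₁ σ₂ ρ n : ℕ)
    (hdata : ScrollData m2 σ₁ σ₂ ρ n)
    (col : Fin (m2 + 2) → MvPolynomial (Fin 2) k)
    (hI : ScrollIdealData k m2 σ₁ n col) :
    -- (a)
    (Ideal.span {Ideal.Quotient.mk (scrollH k m2 σ₁) ((X (Sum.inl 1) : MvPolynomial (Fin 2 ⊕ Fin (m2 + 2)) k) ^ n)}
        * Ideal.map (Ideal.Quotient.mk (scrollH k m2 σ₁)) (reesDefIdeal k m2 σ₁ col)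
      = Ideal.span {Ideal.Quotient.mk (scrollH k m2 σ₁) (scrollg k m2 col)}
          * symbolicPower (scrollK k m2 σ₁) n) ∧
    -- (b)
    ((X (Sum.inl 1) : MvPolynomial (Fin 2 ⊕ Fin (m2 + 2)) k) ^ n ∉ scrollH k m2 σ₁ ∧
      scrollg k m2 col ∉ scrollH k m2 σ₁) ∧
    -- (c)
    (∃ e : ↥(symbolicPower (scrollK k m2 σ₁) n) ≃ₗ[MvPolynomial (Fin 2 ⊕ Fin (m2 + 2)) k ⧸ scrollH k m2 σ₁]
          ↥(Ideal.map (Ideal.Quotient.mk (scrollH k m2 σ₁)) (reesDefIdeal k m2 σ₁ col)),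
      ∀ (a : MvPolynomial (Fin 2 ⊕ Fin (m2 + 2)) k ⧸ scrollH k m2 σ₁)
        (ha : a ∈ symbolicPower (scrollK k m2 σ₁) n) (u s : ℕ),
        IsBiHomogeneousQuot a u s →
          IsBiHomogeneousQuot (k := k) (m2 := m2) (σ₁ := σ₁) ↑(e ⟨a, ha⟩) u (s + 1)) := by
  have h : σ₁ ≤ m2 := by
    rcases hdata with ⟨-, -, h | h⟩ <;> omega
  have hn : 2 ≤ n := hdata.2.1
  obtain ⟨hc, hI, -⟩ := hI
  obtain ⟨-, -, -, -, -, hP, -⟩ := exists_hbDelta_eq h hn hc hI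
  set G := biForm (blockP σ₁ col) (blockQ σ₁ col) with hGdef
  have hG0 : G ≠ 0 := biForm_ne_zero hP
  have hGwt : IsWeightedHomogeneous (wt m2 σ₁) G n :=
    biForm_isWeightedHomogeneous (blockP_isHomogeneous hc) (blockQ_isHomogeneous h hc) _
      (c := 1) (fun _ => rfl) (by simp [wt]) (by simp [wt])
  have hGbi : IsWeightedHomogeneous (parBideg m2 σ₁) G ((n : ℤ), 1) :=
    biForm_isWeightedHomogeneous (blockP_isHomogeneous hc) (blockQ_isHomogeneous h hc) _
      (c := (1, 0)) (fun _ => rfl) (by simp [wt, parBideg]) (by simp [wt, parBideg])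
  have hywt := isWeightedHomogeneous_X_inl_pow (k := k) (m2 := m2) (σ₁ := σ₁) 1 n
  have hy0 : (X (Sum.inl 1) ^ n : MvPolynomial (Fin 2 ⊕ Fin 2) k) ≠ 0 := by simp
  have hθy : thetaBar k h (Ideal.Quotient.mk (scrollH k m2 σ₁) (X (Sum.inl 1) ^ n)) =
      X (Sum.inl 1) ^ n := by rw [thetaBar_mk, map_pow, theta_X_inl]
  have hθg : thetaBar k h (Ideal.Quotient.mk (scrollH k m2 σ₁) (scrollg k m2 col)) = G :=
    theta_scrollg
  have hyA : Ideal.Quotient.mk (scrollH k m2 σ₁) (X (Sum.inl 1) ^ n) ≠ 0 := fun h0 => by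
    rw [h0, map_zero] at hθy
    exact hy0 hθy.symm
  have hgA : Ideal.Quotient.mk (scrollH k m2 σ₁) (scrollg k m2 col) ≠ 0 := fun h0 => by
    rw [h0, map_zero] at hθg
    exact hG0 hθg.symm
  have : IsDomain (MvPolynomial (Fin 2 ⊕ Fin (m2 + 2)) k ⧸ scrollH k m2 σ₁) :=
    (thetaBar_injective h).isDomain
  have h1 : ∀ a ∈ Ideal.map (Ideal.Quotient.mk (scrollH k m2 σ₁)) (reesDefIdeal k m2 σ₁ col),
      ∃ b ∈ symbolicPower (scrollK k m2 σ₁) n,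
        Ideal.Quotient.mk (scrollH k m2 σ₁) (X (Sum.inl 1) ^ n) * a =
          Ideal.Quotient.mk (scrollH k m2 σ₁) (scrollg k m2 col) * b := by
    intro a ha
    obtain ⟨f, hf⟩ := (mem_map_reesDefIdeal_iff h hn hc hI a).1 ha
    have hw := wtGE_thetaBar h a
    rw [hf] at hw
    obtain ⟨b, hb⟩ := exists_thetaBar_eq h (X (Sum.inl 1) ^ n * f)
      (((WtGE.of_isWeightedHomogeneous hywt).mul (hw.of_mul hG0 hGwt)).mono (by simp))
    refine ⟨b, (mem_symbolicPower_iff h n b).2 ⟨f, hb⟩, thetaBar_injective h ?_⟩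
    rw [map_mul, map_mul, hθy, hθg, hf, hb, mul_left_comm]
  have h2 : ∀ b ∈ symbolicPower (scrollK k m2 σ₁) n,
      ∃ a ∈ Ideal.map (Ideal.Quotient.mk (scrollH k m2 σ₁)) (reesDefIdeal k m2 σ₁ col),
        Ideal.Quotient.mk (scrollH k m2 σ₁) (X (Sum.inl 1) ^ n) * a =
          Ideal.Quotient.mk (scrollH k m2 σ₁) (scrollg k m2 col) * b := by
    intro b hb
    obtain ⟨f, hf⟩ := (mem_symbolicPower_iff h n b).1 hb
    have hw := wtGE_thetaBar h b
    rw [hf] at hw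
    obtain ⟨a, ha⟩ := exists_thetaBar_eq h (G * f)
      (((WtGE.of_isWeightedHomogeneous hGwt).mul (hw.of_mul hy0 hywt)).mono (by simp))
    refine ⟨a, (mem_map_reesDefIdeal_iff h hn hc hI a).2 ⟨f, ha⟩, thetaBar_injective h ?_⟩
    rw [map_mul, map_mul, hθy, hθg, hf, ha, mul_left_comm]
  refine ⟨span_singleton_mul_eq_of_forall h1 h2,
    ⟨fun hy => hyA (Ideal.Quotient.eq_zero_iff_mem.2 hy),
      fun hg => hgA (Ideal.Quotient.eq_zero_iff_mem.2 hg)⟩, ?_⟩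
  obtain ⟨e, he⟩ := exists_linearEquiv_of_forall hyA hgA h1 h2
  refine ⟨e, fun a ha u s hus => isBiHomogeneousQuot_of_mul_eq h hGbi ?_ hus⟩
  have := congrArg (thetaBar k h) (he ⟨a, ha⟩)
  rwa [map_mul, map_mul, hθy, hθg] at this
end

section
/- Let M be an m×(m−2) matrix whose entries are homogeneous linear forms from R = k[x,y]. Suppose there exists a column vector φ'' ∈ R^m of homogeneous forms of one common degree such that the ideal of maximal minors of the m×(m−1) matrix [M φ''] has height two in R. Then there exist matrices U ∈ GL_m(k) and V ∈ GL_{m−2}(k) and non-negative integers τ ≤ σ with σ + τ = m − 2 such that UMV is the block matrix with diagonal blocks D(σ) and D(τ). -/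
open MvPolynomial

/-- The `m × r` block matrix `[[D(σ),0],[0,D(τ)]]` (with `r = σ + τ`), where `D(a)` is the
`(a+1) × a` matrix with `x` on the main diagonal and `y` on the subdiagonal. -/
noncomputable def scrollBlockMatrix (k : Type*) [CommSemiring k] (m r σ : ℕ) :
    Matrix (Fin m) (Fin r) (MvPolynomial (Fin 2) k) :=
  Matrix.of fun i j =>
    if (j : ℕ) < σ then
      (if (i : ℕ) = (j : ℕ) then X 0 else if (i : ℕ) = (j : ℕ) + 1 then X 1 else 0)
    else
      (if (i : ℕ) = (j : ℕ) + 1 then X 0 else if (i : ℕ) = (j : ℕ) + 2 then X 1 else 0)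

/-!
STATEMENT 2 (Proposition P28.1).  `m` is written as `m' + 2`, so `M` is an
`(m'+2) × m'` matrix of linear forms in `R = k[x,y]`.  If there is a column `φ''` of
forms of one common degree such that the ideal of maximal minors of `[M φ'']` has
height two, then `M` can be transformed, by invertible row and column operations
over `k`, into the block matrix `[[D(σ),0],[0,D(τ)]]` with `τ ≤ σ`, `σ + τ = m'`.
-/

open Module

theorem mem_of_mulVec_mem_of_height_le_one {R : Type*} [CommRing R] {m' : ℕ}
    {M : Matrix (Fin (m' + 2)) (Fin m') R} {φ : Fin (m' + 2) → R}
    (hI : idealHeight (Ideal.span (Set.range fun i : Fin (m' + 2) =>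
        ((Matrix.of fun a (b : Fin (m' + 1)) =>
            if h : (b : ℕ) < m' then M a ⟨b, h⟩ else φ a).submatrix i.succAbove id).det)) = 2)
    {q : PrimeSpectrum R} (hq : Order.height q ≤ 1) {c : Fin m' → R}
    (hc : ∀ i, M.mulVec c i ∈ q.asIdeal) (j : Fin m') : c j ∈ q.asIdeal := by
  by_contra hj
  have hle : Ideal.span (Set.range fun i : Fin (m' + 2) =>
        ((Matrix.of fun a (b : Fin (m' + 1)) =>
            if h : (b : ℕ) < m' then M a ⟨b, h⟩ else φ a).submatrix i.succAbove id).det)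
      ≤ q.asIdeal := by
    rw [Ideal.span_le]
    rintro _ ⟨i, rfl⟩
    rw [SetLike.mem_coe, ← Ideal.Quotient.eq_zero_iff_mem, RingHom.map_det,
      ← Matrix.exists_mulVec_eq_zero_iff]
    refine ⟨fun b => if h : (b : ℕ) < m' then Ideal.Quotient.mk _ (c ⟨b, h⟩) else 0, ?_, ?_⟩
    · intro h
      apply hj
      rw [← Ideal.Quotient.eq_zero_iff_mem]
      simpa using congrFun h j.castSucc
    · ext a
      have := hc (i.succAbove a)
      rw [← Ideal.Quotient.eq_zero_iff_mem] at this
      simpa [Matrix.mulVec, dotProduct, Fin.sum_univ_castSucc] using this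
  have h2 : idealHeight _ ≤ Order.height q := iInf₂_le q hle
  rw [hI] at h2
  exact absurd (h2.trans hq) (by norm_num)

theorem exists_height_le_one_of_not_isUnit {R : Type*} [CommRing R] [IsNoetherianRing R]
    {r : R} (hr : ¬ IsUnit r) : ∃ q : PrimeSpectrum R, Order.height q ≤ 1 ∧ r ∈ q.asIdeal := by
  obtain ⟨p, hp⟩ := Ideal.nonempty_minimalPrimes (I := Ideal.span {r})
    (by rwa [Ne, Ideal.span_singleton_eq_top])
  refine ⟨⟨p, hp.isPrime⟩, ?_, hp.le (Ideal.mem_span_singleton_self r)⟩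
  rw [← PrimeSpectrum.height_eq_orderHeight]
  exact Ideal.height_le_one_of_isPrincipal_of_mem_minimalPrimes _ _ hp

theorem isHomogeneous_one_fin_two {k : Type*} [CommSemiring k] {p : MvPolynomial (Fin 2) k}
    (hp : p.IsHomogeneous 1) :
    p = C (coeff (Finsupp.single 0 1) p) * X 0 + C (coeff (Finsupp.single 1 1) p) * X 1 := by
  ext d
  by_cases hd : d.degree = 1
  · obtain ⟨i, rfl⟩ : ∃ i, d = Finsupp.single i 1 := by
      simp only [Finsupp.degree_eq_sum, Fin.sum_univ_two, Nat.add_eq_one_iff] at hd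
      obtain ⟨h0, h1⟩ | ⟨h0, h1⟩ := hd
      · refine ⟨1, ?_⟩
        ext i
        fin_cases i <;> simp [h0, h1]
      · refine ⟨0, ?_⟩
        ext i
        fin_cases i <;> simp [h0, h1]
    fin_cases i <;> simp [coeff_C_mul, coeff_X, Finsupp.single_left_inj]
  · rw [hp.coeff_eq_zero hd]
    have h : ∀ i : Fin 2, Finsupp.single i 1 ≠ d := by
      rintro i rfl
      simp at hd
    simp [coeff_C_mul, coeff_X, h]


universe u

theorem exists_basis_sum_extending {k : Type*} {W : Type u} {ι : Type*} [Field k] [AddCommGroup W] [Module k W]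
    {v : ι → W} (hv : LinearIndependent k v) :
    ∃ (κ : Type u) (b : Basis (ι ⊕ κ) k W), ∀ i, b (Sum.inl i) = v i :=
  ⟨_, Basis.sumQuot (Basis.span hv) (Basis.ofVectorSpace k _), fun i => by
    rw [Basis.sumQuot_inl, Basis.span_apply]⟩

/-- Splits the blocks of sizes `s i + 1` into their first `s i` entries and their last entry. -/
def sigmaFinSuccEquiv {ι : Type*} (s : ι → ℕ) :
    (Σ i, Fin (s i)) ⊕ ι ≃ Σ i, Fin (s i + 1) where
  toFun := Sum.elim (fun p => ⟨p.1, p.2.castSucc⟩) (fun i => ⟨i, Fin.last _⟩)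
  invFun p := Fin.lastCases (motive := fun _ => (Σ i, Fin (s i)) ⊕ ι)
    (Sum.inr p.1) (fun j => Sum.inl ⟨p.1, j⟩) p.2
  left_inv := by rintro (⟨i, j⟩ | i) <;> simp
  right_inv := by
    rintro ⟨i, j⟩
    induction j using Fin.lastCases <;> simp

/-- Prolongs every block by one entry and adds empty blocks. -/
def sigmaFinSumElimEquiv {ι κ : Type*} (s : ι → ℕ) :
    (Σ i, Fin (s i + 1)) ≃ Σ i : ι ⊕ κ, Fin (Sum.elim (fun i => s i + 1) (fun _ => 0) i) where
  toFun p := ⟨Sum.inl p.1, p.2⟩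
  invFun
    | ⟨Sum.inl i, j⟩ => ⟨i, j⟩
    | ⟨Sum.inr _, j⟩ => Fin.elim0 j
  left_inv _ := rfl
  right_inv := by
    rintro ⟨i | i, j⟩
    · rfl
    · exact Fin.elim0 j

theorem exists_chain_bases {k : Type*} [Field k] (n : ℕ) :
    ∀ {V W : Type u} [AddCommGroup V] [Module k V] [AddCommGroup W] [Module k W]
      [FiniteDimensional k V] (A B : V →ₗ[k] W), finrank k V = n → Function.Injective A →
      (∀ S : Submodule k V, S.map B ≤ S.map A → S = ⊥) →
      ∃ (ι : Type u) (s : ι → ℕ) (v : Basis (Σ i, Fin (s i)) k V)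
        (w : Basis (Σ i, Fin (s i + 1)) k W),
        ∀ i j, A (v ⟨i, j⟩) = w ⟨i, j.castSucc⟩ ∧ B (v ⟨i, j⟩) = w ⟨i, j.succ⟩ := by
  induction n using Nat.strong_induction_on with
  | _ n ih =>
  intro V W _ _ _ _ _ A B hn hA hAB
  by_cases htop : (LinearMap.range A).comap B = ⊤
  · have hV : (⊤ : Submodule k V) = ⊥ := hAB ⊤ (by
      rw [Submodule.map_top A, Submodule.map_le_iff_le_comap, htop])
    have : Subsingleton V := (Submodule.subsingleton_iff k).1 (subsingleton_of_bot_eq_top hV.symm)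
    let b := Basis.ofVectorSpace k W
    exact ⟨_, fun _ => 0, @Basis.empty _ k V _ _ _ _ ⟨fun p => p.2.elim0⟩, b.reindex
      (Equiv.sigmaUnique _ (fun _ => Fin 1)).symm,
      fun _ j => j.elim0⟩
  set V₂ := (LinearMap.range A).comap B
  let B' : V₂ →ₗ[k] V := (LinearEquiv.ofInjective A hA).symm.toLinearMap ∘ₗ
    B.restrict (fun _ h => h : ∀ x ∈ V₂, B x ∈ LinearMap.range A)
  have hB' : ∀ x : V₂, A (B' x) = B x := fun x => by
    have := (LinearEquiv.ofInjective A hA).apply_symm_apply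
      (B.restrict (fun _ h => h : ∀ x ∈ V₂, B x ∈ LinearMap.range A) x)
    exact congrArg Subtype.val this
  obtain ⟨ι, s, v', w', hvw⟩ := ih _ (hn ▸ Submodule.finrank_lt htop) V₂.subtype B' rfl
    V₂.injective_subtype (by
      intro S hS
      have : S.map V₂.subtype = ⊥ := hAB _ (by
        rintro _ ⟨_, ⟨x, hx, rfl⟩, rfl⟩
        exact ⟨B' x, hS ⟨x, hx, rfl⟩, hB' x⟩)
      exact Submodule.map_injective_of_injective V₂.injective_subtype (by simpa using this))
  have hind : LinearIndependent k
      (fun i => (LinearMap.range A).mkQ (B (w' ⟨i, Fin.last _⟩))) := by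
    rw [linearIndependent_iff]
    intro l hl
    set x := Finsupp.linearCombination k (fun i => w' ⟨i, Fin.last _⟩) l with hx
    have hlx : (LinearMap.range A).mkQ (B x) = 0 := by
      rw [hx, ← hl, ← LinearMap.comp_apply, Finsupp.apply_linearCombination]
      rfl
    have hxV : x ∈ V₂ := by
      rw [Submodule.mkQ_apply, Submodule.Quotient.mk_eq_zero] at hlx
      exact hlx
    ext i
    have h1 : w'.coord ⟨i, Fin.last _⟩ ∘ₗ V₂.subtype = 0 := v'.ext fun p => by
      have : (⟨i, Fin.last _⟩ : Σ i, Fin (s i + 1)) ≠ ⟨p.1, p.2.castSucc⟩ := by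
        rintro h
        obtain ⟨rfl, h⟩ := Sigma.mk.inj_iff.1 h
        exact Fin.castSucc_ne_last _ (eq_of_heq h).symm
      rw [LinearMap.comp_apply, (hvw p.1 p.2).1]
      simp [this.symm]
    have h2 : w'.coord ⟨i, Fin.last _⟩ ∘ₗ
        Finsupp.linearCombination k (fun i => w' ⟨i, Fin.last _⟩) = Finsupp.lapply i := by
      ext j
      by_cases h : j = i
      · subst h; simp
      · have : (⟨j, Fin.last _⟩ : Σ i, Fin (s i + 1)) ≠ ⟨i, Fin.last _⟩ :=
          fun h' => h (congrArg Sigma.fst h')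
        simp [this, h]
    exact (LinearMap.congr_fun h2 l).symm.trans (LinearMap.congr_fun h1 ⟨x, hxV⟩)
  have hind' := LinearIndependent.sumElim_of_quotient
    (w'.map (LinearEquiv.ofInjective A hA)).linearIndependent _ hind
  obtain ⟨κ, b, hb⟩ := exists_basis_sum_extending hind'
  refine ⟨ι ⊕ κ, _, w'.reindex (sigmaFinSumElimEquiv s), b.reindex ((Equiv.sumAssoc _ _ _).trans
    (((sigmaFinSumElimEquiv s).sumCongr (Equiv.refl _)).trans (sigmaFinSuccEquiv _))), ?_⟩
  have hA' : ∀ p, b (Sum.inl (Sum.inl p)) = A (w' p) := fun p => by simp [hb]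
  have hB'' : ∀ i, b (Sum.inl (Sum.inr i)) = B (w' ⟨i, Fin.last _⟩) := fun i => by simp [hb]
  rintro (i | i) j
  · have hv : w'.reindex (sigmaFinSumElimEquiv (κ := κ) s) ⟨Sum.inl i, j⟩ = w' ⟨i, j⟩ := by
      simp [sigmaFinSumElimEquiv]
    rw [hv]
    change Fin (s i + 1) at j
    constructor
    · rw [← hA', Basis.reindex_apply]
      congr 1
      rw [Equiv.eq_symm_apply]
      rfl
    · induction j using Fin.lastCases with
      | last =>
        rw [← hB'', Basis.reindex_apply]
        congr 1
        rw [Equiv.eq_symm_apply]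
        rfl
      | cast j =>
        rw [← (hvw i j).1, Submodule.subtype_apply, ← hB', (hvw i j).2, ← hA', Basis.reindex_apply]
        congr 1
        rw [Equiv.eq_symm_apply]
        rfl
  · exact j.elim0

theorem eq_zero_of_mul_map_eq_mul {k : Type*} [Field k] {m' d : ℕ}
    {M : Matrix (Fin (m' + 2)) (Fin m') (MvPolynomial (Fin 2) k)}
    {φ : Fin (m' + 2) → MvPolynomial (Fin 2) k}
    (hI : idealHeight (Ideal.span (Set.range fun i : Fin (m' + 2) =>
        ((Matrix.of fun a (b : Fin (m' + 1)) =>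
            if h : (b : ℕ) < m' then M a ⟨b, h⟩ else φ a).submatrix i.succAbove id).det)) = 2)
    {T : Matrix (Fin m') (Fin d) k} {L : Matrix (Fin d) (Fin m') k} (hLT : L * T = 1)
    {Q : Matrix (Fin (m' + 2)) (Fin d) (MvPolynomial (Fin 2) k)}
    {P : Matrix (Fin d) (Fin d) (MvPolynomial (Fin 2) k)}
    (hP : ∀ i j, constantCoeff (P i j) = 0)
    (h : M * T.map (C : k →+* MvPolynomial (Fin 2) k) = Q * P) : d = 0 := by
  by_contra hd
  have hdet : ¬ IsUnit P.det := fun hu => by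
    have : Nonempty (Fin d) := ⟨⟨0, Nat.pos_of_ne_zero hd⟩⟩
    have hu' := hu.map (constantCoeff (R := k) (σ := Fin 2))
    have hP' : (constantCoeff (R := k) (σ := Fin 2)).mapMatrix P = 0 := by
      ext i j
      exact hP i j
    rw [RingHom.map_det, hP', Matrix.det_zero] at hu'
    exact not_isUnit_zero hu'
  obtain ⟨q, hq, hPq⟩ := exists_height_le_one_of_not_isUnit hdet
  rw [← Ideal.Quotient.eq_zero_iff_mem, RingHom.map_det,
    ← Matrix.exists_mulVec_eq_zero_iff] at hPq
  obtain ⟨u, hu, hPu⟩ := hPq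
  choose u' hu' using fun j => Ideal.Quotient.mk_surjective (u j)
  have hPu' : ∀ i, P.mulVec u' i ∈ q.asIdeal := fun i => by
    have := congrFun hPu i
    rw [← Ideal.Quotient.eq_zero_iff_mem]
    simpa [Matrix.mulVec, dotProduct, hu'] using this
  have hmem {m n : ℕ} (N : Matrix (Fin m) (Fin n) (MvPolynomial (Fin 2) k))
      {c : Fin n → MvPolynomial (Fin 2) k} (hc : ∀ j, c j ∈ q.asIdeal) (i : Fin m) :
      N.mulVec c i ∈ q.asIdeal := by
    simp only [Matrix.mulVec, dotProduct]
    exact Ideal.sum_mem _ fun j _ => Ideal.mul_mem_left _ _ (hc j)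
  have hc := mem_of_mulVec_mem_of_height_le_one hI hq
    (c := (T.map (C : k →+* MvPolynomial (Fin 2) k)).mulVec u') fun i => by
      rw [Matrix.mulVec_mulVec, h, ← Matrix.mulVec_mulVec]
      exact hmem Q hPu' i
  have hLT' : L.map (C : k →+* MvPolynomial (Fin 2) k) *
      T.map (C : k →+* MvPolynomial (Fin 2) k) = 1 := by
    rw [← Matrix.map_mul, hLT]
    exact Matrix.map_one _ C_0 C_1
  apply hu
  ext j
  rw [← hu', Pi.zero_apply, Ideal.Quotient.eq_zero_iff_mem, ← Matrix.one_mulVec u', ← hLT',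
    ← Matrix.mulVec_mulVec]
  exact hmem _ hc j

theorem exists_matrix_left_inverse {k : Type*} [Field k] {m d : ℕ} {T : Matrix (Fin m) (Fin d) k}
    (hT : LinearIndependent k T.col) : ∃ L : Matrix (Fin d) (Fin m) k, L * T = 1 := by
  obtain ⟨g, hg⟩ := T.mulVecLin.exists_leftInverse_of_injective
    (LinearMap.ker_eq_bot.2 (Matrix.mulVec_injective_iff.2 hT))
  refine ⟨LinearMap.toMatrix' g, ?_⟩
  have h := LinearMap.toMatrix'_comp g T.mulVecLin
  rw [hg, LinearMap.toMatrix'_id, ← Matrix.toLin'_apply', LinearMap.toMatrix'_toLin'] at h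
  exact h.symm

theorem injective_and_eq_bot_of_idealHeight {k : Type*} [Field k] {m' : ℕ}
    {A B : Matrix (Fin (m' + 2)) (Fin m') k}
    {M : Matrix (Fin (m' + 2)) (Fin m') (MvPolynomial (Fin 2) k)}
    {φ : Fin (m' + 2) → MvPolynomial (Fin 2) k}
    (hM : M = (X 0 : MvPolynomial (Fin 2) k) • A.map (C : k →+* MvPolynomial (Fin 2) k) +
      (X 1 : MvPolynomial (Fin 2) k) • B.map (C : k →+* MvPolynomial (Fin 2) k))
    (hI : idealHeight (Ideal.span (Set.range fun i : Fin (m' + 2) =>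
        ((Matrix.of fun a (b : Fin (m' + 1)) =>
            if h : (b : ℕ) < m' then M a ⟨b, h⟩ else φ a).submatrix i.succAbove id).det)) = 2) :
    Function.Injective A.mulVecLin ∧
      ∀ S : Submodule k (Fin m' → k), S.map B.mulVecLin ≤ S.map A.mulVecLin → S = ⊥ := by
  constructor
  · rw [← LinearMap.ker_eq_bot, LinearMap.ker_eq_bot']
    intro v hv
    by_contra hv0
    obtain ⟨L, hL⟩ := exists_matrix_left_inverse (T := Matrix.of fun i (_ : Fin 1) => v i)
      (LinearIndependent.of_subsingleton (i := 0) hv0)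
    refine one_ne_zero (eq_zero_of_mul_map_eq_mul hI hL
      (Q := (B * Matrix.of fun i (_ : Fin 1) => v i).map C)
      (P := (X 1 : MvPolynomial (Fin 2) k) • 1) (fun i j => by simp) ?_)
    have hAv : A * Matrix.of (fun i (_ : Fin 1) => v i) = 0 := by
      ext i j
      exact congrFun hv i
    rw [hM, Matrix.add_mul, Matrix.smul_mul, Matrix.smul_mul, ← Matrix.map_mul, ← Matrix.map_mul, hAv]
    simp
  · intro S hS
    let b := finBasis k S
    choose s hsS hs using fun j => hS ⟨_, (b j).2, rfl⟩
    set T : Matrix (Fin m') (Fin (finrank k S)) k := Matrix.of fun i j => (b j : Fin m' → k) i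
    obtain ⟨L, hL⟩ := exists_matrix_left_inverse (T := T)
      (b.linearIndependent.map' S.subtype S.ker_subtype)
    set Z : Matrix (Fin (finrank k S)) (Fin (finrank k S)) k :=
      Matrix.of fun i j => b.repr ⟨s j, hsS j⟩ i
    have hZ : B * T = A * (T * Z) := by
      ext i j
      have hTZ : (T * Z).col j = s j := by
        ext l
        have := congrFun (congrArg Subtype.val (b.sum_repr ⟨s j, hsS j⟩)) l
        simp only [Submodule.coe_sum, Submodule.coe_smul, Finset.sum_apply, Pi.smul_apply,
          smul_eq_mul] at this
        rw [← this, Matrix.col_apply, Matrix.mul_apply]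
        exact Finset.sum_congr rfl fun _ _ => mul_comm _ _
      have h1 : (A * (T * Z)) i j = A.mulVec ((T * Z).col j) i := rfl
      rw [h1, hTZ]
      exact (congrFun (hs j) i).symm
    rw [← Submodule.finrank_eq_zero]
    refine eq_zero_of_mul_map_eq_mul hI hL (Q := (A * T).map C)
      (P := (X 0 : MvPolynomial (Fin 2) k) • 1 +
        (X 1 : MvPolynomial (Fin 2) k) • Z.map (C : k →+* MvPolynomial (Fin 2) k))
      (fun i j => by simp) ?_
    rw [hM, Matrix.add_mul, Matrix.smul_mul, Matrix.smul_mul, ← Matrix.map_mul, ← Matrix.map_mul, hZ,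
      ← Matrix.mul_assoc, Matrix.map_mul (L := A * T)]
    simp [Matrix.mul_add]

/-- The index map concatenating the blocks `i₀` and `i₁` of a family of blocks of sizes `s`. -/
def twoBlockIndex {ι : Type*} (s : ι → ℕ) (i₀ i₁ : ι) {N : ℕ} (h : s i₀ + s i₁ = N) (j : Fin N) :
    Σ i, Fin (s i) :=
  if hj : (j : ℕ) < s i₀ then ⟨i₀, ⟨j, hj⟩⟩ else ⟨i₁, ⟨j - s i₀, by omega⟩⟩

theorem twoBlockIndex_injective {ι : Type*} (s : ι → ℕ) {i₀ i₁ : ι} (hne : i₀ ≠ i₁) {N : ℕ}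
    (h : s i₀ + s i₁ = N) : Function.Injective (twoBlockIndex s i₀ i₁ h) := by
  intro a b hab
  unfold twoBlockIndex at hab
  ext
  split_ifs at hab
  · simpa using hab
  · exact absurd (congrArg Sigma.fst hab) hne
  · exact absurd (congrArg Sigma.fst hab) hne.symm
  · simp at hab
    omega

theorem linear_matrix_normal_form_of_height_two
    {k : Type*} [Field k] (m' : ℕ)
    (M : Matrix (Fin (m' + 2)) (Fin m') (MvPolynomial (Fin 2) k))
    (hM : ∀ i j, (M i j).IsHomogeneous 1)
    (hcol : ∃ (φ'' : Fin (m' + 2) → MvPolynomial (Fin 2) k) (e : ℕ),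
      (∀ i, (φ'' i).IsHomogeneous e) ∧
      idealHeight (Ideal.span (Set.range fun i : Fin (m' + 2) =>
        ((Matrix.of fun a (b : Fin (m' + 1)) =>
            if h : (b : ℕ) < m' then M a ⟨b, h⟩ else φ'' a).submatrix
          i.succAbove id).det)) = 2) :
    ∃ (U : Matrix (Fin (m' + 2)) (Fin (m' + 2)) k) (V : Matrix (Fin m') (Fin m') k),
      IsUnit U.det ∧ IsUnit V.det ∧
      ∃ σ τ : ℕ, τ ≤ σ ∧ σ + τ = m' ∧
        (U.map (fun a => (MvPolynomial.C a : MvPolynomial (Fin 2) k))) * M *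
          (V.map (fun a => (MvPolynomial.C a : MvPolynomial (Fin 2) k))) =
          scrollBlockMatrix k (m' + 2) m' σ := by
  obtain ⟨φ, -, -, hI⟩ := hcol
  set A := M.map (coeff (Finsupp.single 0 1))
  set B := M.map (coeff (Finsupp.single 1 1))
  have hMAB : M = (X 0 : MvPolynomial (Fin 2) k) • A.map (C : k →+* MvPolynomial (Fin 2) k) +
      (X 1 : MvPolynomial (Fin 2) k) • B.map (C : k →+* MvPolynomial (Fin 2) k) := by
    ext1 i j
    rw [isHomogeneous_one_fin_two (hM i j)]
    simp [A, B, mul_comm]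
  obtain ⟨hinj, hbot⟩ := injective_and_eq_bot_of_idealHeight hMAB hI
  obtain ⟨ι, s, v, w, hvw⟩ := exists_chain_bases _ A.mulVecLin B.mulVecLin rfl hinj hbot
  classical
  have hfin : Finite ι := by
    have := Module.Finite.finite_basis w
    exact Finite.of_surjective (fun p : Σ i, Fin (s i + 1) => p.1) fun i => ⟨⟨i, 0⟩, rfl⟩
  have := Fintype.ofFinite ι
  have hcv : ∑ i, s i = m' := by
    simpa using (finrank_eq_card_basis v).symm
  have hcw : Fintype.card ι = 2 := by
    have : ∑ i, (s i + 1) = m' + 2 := by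
      simpa using (finrank_eq_card_basis w).symm
    simp [Finset.sum_add_distrib, hcv] at this
    exact this
  obtain ⟨i₀, i₁, hne, huniv, hle⟩ :
      ∃ i₀ i₁ : ι, i₀ ≠ i₁ ∧ (Finset.univ : Finset ι) = {i₀, i₁} ∧ s i₁ ≤ s i₀ := by
    obtain ⟨a, b, hab, h⟩ := Finset.card_eq_two.1 hcw
    rcases le_total (s a) (s b) with hs | hs
    · exact ⟨b, a, hab.symm, h.trans (Finset.pair_comm _ _), hs⟩
    · exact ⟨a, b, hab, h, hs⟩
  rw [huniv, Finset.sum_pair hne] at hcv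
  have hcw' : (s i₀ + 1) + (s i₁ + 1) = m' + 2 := by omega
  set e := twoBlockIndex s i₀ i₁ hcv
  set f := twoBlockIndex (fun i => s i + 1) i₀ i₁ hcw'
  set V : Matrix (Fin m') (Fin m') k := Matrix.of fun i j => v (e j) i
  set W : Matrix (Fin (m' + 2)) (Fin (m' + 2)) k := Matrix.of fun i j => w (f j) i
  have hV : IsUnit V := Matrix.linearIndependent_cols_iff_isUnit.1
    (v.linearIndependent.comp e (twoBlockIndex_injective _ hne _))
  have hW : IsUnit W := Matrix.linearIndependent_cols_iff_isUnit.1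
    (w.linearIndependent.comp f (twoBlockIndex_injective (fun i => s i + 1) hne _))
  have hWdet := (Matrix.isUnit_iff_isUnit_det _).1 hW
  have hMV : M * V.map (C : k →+* MvPolynomial (Fin 2) k) =
      W.map (C : k →+* MvPolynomial (Fin 2) k) * scrollBlockMatrix k (m' + 2) m' (s i₀) := by
    ext1 i j
    obtain ⟨a, b, hfa, hfb, hD⟩ : ∃ a b : Fin (m' + 2),
        f a = ⟨(e j).1, (e j).2.castSucc⟩ ∧ f b = ⟨(e j).1, (e j).2.succ⟩ ∧
        ∀ l, scrollBlockMatrix k (m' + 2) m' (s i₀) l j =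
          (if l = a then X 0 else 0) + (if l = b then X 1 else 0) := by
      by_cases hj : (j : ℕ) < s i₀
      · have hej : e j = ⟨i₀, ⟨j, hj⟩⟩ := dif_pos hj
        rw [hej]
        refine ⟨⟨j, by omega⟩, ⟨j + 1, by omega⟩, ?_, ?_, fun l => ?_⟩
        · exact dif_pos (Nat.lt_succ_of_lt hj)
        · exact dif_pos (Nat.succ_lt_succ hj)
        · simp only [scrollBlockMatrix, Matrix.of_apply, if_pos hj, Fin.ext_iff]
          split_ifs <;> first | omega | simp
      · have hej : e j = ⟨i₁, ⟨j - s i₀, by omega⟩⟩ := dif_neg hj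
        have h2 : ¬ ((j : ℕ) + 2 < s i₀ + 1) := by omega
        rw [hej]
        refine ⟨⟨j + 1, by omega⟩, ⟨j + 2, by omega⟩, ?_, ?_, fun l => ?_⟩
        · simp [f, twoBlockIndex, hj]
        · have h3 : (j : ℕ) + 2 - (s i₀ + 1) = j - s i₀ + 1 := by omega
          simp [f, twoBlockIndex, h2, h3]
        · simp only [scrollBlockMatrix, Matrix.of_apply, if_neg hj, Fin.ext_iff]
          split_ifs <;> first | omega | simp
    obtain ⟨hAv, hBv⟩ := hvw (e j).1 (e j).2
    rw [← hfa] at hAv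
    rw [← hfb] at hBv
    have hAV : (A * V) i j = W i a := congrFun hAv i
    have hBV : (B * V) i j = W i b := congrFun hBv i
    rw [hMAB, Matrix.add_mul, Matrix.smul_mul, Matrix.smul_mul, ← Matrix.map_mul,
      ← Matrix.map_mul, Matrix.mul_apply, Matrix.add_apply, Matrix.smul_apply, Matrix.smul_apply,
      Matrix.map_apply, Matrix.map_apply, hAV, hBV]
    simp [hD, mul_add, Finset.sum_add_distrib]
    ring
  refine ⟨W⁻¹, V, Matrix.isUnit_nonsing_inv_det W hWdet, (Matrix.isUnit_iff_isUnit_det _).1 hV,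
    s i₀, s i₁, hle, hcv, ?_⟩
  change W⁻¹.map (C : k →+* MvPolynomial (Fin 2) k) * M *
    V.map (C : k →+* MvPolynomial (Fin 2) k) = _
  rw [Matrix.mul_assoc, hMV, ← Matrix.mul_assoc, ← Matrix.map_mul, Matrix.nonsing_inv_mul W hWdet,
    Matrix.map_one _ C_0 C_1, Matrix.one_mul]
end

section
/- Let I be a height two ideal in R = k[x,y]. Then I has a homogeneous minimal free resolution of the form 0 → R(−d−1)^{m−2} ⊕ R(−d−n) → R(−d)^m → I → 0 (with d = n + m − 2) if and only if there exist non-negative integers σ and τ with σ + τ = m − 2 and relatively prime homogeneous forms F₁ and F₂ in R with deg F₁ = n + σ and deg F₂ = n + τ such that I = (x,y)^τ F₁ + (x,y)^σ F₂. -/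
open MvPolynomial

/-- An element `v` of the graded free module `⊕ᵢ R(−t₀ i)` over `R = k[x,y]` is
homogeneous of degree `e`; i.e. each component `v i` is homogeneous of degree `e - t₀ i`. -/
def VecIsHomogeneous {k : Type*} [Field k] {p : ℕ} (t0 : Fin p → ℕ) (e : ℕ)
    (v : Fin p → MvPolynomial (Fin 2) k) : Prop :=
  ∀ i, (v i).IsHomogeneous (e - t0 i) ∧ (v i ≠ 0 → t0 i ≤ e)

/-- `HasMinimalGradedResolution I t0 t1` says that the (necessarily unique up to
isomorphism) minimal homogeneous free resolution of the ideal `I ⊆ k[x,y]` has the form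
`0 → ⊕ⱼ R(−t1 j) → ⊕ⱼ R(−t0 j) → I → 0` :
there are homogeneous generators `g j` of `I` of degrees `t0 j`, no one of which is
redundant, and a homogeneous basis `s j` (of degrees `t1 j`) of the syzygy module of `g`,
with all entries of the syzygy matrix in the maximal homogeneous ideal. -/
def HasMinimalGradedResolution {k : Type*} [Field k] {p q : ℕ}
    (I : Ideal (MvPolynomial (Fin 2) k)) (t0 : Fin p → ℕ) (t1 : Fin q → ℕ) : Prop :=
  ∃ (g : Fin p → MvPolynomial (Fin 2) k) (s : Fin q → Fin p → MvPolynomial (Fin 2) k),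
    (∀ j, (g j).IsHomogeneous (t0 j)) ∧
    Ideal.span (Set.range g) = I ∧
    (∀ j, g j ∉ Ideal.span (g '' {j' | j' ≠ j})) ∧
    (∀ j, VecIsHomogeneous t0 (t1 j) (s j)) ∧
    (∀ j i, MvPolynomial.coeff 0 (s j i) = 0) ∧
    LinearIndependent (MvPolynomial (Fin 2) k) s ∧
    (∀ v : Fin p → MvPolynomial (Fin 2) k,
      (∑ i, v i * g i = 0) ↔ v ∈ Submodule.span (MvPolynomial (Fin 2) k) (Set.range s))

/-- The Castelnuovo-Mumford regularity `max_{i,j} (t_{i,j} - i)` read off from the twists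
of a free resolution `0 → ⊕ⱼ R(−t1 j) → ⊕ⱼ R(−t0 j) → I → 0`. -/
noncomputable def regOfTwists {p q : ℕ} (t0 : Fin p → ℕ) (t1 : Fin q → ℕ) : ℤ :=
  max ((Finset.univ.sup t0 : ℕ) : ℤ) (((Finset.univ.sup t1 : ℕ) : ℤ) - 1)

/-- `I ⊆ k[x,y]` has Castelnuovo-Mumford regularity `r` (for ideals of projective
dimension at most one). -/
def HasRegularity {k : Type*} [Field k] (I : Ideal (MvPolynomial (Fin 2) k)) (r : ℤ) : Prop :=
  ∃ (p q : ℕ) (t0 : Fin p → ℕ) (t1 : Fin q → ℕ),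
    HasMinimalGradedResolution I t0 t1 ∧ regOfTwists t0 t1 = r

namespace MvPolynomial

variable {k : Type*} [Field k]

/-- The substitution `Xᵢ ↦ Xᵢ T`, which records degrees as powers of `T`. -/
noncomputable def gradingHom (k : Type*) [Field k] :
    MvPolynomial (Fin 2) k →ₐ[k] Polynomial (MvPolynomial (Fin 2) k) :=
  aeval fun i => Polynomial.C (X i) * Polynomial.X

lemma gradingHom_monomial (d : Fin 2 →₀ ℕ) (r : k) :
    gradingHom k (monomial d r) = Polynomial.C (monomial d r) * Polynomial.X ^ d.degree := by
  have h : gradingHom k (monomial d r) =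
      Polynomial.C (C r * (X 0 ^ d 0 * X 1 ^ d 1)) * Polynomial.X ^ (d 0 + d 1) := by
    rw [gradingHom, aeval_monomial, Finsupp.prod_fintype _ _ (by simp)]
    simp only [Fin.prod_univ_two, Polynomial.C_mul, Polynomial.C_pow,
      IsScalarTower.algebraMap_apply k (MvPolynomial (Fin 2) k), algebraMap_eq,
      Polynomial.algebraMap_eq]
    ring
  rw [h, monomial_eq, Finsupp.prod_fintype _ _ (by simp), Finsupp.degree_eq_sum]
  simp [Fin.prod_univ_two, Fin.sum_univ_two]

lemma coeff_gradingHom (f : MvPolynomial (Fin 2) k) (j : ℕ) :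
    (gradingHom k f).coeff j = homogeneousComponent j f := by
  induction f using MvPolynomial.induction_on' with
  | monomial d r =>
    rw [gradingHom_monomial, Polynomial.coeff_C_mul_X_pow,
      homogeneousComponent_of_mem (isHomogeneous_monomial r rfl)]
  | add f g hf hg => simp [hf, hg]

lemma gradingHom_of_isHomogeneous {f : MvPolynomial (Fin 2) k} {n : ℕ}
    (hf : f.IsHomogeneous n) : gradingHom k f = Polynomial.C f * Polynomial.X ^ n := by
  ext1 j
  rw [coeff_gradingHom, homogeneousComponent_of_mem hf, Polynomial.coeff_C_mul_X_pow]

lemma homogeneousComponent_mul_of_isHomogeneous {g : MvPolynomial (Fin 2) k} {n : ℕ}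
    (hg : g.IsHomogeneous n) (f : MvPolynomial (Fin 2) k) (i : ℕ) :
    homogeneousComponent (i + n) (f * g) = homogeneousComponent i f * g := by
  rw [← coeff_gradingHom, map_mul, gradingHom_of_isHomogeneous hg, ← mul_assoc,
    Polynomial.coeff_mul_X_pow, Polynomial.coeff_mul_C, coeff_gradingHom]

/-- A factor of a nonzero form is a form. -/
lemma exists_isHomogeneous_of_mul {f g : MvPolynomial (Fin 2) k} {n : ℕ}
    (hfg : (f * g).IsHomogeneous n) (h0 : f * g ≠ 0) :
    ∃ i j, i + j = n ∧ f.IsHomogeneous i ∧ g.IsHomogeneous j := by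
  have hf0 : f ≠ 0 := left_ne_zero_of_mul h0
  have hg0 : g ≠ 0 := right_ne_zero_of_mul h0
  have hne : ∀ {p : MvPolynomial (Fin 2) k}, p ≠ 0 → gradingHom k p ≠ 0 := by
    intro p hp h
    apply hp
    rw [← sum_homogeneousComponent p]
    exact Finset.sum_eq_zero fun i _ => by rw [← coeff_gradingHom, h, Polynomial.coeff_zero]
  have hmul := gradingHom_of_isHomogeneous hfg
  rw [map_mul] at hmul
  have h1 := congrArg Polynomial.natDegree hmul
  have h2 := congrArg Polynomial.natTrailingDegree hmul
  rw [Polynomial.natDegree_mul (hne hf0) (hne hg0), Polynomial.natDegree_C_mul_X_pow _ _ h0] at h1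
  rw [Polynomial.natTrailingDegree_mul (hne hf0) (hne hg0),
    Polynomial.C_mul_X_pow_eq_monomial, Polynomial.natTrailingDegree_monomial h0] at h2
  have h3 := (gradingHom k f).natTrailingDegree_le_natDegree
  have h4 := (gradingHom k g).natTrailingDegree_le_natDegree
  have key : ∀ p : MvPolynomial (Fin 2) k,
      (gradingHom k p).natTrailingDegree = (gradingHom k p).natDegree →
      p.IsHomogeneous (gradingHom k p).natDegree := by
    intro p hp
    rw [← sum_homogeneousComponent p]
    refine IsHomogeneous.sum _ _ _ fun i _ => ?_
    rcases eq_or_ne i (gradingHom k p).natDegree with h | h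
    · rw [sum_homogeneousComponent, ← h]
      exact homogeneousComponent_isHomogeneous i p
    · rw [← coeff_gradingHom]
      rcases lt_or_gt_of_ne h with h | h
      · rw [Polynomial.coeff_eq_zero_of_lt_natTrailingDegree (hp ▸ h)]
        exact isHomogeneous_zero _ _ _
      · rw [Polynomial.coeff_eq_zero_of_natDegree_lt h]
        exact isHomogeneous_zero _ _ _
  exact ⟨_, _, h1, key f (by omega), key g (by omega)⟩

lemma isHomogeneous_of_mul_left {f g : MvPolynomial (Fin 2) k} {i e : ℕ} (hf : f.IsHomogeneous i)
    (hf0 : f ≠ 0) (h : (f * g).IsHomogeneous (i + e)) : g.IsHomogeneous e := by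
  rcases eq_or_ne g 0 with rfl | hg
  · exact isHomogeneous_zero _ _ _
  · obtain ⟨i', j, hij, h1, h2⟩ := exists_isHomogeneous_of_mul h (mul_ne_zero hf0 hg)
    have : i' = i := h1.inj_right hf hf0
    rwa [show e = j by omega]

lemma finrank_homogeneousSubmodule_fin_two (e : ℕ) :
    Module.finrank k (homogeneousSubmodule (Fin 2) k e) = e + 1 := by
  have hcard : Nat.card {d : Fin 2 →₀ ℕ | d.degree = e} = e + 1 := by
    have := Nat.card_congr (α := Fin (e + 1)) (β := {d : Fin 2 →₀ ℕ | d.degree = e})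
      { toFun := fun i => ⟨Finsupp.equivFunOnFinite.symm ![(i : ℕ), e - i], by
          simp [Finsupp.degree_eq_sum, Fin.sum_univ_two]; omega⟩
        invFun := fun d => ⟨d.1 0, by
          have := d.2
          simp only [Set.mem_ofPred_eq, Finsupp.degree_eq_sum, Fin.sum_univ_two] at this
          omega⟩
        left_inv := fun i => by simp
        right_inv := fun d => by
          have := d.2
          simp only [Set.mem_ofPred_eq, Finsupp.degree_eq_sum, Fin.sum_univ_two] at this
          ext i
          fin_cases i <;> simp
          omega }
    rw [← this, Nat.card_fin]
  rw [homogeneousSubmodule_eq_finsupp_supported, ← hcard]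
  exact Module.finrank_eq_nat_card_basis
    (.ofRepr (AddMonoidAlgebra.supportedEquivFinsupp {d : Fin 2 →₀ ℕ | d.degree = e}))

instance finite_homogeneousSubmodule_fin_two (e : ℕ) :
    Module.Finite k (homogeneousSubmodule (Fin 2) k e) :=
  Module.finite_of_finrank_pos (by rw [finrank_homogeneousSubmodule_fin_two]; omega)

lemma isRelPrime_X_pow (a b : ℕ) :
    IsRelPrime (X 0 ^ a : MvPolynomial (Fin 2) k) (X 1 ^ b) := by
  refine IsRelPrime.pow ?_
  refine (X_prime : Prime (X 0 : MvPolynomial (Fin 2) k)).irreducible.isRelPrime_iff_not_dvd.mpr ?_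
  rw [X_dvd_X]
  simp

lemma span_X_pow (τ : ℕ) :
    (Ideal.span {X 0, X 1} : Ideal (MvPolynomial (Fin 2) k)) ^ τ =
      Ideal.span (Set.range fun i : Fin (τ + 1) => X 0 ^ (i : ℕ) * X 1 ^ (τ - i)) := by
  have h : (Ideal.span {X 0, X 1} : Ideal (MvPolynomial (Fin 2) k)) = idealOfVars (Fin 2) k := by
    rw [idealOfVars]
    congr 1
    ext; simp [Fin.exists_fin_two, eq_comm]
  rw [h, pow_idealOfVars_eq_span]
  congr 1
  ext f
  simp only [Set.mem_image, Set.mem_preimage, Set.mem_singleton_iff, Set.mem_range,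
    Finsupp.degree_eq_sum, Fin.sum_univ_two, monomial_eq, C_1, one_mul]
  constructor
  · rintro ⟨d, hd, rfl⟩
    refine ⟨⟨d 0, by omega⟩, ?_⟩
    rw [Finsupp.prod_fintype _ _ (by simp), Fin.prod_univ_two]
    simp [← hd]
  · rintro ⟨i, rfl⟩
    refine ⟨Finsupp.equivFunOnFinite.symm ![(i : ℕ), τ - i], by simp; omega, ?_⟩
    rw [Finsupp.prod_fintype _ _ (by simp), Fin.prod_univ_two]
    simp

/-- A form of degree `n + τ` is a combination of the monomials of degree `τ` with
coefficients forms of degree `n`. -/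
lemma IsHomogeneous.exists_eq_sum_range {n τ : ℕ} {f : MvPolynomial (Fin 2) k}
    (hf : f.IsHomogeneous (n + τ)) :
    ∃ q : ℕ → MvPolynomial (Fin 2) k, (∀ i, (q i).IsHomogeneous n) ∧
      f = ∑ i ∈ Finset.range (τ + 1), q i * (X 0 ^ i * X 1 ^ (τ - i)) := by
  rw [f.as_sum]
  apply Finset.sum_induction _ (fun f : MvPolynomial (Fin 2) k =>
    ∃ q : ℕ → MvPolynomial (Fin 2) k, (∀ i, (q i).IsHomogeneous n) ∧
      f = ∑ i ∈ Finset.range (τ + 1), q i * (X 0 ^ i * X 1 ^ (τ - i)))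
  · rintro _ _ ⟨q, hq, rfl⟩ ⟨r, hr, rfl⟩
    exact ⟨q + r, fun i => (hq i).add (hr i), by simp [add_mul, Finset.sum_add_distrib]⟩
  · exact ⟨0, fun i => isHomogeneous_zero _ _ _, by simp⟩
  · intro d hd
    have hdeg : d.degree = n + τ := by
      by_contra h
      exact mem_support_iff.mp hd (hf.coeff_eq_zero h)
    rw [Finsupp.degree_eq_sum, Fin.sum_univ_two] at hdeg
    obtain ⟨i, hi, hi0, hi1⟩ : ∃ i, i ≤ τ ∧ i ≤ d 0 ∧ τ - i ≤ d 1 := by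
      rcases le_total (d 0) τ with h | h
      · exact ⟨d 0, by omega, by omega, by omega⟩
      · exact ⟨τ, by omega, by omega, by omega⟩
    refine ⟨fun j => if j = i then
      C (coeff d f) * (X 0 ^ (d 0 - i) * X 1 ^ (d 1 - (τ - i))) else 0, fun j => ?_, ?_⟩
    · dsimp only
      split_ifs
      · have := ((isHomogeneous_X_pow (R := k) (0 : Fin 2) (d 0 - i)).mul
          (isHomogeneous_X_pow (R := k) (1 : Fin 2) (d 1 - (τ - i)))).C_mul (coeff d f)
        convert this using 1
        omega
      · exact isHomogeneous_zero _ _ _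
    · simp only [ite_mul, zero_mul, Finset.sum_ite_eq', Finset.mem_range]
      rw [if_pos (by omega), monomial_eq, Finsupp.prod_fintype _ _ (by simp), Fin.prod_univ_two]
      conv_lhs => rw [← Nat.sub_add_cancel hi0, ← Nat.sub_add_cancel hi1]
      ring

end MvPolynomial

section OfForms

variable {k : Type*} [Field k]

/-- A resolution may be presented with arbitrary finite index types; if all entries of the
syzygy matrix lie in the maximal ideal, irredundancy of the generators is automatic. -/
lemma HasMinimalGradedResolution.of_equiv {ι κ : Type*} [Fintype ι] [Fintype κ] {p q : ℕ}
    (eι : Fin p ≃ ι) (eκ : Fin q ≃ κ) {t0 : Fin p → ℕ} {t1 : Fin q → ℕ}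
    {I : Ideal (MvPolynomial (Fin 2) k)}
    (g : ι → MvPolynomial (Fin 2) k) (s : κ → ι → MvPolynomial (Fin 2) k)
    (hg : ∀ i, (g (eι i)).IsHomogeneous (t0 i))
    (hI : Ideal.span (Set.range g) = I)
    (hle : ∀ j i, t0 i ≤ t1 j)
    (hs : ∀ j i, (s (eκ j) (eι i)).IsHomogeneous (t1 j - t0 i))
    (hs0 : ∀ j i, coeff 0 (s j i) = 0)
    (hind : ∀ b : κ → MvPolynomial (Fin 2) k, (∀ i, ∑ j, b j * s j i = 0) → ∀ j, b j = 0)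
    (hsyz : ∀ j, ∑ i, s j i * g i = 0)
    (hex : ∀ v : ι → MvPolynomial (Fin 2) k, ∑ i, v i * g i = 0 →
      ∃ b : κ → MvPolynomial (Fin 2) k, ∀ i, v i = ∑ j, b j * s j i) :
    HasMinimalGradedResolution I t0 t1 := by
  have hex' : ∀ v : Fin p → MvPolynomial (Fin 2) k, (∑ i, v i * g (eι i) = 0) →
      ∃ b : Fin q → MvPolynomial (Fin 2) k, ∀ i, v i = ∑ j, b j * s (eκ j) (eι i) := by
    intro v hv
    obtain ⟨b, hb⟩ := hex (v ∘ eι.symm) (by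
      rw [← hv, ← eι.sum_comp]; simp)
    refine ⟨b ∘ eκ, fun i => ?_⟩
    have := hb (eι i)
    rw [← eκ.sum_comp] at this
    simpa using this
  refine ⟨fun i => g (eι i), fun j i => s (eκ j) (eι i), hg, ?_, ?_, ?_, ?_, ?_, ?_⟩
  · rw [← hI, ← eι.surjective.range_comp g]
    rfl
  · intro j hj
    rw [Ideal.span, Finsupp.mem_span_image_iff_linearCombination] at hj
    obtain ⟨l, hl, hlj⟩ := hj
    have hl0 : l j = 0 := by
      by_contra h
      exact (Finsupp.mem_supported _ l).mp hl (Finsupp.mem_support_iff.mpr h) rfl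
    rw [Finsupp.linearCombination_apply, Finsupp.sum_fintype _ _ (by simp)] at hlj
    obtain ⟨b, hb⟩ := hex' (fun i => l i - if i = j then 1 else 0) (by
      simpa [sub_mul, Finset.sum_sub_distrib, sub_eq_zero] using hlj)
    have hs0' : ∀ j i, constantCoeff (s j i) = 0 := hs0
    have := congrArg constantCoeff (hb j)
    rw [map_sum] at this
    simp only [map_mul, hs0', mul_zero, Finset.sum_const_zero, hl0] at this
    simp at this
  · exact fun j i => ⟨hs j i, fun _ => hle j i⟩
  · exact fun j i => hs0 _ _
  · rw [Fintype.linearIndependent_iff]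
    intro b hb j
    have := hind (b ∘ eκ.symm) (fun i => by
      have := congrFun hb (eι.symm i)
      rw [← eκ.sum_comp]
      simpa using this) (eκ j)
    simpa using this
  · intro v
    rw [Submodule.mem_span_range_iff_exists_fun]
    constructor
    · intro hv
      obtain ⟨b, hb⟩ := hex' v hv
      refine ⟨b, ?_⟩
      ext1 i
      simp [hb i]
    · rintro ⟨b, rfl⟩
      simp only [Finset.sum_apply, Pi.smul_apply, smul_eq_mul, Finset.sum_mul]
      rw [Finset.sum_comm]
      refine Finset.sum_eq_zero fun j _ => ?_
      have := hsyz (eκ j)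
      rw [← eι.sum_comp] at this
      simp [mul_assoc, ← Finset.mul_sum, this]

/-- The monomial `X₀ⁱ X₁^(τ - i)`, of degree `τ` if `i ≤ τ`. -/
noncomputable def monomialForm (k : Type*) [Field k] (τ i : ℕ) : MvPolynomial (Fin 2) k :=
  X 0 ^ i * X 1 ^ (τ - i)

lemma isHomogeneous_monomialForm {τ i : ℕ} (h : i ≤ τ) : (monomialForm k τ i).IsHomogeneous τ := by
  have := (isHomogeneous_X_pow (R := k) (0 : Fin 2) i).mul
    (isHomogeneous_X_pow (R := k) (1 : Fin 2) (τ - i))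
  rwa [show i + (τ - i) = τ by omega] at this

/-- The Koszul relations `X₀ eⱼ - X₁ eⱼ₊₁` between the monomials `X₀ⁱ X₁^(τ - i)`. -/
noncomputable def koszulRelation (k : Type*) [Field k] (j i : ℕ) : MvPolynomial (Fin 2) k :=
  (if j = i then X 0 else 0) - (if j + 1 = i then X 1 else 0)

lemma isHomogeneous_koszulRelation (j i : ℕ) : (koszulRelation k j i).IsHomogeneous 1 := by
  unfold koszulRelation
  refine IsHomogeneous.sub ?_ ?_ <;> split_ifs <;>
    first | exact isHomogeneous_X _ _ | exact isHomogeneous_zero _ _ _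

lemma sum_mul_koszulRelation {τ : ℕ} {B : ℕ → MvPolynomial (Fin 2) k} (h0 : B 0 = 0)
    (hτ : B (τ + 1) = 0) (i : Fin (τ + 1)) :
    ∑ j : Fin τ, B (j + 1) * koszulRelation k j i = X 0 * B (i + 1) - X 1 * B i := by
  rw [Fin.sum_univ_eq_sum_range (fun j => B (j + 1) * koszulRelation k j i) τ]
  obtain ⟨i, hi⟩ := i
  simp only [koszulRelation, mul_sub, Finset.sum_sub_distrib, mul_ite, mul_zero,
    Finset.sum_ite_eq', Finset.mem_range]
  congr 1
  · split_ifs with h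
    · ring
    · rw [show i = τ by omega, hτ, mul_zero]
  · rcases i with _ | i
    · simp [h0]
    · simp only [Nat.add_right_cancel_iff, Finset.sum_ite_eq', Finset.mem_range]
      rw [if_pos (by omega)]
      ring

lemma exists_extension_of_fin {R : Type*} [Zero R] {τ : ℕ} (b : Fin τ → R) :
    ∃ B : ℕ → R, B 0 = 0 ∧ B (τ + 1) = 0 ∧ ∀ j : Fin τ, B (j + 1) = b j := by
  refine ⟨fun n => if h : 0 < n ∧ n ≤ τ then b ⟨n - 1, by omega⟩ else 0, by simp, by simp, ?_⟩
  intro j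
  have := j.2
  simp

lemma koszulRelation_independent {τ : ℕ} (b : Fin τ → MvPolynomial (Fin 2) k)
    (h : ∀ i : Fin (τ + 1), ∑ j : Fin τ, b j * koszulRelation k j i = 0) (j : Fin τ) :
    b j = 0 := by
  obtain ⟨B, h0, hτ, hB⟩ := exists_extension_of_fin b
  simp only [← hB, sum_mul_koszulRelation h0 hτ] at h ⊢
  have key : ∀ n ≤ τ + 1, B n = 0 := by
    intro n
    induction n with
    | zero => exact fun _ => h0
    | succ n ih =>
      intro hn
      have := h ⟨n, by omega⟩
      simp only [ih (by omega), mul_zero, sub_zero, mul_eq_zero, X_ne_zero, false_or] at this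
      exact this
  exact key _ (by omega)

lemma sum_koszulRelation_mul {τ : ℕ} (j : Fin τ) :
    ∑ i : Fin (τ + 1), koszulRelation k j i * monomialForm k τ i = 0 := by
  obtain ⟨j, hj⟩ := j
  rw [Fin.sum_univ_eq_sum_range (fun i => koszulRelation k j i * monomialForm k τ i)]
  simp only [koszulRelation, monomialForm, sub_mul, Finset.sum_sub_distrib, ite_mul, zero_mul,
    Finset.sum_ite_eq, Finset.mem_range]
  rw [if_pos (by omega), if_pos (by omega), show τ - j = τ - (j + 1) + 1 by omega]
  ring

lemma koszulRelation_exact_nat (τ : ℕ) (c : ℕ → MvPolynomial (Fin 2) k)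
    (h : ∑ i ∈ Finset.range (τ + 1), c i * monomialForm k τ i = 0) :
    ∃ B : ℕ → MvPolynomial (Fin 2) k, B 0 = 0 ∧ B (τ + 1) = 0 ∧
      ∀ i ≤ τ, c i = X 0 * B (i + 1) - X 1 * B i := by
  induction τ generalizing c with
  | zero => exact ⟨0, rfl, rfl, fun i hi => by simpa [Nat.le_zero.mp hi, monomialForm] using h⟩
  | succ τ ih =>
    simp only [monomialForm] at h ih
    rw [Finset.sum_range_succ'] at h
    have hsum : ∑ i ∈ Finset.range (τ + 1), c (i + 1) * (X 0 ^ (i + 1) * X 1 ^ (τ + 1 - (i + 1))) =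
        X 0 * ∑ i ∈ Finset.range (τ + 1), c (i + 1) * (X 0 ^ i * X 1 ^ (τ - i)) := by
      rw [Finset.mul_sum]
      refine Finset.sum_congr rfl fun i _ => ?_
      rw [Nat.add_sub_add_right]
      ring
    rw [hsum] at h
    have hdvd : (X 0 : MvPolynomial (Fin 2) k) ∣ c 0 * X 1 ^ (τ + 1) := by
      refine ⟨-∑ i ∈ Finset.range (τ + 1), c (i + 1) * (X 0 ^ i * X 1 ^ (τ - i)), ?_⟩
      simp only [pow_zero, one_mul, Nat.sub_zero] at h
      linear_combination h
    obtain ⟨c', hc'⟩ := (by simpa using isRelPrime_X_pow (k := k) 1 (τ + 1) :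
      IsRelPrime (X 0 : MvPolynomial (Fin 2) k) (X 1 ^ (τ + 1))).dvd_of_dvd_mul_right hdvd
    obtain ⟨B, h0, hτ, hB⟩ := ih (fun i => c (i + 1) + if i = 0 then X 1 * c' else 0) (by
      apply mul_left_cancel₀ (X_ne_zero (0 : Fin 2) : (X 0 : MvPolynomial (Fin 2) k) ≠ 0)
      simp only [add_mul, Finset.sum_add_distrib, ite_mul, zero_mul, Finset.sum_ite_eq',
        Finset.mem_range]
      rw [if_pos (by omega), mul_zero, ← h, hc', Nat.sub_zero, Nat.sub_zero]
      ring)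
    refine ⟨fun i => match i with | 0 => 0 | 1 => c' | i + 2 => B (i + 1), rfl, hτ, fun i hi => ?_⟩
    rcases i with _ | _ | i
    · simp [hc']
    · have := hB 0 (by omega)
      simp only [h0, if_pos] at this
      simp only
      linear_combination this
    · have := hB (i + 1) (by omega)
      simpa using this

lemma koszulRelation_exact {τ : ℕ} (c : Fin (τ + 1) → MvPolynomial (Fin 2) k)
    (h : ∑ i, c i * monomialForm k τ i = 0) :
    ∃ b : Fin τ → MvPolynomial (Fin 2) k, ∀ i, c i = ∑ j, b j * koszulRelation k j i := by
  obtain ⟨B, h0, hτ, hB⟩ := koszulRelation_exact_nat τ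
    (fun i => if hi : i < τ + 1 then c ⟨i, hi⟩ else 0) (by
      rw [← h, Finset.sum_range]
      exact Finset.sum_congr rfl fun i _ => by rw [dif_pos i.2])
  refine ⟨fun j => B (j + 1), fun i => ?_⟩
  rw [sum_mul_koszulRelation h0 hτ, ← hB i (by omega), dif_pos i.2]

lemma hasMinimalGradedResolution_of_forms {n σ τ : ℕ} (hn : 1 ≤ n)
    {F₁ F₂ : MvPolynomial (Fin 2) k} (h₁ : F₁.IsHomogeneous (n + σ))
    (h₂ : F₂.IsHomogeneous (n + τ)) (hrel : IsRelPrime F₁ F₂) {p q : ℕ}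
    (hp : p = τ + 1 + (σ + 1)) (hq : q = τ + σ + 1) :
    HasMinimalGradedResolution
      ((Ideal.span {X 0, X 1}) ^ τ * Ideal.span {F₁}
        + (Ideal.span {X 0, X 1}) ^ σ * Ideal.span {F₂})
      (fun _ : Fin p => n + σ + τ)
      (fun j : Fin q => if (j : ℕ) < τ + σ then n + σ + τ + 1 else n + σ + τ + n) := by
  subst hp hq
  have hF₂ : F₂ ≠ 0 := by
    rintro rfl
    have hu : IsUnit F₁ := hrel dvd_rfl (dvd_zero _)
    obtain ⟨c, hc, rfl⟩ := isUnit_iff_eq_C_of_isReduced.mp hu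
    have := (isHomogeneous_C (Fin 2) c).inj_right h₁ (by simpa using hc.ne_zero)
    omega
  obtain ⟨q, hq, hF₂q⟩ := h₂.exists_eq_sum_range
  obtain ⟨r, hr, hF₁r⟩ := h₁.exists_eq_sum_range
  rw [Finset.sum_range] at hF₂q hF₁r
  change F₂ = ∑ i : Fin (τ + 1), q i * monomialForm k τ i at hF₂q
  change F₁ = ∑ i : Fin (σ + 1), r i * monomialForm k σ i at hF₁r
  have hcoeff : ∀ {f : MvPolynomial (Fin 2) k} {e : ℕ}, 1 ≤ e → f.IsHomogeneous e →
      coeff 0 f = 0 := fun he hf => hf.coeff_eq_zero (by simp; omega)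
  let g : Fin (τ + 1) ⊕ Fin (σ + 1) → MvPolynomial (Fin 2) k :=
    Sum.elim (fun i => monomialForm k τ i * F₁) (fun i => monomialForm k σ i * F₂)
  let s : (Fin τ ⊕ Fin σ) ⊕ Fin 1 → Fin (τ + 1) ⊕ Fin (σ + 1) → MvPolynomial (Fin 2) k :=
    Sum.elim (Sum.elim (fun j => Sum.elim (fun i => koszulRelation k j i) 0)
      (fun j => Sum.elim 0 (fun i => koszulRelation k j i)))
      (fun _ => Sum.elim (fun i => q i) (fun i => -r i))
  refine .of_equiv finSumFinEquiv.symm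
    ((finSumFinEquiv.sumCongr (Equiv.refl (Fin 1))).trans finSumFinEquiv).symm g s ?_ ?_ ?_ ?_ ?_
    ?_ ?_ ?_
  · intro i
    generalize finSumFinEquiv.symm i = i
    rcases i with i | i
    · simpa [g, add_comm, add_left_comm] using
        (isHomogeneous_monomialForm (k := k) (Nat.le_of_lt_succ i.2)).mul h₁
    · simpa [g, add_comm, add_left_comm] using
        (isHomogeneous_monomialForm (k := k) (Nat.le_of_lt_succ i.2)).mul h₂
  · rw [span_X_pow, span_X_pow, Ideal.span_mul_span', Ideal.span_mul_span', Ideal.add_eq_sup,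
      ← Ideal.span_union, Set.mul_singleton, Set.mul_singleton, ← Set.range_comp, ← Set.range_comp,
      ← Set.Sum.elim_range]
    rfl
  · intro j i
    split_ifs <;> omega
  · intro j i
    generalize finSumFinEquiv.symm i = i
    obtain ⟨j, rfl⟩ := ((finSumFinEquiv.sumCongr (Equiv.refl (Fin 1))).trans
      finSumFinEquiv).surjective j
    rw [Equiv.symm_apply_apply]
    rcases j with (j | j) | j
    · have : (j : ℕ) < τ + σ := by omega
      rcases i with i | i <;>
      simp [s, this, isHomogeneous_koszulRelation, isHomogeneous_zero]
    · rcases i with i | i <;>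
      simp [s, isHomogeneous_koszulRelation, isHomogeneous_zero]
    · rcases i with i | i
      · simpa [s] using hq i
      · simpa [s] using (hr i).neg
  · rintro ((j | j) | j) (i | i) <;>
    simp [s, hcoeff le_rfl (isHomogeneous_koszulRelation _ _), hcoeff hn (hq _), hcoeff hn (hr _)]
  · intro b hb
    have hb₁ : ∀ i : Fin (τ + 1), ∑ j, b (.inl (.inl j)) * koszulRelation k j i
        + b (.inr 0) * q i = 0 := fun i => by simpa [s] using hb (.inl i)
    have hb₂ : ∀ i : Fin (σ + 1), ∑ j, b (.inl (.inr j)) * koszulRelation k j i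
        - b (.inr 0) * r i = 0 := fun i => by simpa [s, sub_eq_add_neg] using hb (.inr i)
    have hlast : b (.inr 0) = 0 := by
      have : ∑ i : Fin (τ + 1), (∑ j, b (.inl (.inl j)) * koszulRelation k j i
        + b (.inr 0) * q i) * monomialForm k τ i = 0 :=
        Finset.sum_eq_zero fun i _ => by rw [hb₁, zero_mul]
      simp only [add_mul, Finset.sum_add_distrib, Finset.sum_mul] at this
      rw [Finset.sum_comm] at this
      simp only [mul_assoc, ← Finset.mul_sum] at this hF₂q
      rw [← hF₂q] at this
      simpa [sum_koszulRelation_mul, hF₂] using this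
    rintro ((j | j) | j)
    · exact koszulRelation_independent _ (fun i => by simpa [hlast] using hb₁ i) j
    · exact koszulRelation_independent _ (fun i => by simpa [hlast] using hb₂ i) j
    · rwa [Subsingleton.elim j 0]
  · rintro ((j | j) | j)
    · simp only [s, g, Fintype.sum_sum_type, Sum.elim_inl, Sum.elim_inr, Pi.zero_apply, zero_mul,
        Finset.sum_const_zero, add_zero, ← mul_assoc, ← Finset.sum_mul]
      simp [sum_koszulRelation_mul]
    · simp only [s, g, Fintype.sum_sum_type, Sum.elim_inl, Sum.elim_inr, Pi.zero_apply, zero_mul,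
        Finset.sum_const_zero, zero_add, ← mul_assoc, ← Finset.sum_mul]
      simp [sum_koszulRelation_mul]
    · simp only [s, g, Fintype.sum_sum_type, Sum.elim_inl, Sum.elim_inr, neg_mul,
        Finset.sum_neg_distrib, ← mul_assoc (q _), ← mul_assoc (r _), ← Finset.sum_mul]
      rw [← hF₂q, ← hF₁r]
      ring
  · intro v hv
    simp only [g, Fintype.sum_sum_type, Sum.elim_inl, Sum.elim_inr, ← mul_assoc (v _),
      ← Finset.sum_mul] at hv
    obtain ⟨h, hh⟩ : F₂ ∣ ∑ i : Fin (τ + 1), v (.inl i) * monomialForm k τ i := by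
      refine hrel.symm.dvd_of_dvd_mul_right
        ⟨-∑ i : Fin (σ + 1), v (.inr i) * monomialForm k σ i, ?_⟩
      linear_combination hv
    have hh' : ∑ i : Fin (σ + 1), v (.inr i) * monomialForm k σ i = -h * F₁ := by
      apply mul_right_cancel₀ hF₂
      linear_combination hv - F₁ * hh
    obtain ⟨b, hb⟩ := koszulRelation_exact (fun i => v (.inl i) - h * q i) (by
      simp only [sub_mul, Finset.sum_sub_distrib, mul_assoc h, ← Finset.mul_sum]
      rw [hh, ← hF₂q]
      ring)
    obtain ⟨c, hc⟩ := koszulRelation_exact (fun i => v (.inr i) + h * r i) (by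
      simp only [add_mul, Finset.sum_add_distrib, mul_assoc h, ← Finset.mul_sum]
      rw [hh', ← hF₁r]
      ring)
    refine ⟨Sum.elim (Sum.elim b c) fun _ => h, ?_⟩
    rintro (i | i)
    · simp [s, ← hb i]
    · simp [s, ← hc i]

end OfForms

section ToForms

variable {k : Type*} [Field k]

attribute [local instance] MvPolynomial.gradedAlgebra

lemma height_idealOfVars_fin_two_le : (idealOfVars (Fin 2) k).height ≤ 2 := by
  have hne : idealOfVars (Fin 2) k ≠ ⊤ := by
    rw [Ne, Ideal.eq_top_iff_one, ← pow_one (idealOfVars (Fin 2) k), mem_pow_idealOfVars_iff']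
    intro h
    simpa using h 0 (by simp)
  refine (Ideal.height_le_spanFinrank _ hne).trans ?_
  have h1 := Submodule.spanFinrank_span_le_ncard_of_finite (R := MvPolynomial (Fin 2) k)
    (Set.finite_range (X : Fin 2 → MvPolynomial (Fin 2) k))
  have h2 : (Set.range (X : Fin 2 → MvPolynomial (Fin 2) k)).ncard ≤ 2 := by
    rw [← Set.image_univ]
    exact (Set.ncard_image_le Set.finite_univ).trans (by simp)
  exact_mod_cast h1.trans h2

/-- The radical of a homogeneous ideal of height two contains both variables. -/
lemma X_mem_radical_of_idealHeight_eq_two {I : Ideal (MvPolynomial (Fin 2) k)}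
    (hI : I.IsHomogeneous (homogeneousSubmodule (Fin 2) k)) (hht : idealHeight I = 2)
    (i : Fin 2) : X i ∈ I.radical := by
  rw [Ideal.radical_eq_sInf, Ideal.mem_sInf]
  rintro P ⟨hIP, hP⟩
  set Q := (P.homogeneousCore (homogeneousSubmodule (Fin 2) k)).toIdeal with hQ
  have hQP : Q ≤ P := Ideal.toIdeal_homogeneousCore_le _ _
  have hQprime : Q.IsPrime := hP.homogeneousCore
  have hQhom : Q.IsHomogeneous (homogeneousSubmodule (Fin 2) k) :=
    (P.homogeneousCore (homogeneousSubmodule (Fin 2) k)).isHomogeneous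
  have hIQ : I ≤ Q := by
    have h := Ideal.homogeneousCore_mono (homogeneousSubmodule (Fin 2) k) hIP
    calc I = (I.homogeneousCore (homogeneousSubmodule (Fin 2) k)).toIdeal :=
        hI.toIdeal_homogeneousCore_eq_self.symm
      _ ≤ Q := h
  have hQ2 : 2 ≤ Q.height := by
    have := PrimeSpectrum.height_eq_orderHeight ⟨Q, hQprime⟩
    simp only at this
    rw [this, ← hht, idealHeight]
    exact iInf₂_le_of_le ⟨Q, hQprime⟩ hIQ le_rfl
  have hQM : Q ≤ idealOfVars (Fin 2) k := by
    intro f hf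
    rw [← pow_one (idealOfVars (Fin 2) k), mem_pow_idealOfVars_iff']
    intro d hd
    obtain rfl : d = 0 := by rwa [Nat.lt_one_iff, Finsupp.degree_eq_zero_iff] at hd
    by_contra h
    have := homogeneousComponent_mem_of_mem hQhom hf 0
    rw [homogeneousComponent_zero] at this
    exact hQprime.ne_top (Ideal.eq_top_of_isUnit_mem _ this ((Ne.isUnit h).map C))
  have hfin : Q.FiniteHeight := inferInstance
  have hQeq : Q = idealOfVars (Fin 2) k :=
    Ideal.eq_of_le_of_height_le Q hQM (height_idealOfVars_fin_two_le.trans hQ2)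
  rw [hQeq] at hQP
  exact hQP (Ideal.subset_span ⟨i, rfl⟩)

variable {m p : ℕ}

/-- The `k`-linear map `u ↦ S u` on vectors of forms of degree `e`, for a matrix `S` of
linear forms. -/
noncomputable def linearFormsMap (S : Fin p → Fin m → MvPolynomial (Fin 2) k)
    (hS : ∀ j i, (S j i).IsHomogeneous 1) (e : ℕ) :
    (Fin m → homogeneousSubmodule (Fin 2) k e) →ₗ[k]
      (Fin p → homogeneousSubmodule (Fin 2) k (e + 1)) where
  toFun u j := ⟨∑ i, (u i : MvPolynomial (Fin 2) k) * S j i,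
    IsHomogeneous.sum _ _ _ fun i _ => (u i).2.mul (hS j i)⟩
  map_add' u v := by
    ext1 j
    apply Subtype.ext
    simp [add_mul, Finset.sum_add_distrib]
  map_smul' c u := by
    ext1 j
    apply Subtype.ext
    simp [Finset.smul_sum]

/-- Multiplication of a fixed vector of forms of degree `a` by forms of degree `c`. -/
noncomputable def formSMul {a c e : ℕ} (h : c + a = e)
    (u : Fin m → homogeneousSubmodule (Fin 2) k a) :
    homogeneousSubmodule (Fin 2) k c →ₗ[k] (Fin m → homogeneousSubmodule (Fin 2) k e) where
  toFun f i := ⟨f * u i, h ▸ f.2.mul (u i).2⟩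
  map_add' f g := by
    ext1 i
    apply Subtype.ext
    simp [add_mul]
  map_smul' c f := by
    ext1 i
    apply Subtype.ext
    simp

lemma mem_ker_linearFormsMap {S : Fin p → Fin m → MvPolynomial (Fin 2) k}
    {hS : ∀ j i, (S j i).IsHomogeneous 1} {e : ℕ}
    {u : Fin m → homogeneousSubmodule (Fin 2) k e} :
    u ∈ LinearMap.ker (linearFormsMap S hS e) ↔
      ∀ j, ∑ i, (u i : MvPolynomial (Fin 2) k) * S j i = 0 := by
  rw [LinearMap.mem_ker, funext_iff]
  exact forall_congr' fun j => Subtype.ext_iff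

lemma formSMul_mem_ker {S : Fin p → Fin m → MvPolynomial (Fin 2) k}
    {hS : ∀ j i, (S j i).IsHomogeneous 1} {a c e : ℕ} (h : c + a = e)
    {u : Fin m → homogeneousSubmodule (Fin 2) k a}
    (hu : u ∈ LinearMap.ker (linearFormsMap S hS a)) (f : homogeneousSubmodule (Fin 2) k c) :
    formSMul h u f ∈ LinearMap.ker (linearFormsMap S hS e) := by
  rw [mem_ker_linearFormsMap] at hu ⊢
  intro j
  simp [formSMul, mul_assoc, ← Finset.mul_sum, hu j]

lemma finrank_forms (q e : ℕ) :
    Module.finrank k (Fin q → homogeneousSubmodule (Fin 2) k e) = q * (e + 1) := by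
  rw [Module.finrank_pi_fintype]
  simp [finrank_homogeneousSubmodule_fin_two]

lemma le_finrank_ker_linearFormsMap (S : Fin p → Fin (p + 2) → MvPolynomial (Fin 2) k)
    (hS : ∀ j i, (S j i).IsHomogeneous 1) (e : ℕ) :
    2 * e + 2 ≤ Module.finrank k (LinearMap.ker (linearFormsMap S hS e)) + p := by
  have h1 := (linearFormsMap S hS e).finrank_range_add_finrank_ker
  have h2 := (LinearMap.range (linearFormsMap S hS e)).finrank_le
  rw [finrank_forms] at h1 h2
  nlinarith

/-- The kernel of a `p × (p + 2)` matrix of linear forms contains vectors `u` of degree `a` and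
`v` of degree `p - a`, linearly independent over `k[x,y]`. -/
lemma exists_independent_kernel_vectors (S : Fin p → Fin (p + 2) → MvPolynomial (Fin 2) k)
    (hS : ∀ j i, (S j i).IsHomogeneous 1) :
    ∃ (a b : ℕ) (u : Fin (p + 2) → homogeneousSubmodule (Fin 2) k a)
      (v : Fin (p + 2) → homogeneousSubmodule (Fin 2) k b), a + b = p ∧
      u ∈ LinearMap.ker (linearFormsMap S hS a) ∧ v ∈ LinearMap.ker (linearFormsMap S hS b) ∧
      ∀ f g : MvPolynomial (Fin 2) k, (∀ i, f * u i + g * v i = 0) → f = 0 ∧ g = 0 := by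
  classical
  have hex : ∃ a, LinearMap.ker (linearFormsMap S hS a) ≠ ⊥ := by
    refine ⟨p, fun h => ?_⟩
    have := le_finrank_ker_linearFormsMap S hS p
    rw [h, finrank_bot] at this
    omega
  obtain ⟨a, ha, hmin⟩ : ∃ a, LinearMap.ker (linearFormsMap S hS a) ≠ ⊥ ∧
      ∀ c < a, LinearMap.ker (linearFormsMap S hS c) = ⊥ :=
    ⟨Nat.find hex, Nat.find_spec hex, fun c hc => by simpa using Nat.find_min hex hc⟩
  have hap : a ≤ p - a := by
    have : a ≤ p / 2 := by
      by_contra! h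
      have h := hmin _ h
      have := le_finrank_ker_linearFormsMap S hS (p / 2)
      rw [h, finrank_bot] at this
      omega
    omega
  obtain ⟨u, hu, hu0⟩ := Submodule.exists_mem_ne_zero_of_ne_bot ha
  obtain ⟨v, hv, hvu⟩ : ∃ v ∈ LinearMap.ker (linearFormsMap S hS (p - a)),
      v ∉ LinearMap.range (formSMul (show (p - a - a) + a = p - a by omega) u) := by
    by_contra! h
    have h1 := Submodule.finrank_mono (show _ ≤ _ from h)
    have h2 := LinearMap.finrank_range_le
      (formSMul (show (p - a - a) + a = p - a by omega) u)
    rw [finrank_homogeneousSubmodule_fin_two] at h2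
    have := le_finrank_ker_linearFormsMap S hS (p - a)
    omega
  obtain ⟨i₀, hi₀⟩ : ∃ i, (u i : MvPolynomial (Fin 2) k) ≠ 0 := by
    by_contra! h
    exact hu0 (funext fun i => Subtype.ext (h i))
  refine ⟨a, p - a, u, v, by omega, hu, hv, fun f g hfg => ?_⟩
  suffices hg : g = 0 by
    subst hg
    simpa [hi₀] using hfg i₀
  by_contra hg
  obtain ⟨g', f', h, hrel, rfl, rfl⟩ := UniqueFactorizationMonoid.exists_reduced_factors g hg f
  have hh : h ≠ 0 := left_ne_zero_of_mul hg
  have hg' : g' ≠ 0 := right_ne_zero_of_mul hg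
  have hfg' : ∀ i, f' * u i + g' * v i = 0 := fun i =>
    mul_left_cancel₀ hh (by linear_combination hfg i)
  have hdvd : ∀ i, ∃ w, (u i : MvPolynomial (Fin 2) k) = g' * w := fun i =>
    hrel.dvd_of_dvd_mul_left ⟨-v i, by linear_combination hfg' i⟩
  choose w hw using hdvd
  -- By minimality of `a`, the vector `u` is not divisible by a nonconstant form.
  obtain ⟨c, c', hcc', hgc, -⟩ := exists_isHomogeneous_of_mul (hw i₀ ▸ (u i₀).2) (hw i₀ ▸ hi₀)
  have hwhom : ∀ i, (w i).IsHomogeneous c' := fun i =>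
    isHomogeneous_of_mul_left hgc hg' (by rw [hcc', ← hw i]; exact (u i).2)
  have hc0 : c = 0 := by
    by_contra hc0
    have hbot := hmin c' (by omega)
    have hmem : (fun i => ⟨w i, hwhom i⟩ : Fin (p + 2) → homogeneousSubmodule (Fin 2) k c') ∈
        LinearMap.ker (linearFormsMap S hS c') := by
      rw [mem_ker_linearFormsMap] at hu ⊢
      intro j
      apply mul_left_cancel₀ hg'
      simpa [Finset.mul_sum, ← mul_assoc, ← hw] using hu j
    rw [hbot, Submodule.mem_bot] at hmem
    apply hi₀
    rw [hw i₀, show w i₀ = 0 from congrArg Subtype.val (congrFun hmem i₀), mul_zero]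
  subst hc0
  obtain ⟨r, rfl⟩ : ∃ r, g' = C r := ⟨coeff 0 g', totalDegree_eq_zero_iff_eq_C.mp
    (Nat.le_zero.mp hgc.totalDegree_le)⟩
  have hr : r ≠ 0 := by simpa using hg'
  have hvf : ∀ i, (v i : MvPolynomial (Fin 2) k) =
      -C r⁻¹ * f' * (u i : MvPolynomial (Fin 2) k) := fun i => by
    have : (C r⁻¹ * C r : MvPolynomial (Fin 2) k) = 1 := by
      rw [← C_mul, inv_mul_cancel₀ hr, C_1]
    linear_combination C r⁻¹ * hfg' i - (v i : MvPolynomial (Fin 2) k) * this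
  apply hvu
  have hfhom : (-C r⁻¹ * f').IsHomogeneous (p - a - a) :=
    isHomogeneous_of_mul_left (u i₀).2 hi₀ (by
      rw [mul_comm, ← hvf i₀, show a + (p - a - a) = p - a by omega]
      exact (v i₀).2)
  exact ⟨⟨_, hfhom⟩, funext fun i => Subtype.ext (hvf i).symm⟩

/-- If the matrix `S` of linear forms is surjective in degree `e`, its kernel in degree `e` is
generated by the two vectors of `exists_independent_kernel_vectors`. -/
lemma exists_eq_of_mem_ker {S : Fin p → Fin (p + 2) → MvPolynomial (Fin 2) k}
    {hS : ∀ j i, (S j i).IsHomogeneous 1} {a b e : ℕ} (hab : a + b = p) (he : p ≤ e)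
    {u : Fin (p + 2) → homogeneousSubmodule (Fin 2) k a}
    {v : Fin (p + 2) → homogeneousSubmodule (Fin 2) k b}
    (hu : u ∈ LinearMap.ker (linearFormsMap S hS a))
    (hv : v ∈ LinearMap.ker (linearFormsMap S hS b))
    (hind : ∀ f g : MvPolynomial (Fin 2) k, (∀ i, f * u i + g * v i = 0) → f = 0 ∧ g = 0)
    (hsurj : Function.Surjective (linearFormsMap S hS e))
    {w : Fin (p + 2) → homogeneousSubmodule (Fin 2) k e}
    (hw : w ∈ LinearMap.ker (linearFormsMap S hS e)) :
    ∃ f g : MvPolynomial (Fin 2) k, f.IsHomogeneous (e - a) ∧ g.IsHomogeneous (e - b) ∧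
      ∀ i, (w i : MvPolynomial (Fin 2) k) = f * u i + g * v i := by
  let T := (formSMul (show e - a + a = e by omega) u).coprod
    (formSMul (show e - b + b = e by omega) v)
  have hT : LinearMap.range T = LinearMap.ker (linearFormsMap S hS e) := by
    apply Submodule.eq_of_le_of_finrank_eq
    · rintro _ ⟨⟨f, g⟩, rfl⟩
      exact add_mem (formSMul_mem_ker (show e - a + a = e by omega) hu f)
        (formSMul_mem_ker (show e - b + b = e by omega) hv g)
    · have hinj : Function.Injective T := by
        rw [← LinearMap.ker_eq_bot, LinearMap.ker_eq_bot']
        rintro ⟨f, g⟩ h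
        obtain ⟨hf, hg⟩ := hind f g fun i => congrArg Subtype.val (congrFun h i)
        exact Prod.ext (Subtype.ext hf) (Subtype.ext hg)
      rw [LinearMap.finrank_range_of_inj hinj, Module.finrank_prod,
        finrank_homogeneousSubmodule_fin_two, finrank_homogeneousSubmodule_fin_two]
      have h1 := (linearFormsMap S hS e).finrank_range_add_finrank_ker
      rw [LinearMap.range_eq_top.mpr hsurj, finrank_top, finrank_forms, finrank_forms] at h1
      have h2 : (p + 2) * (e + 1) = p * (e + 1 + 1) + (2 * e + 2 - p) := by
        have : p + (2 * e + 2 - p) = 2 * e + 2 := by omega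
        nlinarith
      omega
  rw [← hT] at hw
  obtain ⟨⟨f, g⟩, rfl⟩ := hw
  exact ⟨f, g, f.2, g.2, fun i => rfl⟩

/-- The cokernel of the transpose of the syzygy matrix of `g` is annihilated by the ideal
generated by `g`. -/
lemma exists_mulVec_eq_of_forall_mem_span {R : Type*} [CommRing R] {m q : ℕ} {g : Fin m → R}
    {s : Fin q → Fin m → R} (hind : LinearIndependent R s)
    (hsyz : ∀ v : Fin m → R, ∑ i, v i * g i = 0 ↔ v ∈ Submodule.span R (Set.range s))
    {w : Fin q → R} (hw : ∀ j, w j ∈ Ideal.span (Set.range g)) :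
    ∃ u, (Matrix.of s).mulVec u = w := by
  classical
  have key : ∀ i, ∀ w : Fin q → R, g i • w ∈ LinearMap.range (Matrix.of s).mulVecLin := by
    intro i w
    have hmem : ∀ l, ∃ c : Fin q → R, ∑ j, c j • s j =
        g i • Pi.single l 1 - g l • Pi.single i 1 := by
      intro l
      rw [← Submodule.mem_span_range_iff_exists_fun, ← hsyz]
      simp [sub_mul, Finset.sum_sub_distrib, Pi.single_apply, mul_comm (g i)]
    choose c hc using hmem
    have hs : ∀ j, ∑ l, s j l * g l = 0 := fun j =>
      (hsyz _).mpr (Submodule.subset_span ⟨j, rfl⟩)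
    have hδ : ∀ j j', ∑ l, s j l * c l j' = if j = j' then g i else 0 := by
      intro j
      have : ∑ j', (∑ l, s j l * c l j' - if j = j' then g i else 0) • s j' = 0 := by
        calc _ = ∑ l, s j l • ∑ j', c l j' • s j' - g i • s j := by
              simp only [sub_smul, Finset.sum_sub_distrib, Finset.sum_smul, Finset.smul_sum,
                ite_smul, zero_smul, Finset.sum_ite_eq, Finset.mem_univ, if_true, mul_smul]
              rw [Finset.sum_comm]
          _ = 0 := by
              ext1 t
              simp only [hc, Finset.sum_apply, Pi.sub_apply, Pi.smul_apply, smul_eq_mul, mul_sub,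
                Finset.sum_sub_distrib, Pi.zero_apply, ← mul_assoc, ← Finset.sum_mul, hs]
              simp [Pi.single_apply, mul_comm]
      exact fun j' => sub_eq_zero.mp (Fintype.linearIndependent_iff.mp hind _ this j')
    refine ⟨fun l => ∑ j', c l j' * w j', ?_⟩
    ext1 j
    simp only [Matrix.mulVecLin_apply, Matrix.mulVec, dotProduct, Matrix.of_apply, Finset.mul_sum,
      Pi.smul_apply, smul_eq_mul]
    rw [Finset.sum_comm]
    simp [← mul_assoc, ← Finset.sum_mul, hδ]
  have key' : ∀ f ∈ Ideal.span (Set.range g), ∀ w : Fin q → R,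
      f • w ∈ LinearMap.range (Matrix.of s).mulVecLin := by
    intro f hf w
    induction hf using Submodule.span_induction with
    | mem f hf => obtain ⟨i, rfl⟩ := hf; exact key i w
    | zero => rw [zero_smul]; exact zero_mem _
    | add f f' _ _ hf hf' => rw [add_smul]; exact add_mem hf hf'
    | smul a f _ hf => rw [smul_assoc]; exact Submodule.smul_mem _ a hf
  rw [pi_eq_sum_univ' w]
  exact sum_mem fun j _ => key' _ (hw j) _

lemma isHomogeneous_mem_of_X_pow_mem {I : Ideal (MvPolynomial (Fin 2) k)} {N : ℕ}
    (h0 : X 0 ^ N ∈ I) (h1 : X 1 ^ N ∈ I) {f : MvPolynomial (Fin 2) k} {e : ℕ}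
    (hf : f.IsHomogeneous (e + 2 * N)) : f ∈ I := by
  obtain ⟨q, -, rfl⟩ := hf.exists_eq_sum_range
  refine sum_mem fun i _ => I.mul_mem_left _ ?_
  rcases le_total N i with h | h
  · exact I.mul_mem_right _ (I.pow_mem_of_pow_mem h0 h)
  · exact I.mul_mem_left _ (I.pow_mem_of_pow_mem h1 (by omega))

lemma surjective_linearFormsMap {S : Fin p → Fin m → MvPolynomial (Fin 2) k}
    (hS : ∀ j i, (S j i).IsHomogeneous 1) {I : Ideal (MvPolynomial (Fin 2) k)} {N : ℕ}
    (h0 : X 0 ^ N ∈ I) (h1 : X 1 ^ N ∈ I)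
    (hI : ∀ w : Fin p → MvPolynomial (Fin 2) k, (∀ j, w j ∈ I) →
      ∃ u, (Matrix.of S).mulVec u = w) {e : ℕ} (he : 2 * N ≤ e) :
    Function.Surjective (linearFormsMap S hS e) := by
  intro w
  obtain ⟨u, hu⟩ := hI (fun j => w j) fun j =>
    isHomogeneous_mem_of_X_pow_mem (e := e + 1 - 2 * N) h0 h1 (by
      rw [Nat.sub_add_cancel (by omega)]; exact (w j).2)
  refine ⟨fun l => ⟨homogeneousComponent e (u l), homogeneousComponent_isHomogeneous _ _⟩, ?_⟩
  ext1 j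
  apply Subtype.ext
  have := congrArg (homogeneousComponent (e + 1)) (congrFun hu j)
  rw [homogeneousComponent_of_mem (w j).2, if_pos rfl] at this
  rw [← this]
  simp only [linearFormsMap, LinearMap.coe_mk, AddHom.coe_mk, Matrix.mulVec, dotProduct,
    Matrix.of_apply, map_sum, mul_comm (S j _)]
  exact Finset.sum_congr rfl fun i _ =>
    (homogeneousComponent_mul_of_isHomogeneous (hS j i) _ _).symm

/-- A vector of forms in the kernel of `S` is a combination of the two vectors of
`exists_independent_kernel_vectors`, if `S` is surjective in all large degrees. -/
lemma exists_eq_of_mem_ker_of_surjective {S : Fin p → Fin (p + 2) → MvPolynomial (Fin 2) k}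
    {hS : ∀ j i, (S j i).IsHomogeneous 1} {a b d N : ℕ} (hab : a + b = p) (hd : p ≤ d)
    {u : Fin (p + 2) → homogeneousSubmodule (Fin 2) k a}
    {v : Fin (p + 2) → homogeneousSubmodule (Fin 2) k b}
    (hu : u ∈ LinearMap.ker (linearFormsMap S hS a))
    (hv : v ∈ LinearMap.ker (linearFormsMap S hS b))
    (hind : ∀ f g : MvPolynomial (Fin 2) k, (∀ i, f * u i + g * v i = 0) → f = 0 ∧ g = 0)
    (hsurj : Function.Surjective (linearFormsMap S hS (N + d)))
    {w : Fin (p + 2) → homogeneousSubmodule (Fin 2) k d}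
    (hw : w ∈ LinearMap.ker (linearFormsMap S hS d)) :
    ∃ f g : MvPolynomial (Fin 2) k, f.IsHomogeneous (d - a) ∧ g.IsHomogeneous (d - b) ∧
      ∀ i, (w i : MvPolynomial (Fin 2) k) = f * u i + g * v i := by
  have hX : ∀ i : Fin 2, ∃ A B : MvPolynomial (Fin 2) k, A.IsHomogeneous (N + (d - a)) ∧
      B.IsHomogeneous (N + (d - b)) ∧
      ∀ j, X i ^ N * (w j : MvPolynomial (Fin 2) k) =
        A * (u j : MvPolynomial (Fin 2) k) + B * (v j : MvPolynomial (Fin 2) k) := by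
    intro i
    obtain ⟨A, B, hA, hB, h⟩ := exists_eq_of_mem_ker hab (by omega) hu hv hind hsurj
      (formSMul_mem_ker (c := N) rfl hw ⟨X i ^ N, isHomogeneous_X_pow i N⟩)
    exact ⟨A, B, by rwa [← Nat.add_sub_assoc (by omega)],
      by rwa [← Nat.add_sub_assoc (by omega)], h⟩
  obtain ⟨A, B, hA, hB, h0⟩ := hX 0
  obtain ⟨C, D, -, -, h1⟩ := hX 1
  obtain ⟨hAC, hBD⟩ := hind (X 1 ^ N * A - X 0 ^ N * C) (X 1 ^ N * B - X 0 ^ N * D) fun j => by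
    linear_combination X 0 ^ N * h1 j - X 1 ^ N * h0 j
  obtain ⟨f, rfl⟩ := (isRelPrime_X_pow (k := k) N N).dvd_of_dvd_mul_left
    ⟨C, sub_eq_zero.mp hAC⟩
  obtain ⟨g, rfl⟩ := (isRelPrime_X_pow (k := k) N N).dvd_of_dvd_mul_left
    ⟨D, sub_eq_zero.mp hBD⟩
  have hXN : (X 0 ^ N : MvPolynomial (Fin 2) k) ≠ 0 := pow_ne_zero _ (X_ne_zero _)
  refine ⟨f, g, isHomogeneous_of_mul_left (isHomogeneous_X_pow 0 N) hXN hA,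
    isHomogeneous_of_mul_left (isHomogeneous_X_pow 0 N) hXN hB, fun j => ?_⟩
  apply mul_left_cancel₀ hXN
  linear_combination h0 j

lemma mem_span_X_pow_of_isHomogeneous {f : MvPolynomial (Fin 2) k} {e : ℕ}
    (hf : f.IsHomogeneous e) :
    f ∈ (Ideal.span {X 0, X 1} : Ideal (MvPolynomial (Fin 2) k)) ^ e := by
  rw [← Nat.zero_add e] at hf
  obtain ⟨q, -, rfl⟩ := hf.exists_eq_sum_range
  rw [span_X_pow]
  exact sum_mem fun i hi => Ideal.mul_mem_left _ _
    (Ideal.subset_span ⟨⟨i, Finset.mem_range.mp hi⟩, rfl⟩)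

/-- An ideal minimally generated by `a + b + 2` elements of the form `u F + v G`, with `u` and `v`
forms of degrees `a` and `b`, contains all such elements. -/
lemma eq_add_of_span_eq {a b : ℕ} {I : Ideal (MvPolynomial (Fin 2) k)} (hm : m = a + b + 2)
    {g : Fin m → MvPolynomial (Fin 2) k} (hI : Ideal.span (Set.range g) = I)
    (hmin : ∀ j, g j ∉ Ideal.span (g '' {j' | j' ≠ j})) {F G : MvPolynomial (Fin 2) k}
    {u : Fin m → homogeneousSubmodule (Fin 2) k a} {v : Fin m → homogeneousSubmodule (Fin 2) k b}
    (hg : ∀ i, g i = F * u i + G * v i) :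
    I = (Ideal.span {X 0, X 1}) ^ a * Ideal.span {F}
      + (Ideal.span {X 0, X 1}) ^ b * Ideal.span {G} := by
  have hlin : LinearIndependent k g := by
    rw [linearIndependent_iff_notMem_span]
    intro i hi
    apply hmin i
    have := Submodule.span_le_restrictScalars k (MvPolynomial (Fin 2) k) _ hi
    rwa [← Set.compl_eq_univ_sdiff] at this
  let T : (homogeneousSubmodule (Fin 2) k a × homogeneousSubmodule (Fin 2) k b) →ₗ[k]
      MvPolynomial (Fin 2) k :=
    (LinearMap.mulLeft k F ∘ₗ (homogeneousSubmodule (Fin 2) k a).subtype).coprod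
      (LinearMap.mulLeft k G ∘ₗ (homogeneousSubmodule (Fin 2) k b).subtype)
  have hT : Submodule.span k (Set.range g) = LinearMap.range T := by
    apply Submodule.eq_of_le_of_finrank_le
    · rw [Submodule.span_le]
      rintro _ ⟨i, rfl⟩
      exact ⟨(u i, v i), (hg i).symm⟩
    · refine (LinearMap.finrank_range_le T).trans ?_
      rw [finrank_span_eq_card hlin, Module.finrank_prod, finrank_homogeneousSubmodule_fin_two,
        finrank_homogeneousSubmodule_fin_two, Fintype.card_fin]
      omega
  have hTI : ∀ x, T x ∈ I := by
    intro x
    rw [← hI]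
    exact Submodule.span_le_restrictScalars k (MvPolynomial (Fin 2) k) _
      (hT ▸ LinearMap.mem_range_self T x)
  apply le_antisymm
  · rw [← hI, Ideal.span_le]
    rintro _ ⟨i, rfl⟩
    rw [hg, mul_comm F, mul_comm G, SetLike.mem_coe]
    exact Submodule.add_mem_sup
      (Ideal.mul_mem_mul (mem_span_X_pow_of_isHomogeneous (u i).2)
        (Ideal.mem_span_singleton_self F))
      (Ideal.mul_mem_mul (mem_span_X_pow_of_isHomogeneous (v i).2)
        (Ideal.mem_span_singleton_self G))
  · have hhom : ∀ (e : ℕ) (i : Fin (e + 1)),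
        (X 0 ^ (i : ℕ) * X 1 ^ (e - i) : MvPolynomial (Fin 2) k).IsHomogeneous e :=
      fun e i => isHomogeneous_monomialForm (Nat.le_of_lt_succ i.2)
    rw [span_X_pow, span_X_pow, Ideal.span_mul_span', Ideal.span_mul_span', Ideal.add_eq_sup,
      sup_le_iff, Ideal.span_le, Ideal.span_le, Set.mul_singleton, Set.mul_singleton]
    constructor
    · rintro _ ⟨_, ⟨i, rfl⟩, rfl⟩
      simpa [T, mul_comm F] using hTI (⟨_, hhom a i⟩, 0)
    · rintro _ ⟨_, ⟨i, rfl⟩, rfl⟩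
      simpa [T, mul_comm G] using hTI (0, ⟨_, hhom b i⟩)

lemma exists_forms_of_hasMinimalGradedResolution {n p : ℕ} {I : Ideal (MvPolynomial (Fin 2) k)}
    (hht : idealHeight I = 2) {t : ℕ}
    (h : HasMinimalGradedResolution I (fun _ : Fin (p + 2) => n + p)
      (fun j : Fin (p + 1) => if (j : ℕ) < p then n + p + 1 else t)) :
    ∃ (σ τ : ℕ) (F₁ F₂ : MvPolynomial (Fin 2) k), σ + τ = p ∧
      F₁.IsHomogeneous (n + σ) ∧ F₂.IsHomogeneous (n + τ) ∧ IsRelPrime F₁ F₂ ∧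
      I = (Ideal.span {X 0, X 1}) ^ τ * Ideal.span {F₁}
        + (Ideal.span {X 0, X 1}) ^ σ * Ideal.span {F₂} := by
  obtain ⟨g, s, hg, hI, hmin, hs, -, hind, hsyz⟩ := h
  have hIhom : I.IsHomogeneous (homogeneousSubmodule (Fin 2) k) := by
    rw [← hI]
    apply Ideal.homogeneous_span
    rintro _ ⟨i, rfl⟩
    exact ⟨_, hg i⟩
  obtain ⟨N₀, hN₀⟩ := X_mem_radical_of_idealHeight_eq_two hIhom hht 0
  obtain ⟨N₁, hN₁⟩ := X_mem_radical_of_idealHeight_eq_two hIhom hht 1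
  obtain ⟨N, h0, h1⟩ : ∃ N, (X 0 ^ N : MvPolynomial (Fin 2) k) ∈ I ∧
      (X 1 ^ N : MvPolynomial (Fin 2) k) ∈ I :=
    ⟨N₀ + N₁, I.pow_mem_of_pow_mem hN₀ (by omega), I.pow_mem_of_pow_mem hN₁ (by omega)⟩
  let S : Fin p → Fin (p + 2) → MvPolynomial (Fin 2) k := fun j => s j.castSucc
  have hS : ∀ j i, (S j i).IsHomogeneous 1 := fun j i => by
    simpa [S] using (hs j.castSucc i).1
  have hsurj : Function.Surjective (linearFormsMap S hS (2 * N + (n + p))) := by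
    refine surjective_linearFormsMap hS h0 h1 (fun w hw => ?_) (by omega)
    obtain ⟨u, hu⟩ := exists_mulVec_eq_of_forall_mem_span hind hsyz
      (w := Fin.snoc (α := fun _ => MvPolynomial (Fin 2) k) w 0) (by
        refine Fin.lastCases ?_ fun j => ?_
        · simp
        · simpa [hI] using hw j)
    exact ⟨u, funext fun j => by
      have := congrFun hu j.castSucc
      rwa [Fin.snoc_castSucc] at this⟩
  obtain ⟨a, b, u, v, hab, hu, hv, huv⟩ := exists_independent_kernel_vectors S hS
  obtain ⟨F, G, hF, hG, hFG⟩ := exists_eq_of_mem_ker_of_surjective hab (Nat.le_add_left p n)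
    hu hv huv hsurj (w := fun i => ⟨g i, hg i⟩) (by
      rw [mem_ker_linearFormsMap]
      intro j
      simpa [S, mul_comm] using (hsyz (s j.castSucc)).mpr (Submodule.subset_span ⟨_, rfl⟩))
  refine ⟨b, a, F, G, by omega, ?_, ?_, fun c hcF hcG => ?_,
    eq_add_of_span_eq (by omega) hI hmin hFG⟩
  · rwa [show n + b = n + p - a by omega]
  · rwa [show n + a = n + p - b by omega]
  · have hIc : I ≤ Ideal.span {c} := by
      rw [← hI, Ideal.span_le]
      rintro _ ⟨i, rfl⟩
      rw [SetLike.mem_coe, Ideal.mem_span_singleton]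
      exact (dvd_add (hcF.mul_right _) (hcG.mul_right _)).trans (hFG i).symm.dvd
    exact isRelPrime_X_pow (k := k) N N (Ideal.mem_span_singleton.mp (hIc h0))
      (Ideal.mem_span_singleton.mp (hIc h1))

end ToForms

/-!
STATEMENT 5 (Corollary C2.4).  A height two ideal `I ⊆ R = k[x,y]` has a minimal
homogeneous free resolution
`0 → R(−d−1)^{m−2} ⊕ R(−d−n) → R(−d)^m → I → 0`  (with `d = n+m−2`)
if and only if there are non-negative integers `σ + τ = m−2` and relatively prime forms
`F₁`, `F₂` of degrees `n+σ`, `n+τ` with `I = (x,y)^τ F₁ + (x,y)^σ F₂`.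
-/

theorem resolution_iff_truncation
    {k : Type*} [Field k] (m n : ℕ) (hm : 2 ≤ m) (hn : 1 ≤ n)
    (d : ℕ) (hd : d = n + m - 2)
    (I : Ideal (MvPolynomial (Fin 2) k))
    (hht : idealHeight I = 2) :
    HasMinimalGradedResolution I (fun _ : Fin m => d)
        (fun j : Fin (m - 1) => if (j : ℕ) < m - 2 then d + 1 else d + n)
      ↔
    ∃ (σ τ : ℕ) (F₁ F₂ : MvPolynomial (Fin 2) k),
      σ + τ = m - 2 ∧
      F₁.IsHomogeneous (n + σ) ∧ F₂.IsHomogeneous (n + τ) ∧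
      IsRelPrime F₁ F₂ ∧
      I = (Ideal.span {X 0, X 1}) ^ τ * Ideal.span {F₁}
        + (Ideal.span {X 0, X 1}) ^ σ * Ideal.span {F₂} := by
  obtain ⟨p, rfl⟩ := Nat.exists_eq_add_of_le' hm
  obtain rfl : d = n + p := by omega
  constructor
  · exact exists_forms_of_hasMinimalGradedResolution hht
  · rintro ⟨σ, τ, F₁, F₂, hστ, h₁, h₂, hrel, rfl⟩
    obtain rfl : σ + τ = p := hστ
    have := hasMinimalGradedResolution_of_forms hn h₁ h₂ hrel (p := σ + τ + 2)
      (q := σ + τ + 2 - 1) (by omega) (by omega)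
    rw [Nat.add_comm τ σ, Nat.add_assoc n] at this
    exact this
end
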